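/- (Propagation of chaos.) Assume the interaction kernel K satisfies (HK1)-(HK2). Let f^in be a probability density on ℝ^d with ∫|z|^{d+5} f^in(z) dz < ∞. Let F_N^in := (f^in·Leb)^{⊗N} and F_N(t) := T_t#F_N^in. Let f(t,·) be the unique weak solution of the mean field PDE ∂_t f + div_z(f 𝒦f) = 0 with f(0,·) = f^in. Then for each j ≥ 1 and each t ∈ ℝ, the j-particle marginal F_{N:j}(t) converges to (f(t,·)·Leb)^{⊗j} weakly in the sense of probability measures on (ℝ^d)^j as N → ∞. -/

import Mathlib

open MeasureTheory Real Filter Topology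
open scoped ENNReal NNReal

noncomputable section

/-- The measure with density `g` with respect to Lebesgue measure on `ℝ^d`. -/
def densMeasure {d : ℕ} (g : EuclideanSpace ℝ (Fin d) → ℝ) :
    Measure (EuclideanSpace ℝ (Fin d)) :=
  volume.withDensity (fun z => ENNReal.ofReal (g z))

/-- The `j`-particle marginal of a measure on `(ℝ^d)^N`: the image under the
projection on the first `j` coordinates when `j ≤ N`, and `0` by convention when
`j > N`. -/
def marginal {d : ℕ} (N j : ℕ) (P : Measure (Fin N → EuclideanSpace ℝ (Fin d))) :
    Measure (Fin j → EuclideanSpace ℝ (Fin d)) :=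
  if h : j ≤ N then
    Measure.map (fun z (i : Fin j) => z (Fin.castLE h i)) P
  else 0

/-- `f` is a weak solution of the mean field PDE `∂ₜ f + div_z (f 𝒦f) = 0`. -/
def IsWeakMeanFieldSol {d : ℕ}
    (K : EuclideanSpace ℝ (Fin d) × EuclideanSpace ℝ (Fin d) → EuclideanSpace ℝ (Fin d))
    (f : ℝ → EuclideanSpace ℝ (Fin d) → ℝ) : Prop :=
  ∀ φ : EuclideanSpace ℝ (Fin d) → ℝ, ContDiff ℝ 1 φ →
    (∃ C : ℝ, ∀ z, |φ z| ≤ C) → (∃ C : ℝ, ∀ z, ‖fderiv ℝ φ z‖ ≤ C) →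
    ∀ t : ℝ,
      HasDerivAt (fun s => ∫ z, φ z * f s z)
        (∫ z, fderiv ℝ φ z (∫ z', f t z' • K (z, z')) * f t z) t

set_option linter.unusedSectionVars false

section Mollifier

variable (E : Type*) [NormedAddCommGroup E] [InnerProductSpace ℝ E] [FiniteDimensional ℝ E]
  [MeasurableSpace E] [BorelSpace E]

/-- A smooth bump function at the origin, supported in the closed unit ball. -/
def unitBump : ContDiffBump (0 : E) where
  rIn := 1 / 2
  rOut := 1
  rIn_pos := by norm_num
  rIn_lt_rOut := by norm_num

variable {E}

/-- A sequence of smooth mollifiers, with `mollifier n` supported in the ball of radius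
`1 / (n + 1)`. -/
def mollifier (n : ℕ) (x : E) : ℝ :=
  ((n : ℝ) + 1) ^ Module.finrank ℝ E * (unitBump E).normed volume (((n : ℝ) + 1) • x)

lemma contDiff_mollifier (n : ℕ) : ContDiff ℝ 1 (mollifier n : E → ℝ) :=
  contDiff_const.mul ((unitBump E).contDiff_normed.comp (contDiff_const_smul _))

lemma mollifier_nonneg (n : ℕ) (x : E) : 0 ≤ mollifier n x :=
  mul_nonneg (by positivity) ((unitBump E).nonneg_normed _)

lemma mollifier_neg (n : ℕ) (x : E) : mollifier n (-x) = mollifier n x := by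
  simp [mollifier, ContDiffBump.normed_neg]

lemma mollifier_eq_zero {n : ℕ} {x : E} (hx : 1 / ((n : ℝ) + 1) ≤ ‖x‖) : mollifier n x = 0 := by
  have hn : (0 : ℝ) < n + 1 := by positivity
  have h : (((n : ℝ) + 1) • x) ∉ Function.support ((unitBump E).normed volume) := by
    rw [ContDiffBump.support_normed_eq]
    simp only [Metric.mem_ball, dist_zero_right, norm_smul, unitBump, not_lt]
    rw [Real.norm_of_nonneg hn.le]
    rw [div_le_iff₀ hn] at hx
    linarith
  simp [mollifier, Function.notMem_support.1 h]

lemma integral_mollifier (n : ℕ) : ∫ x : E, mollifier n x = 1 := by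
  have hn : (0 : ℝ) < n + 1 := by positivity
  simp only [mollifier]
  rw [integral_const_mul, Measure.integral_comp_smul volume ((unitBump E).normed volume),
    ContDiffBump.integral_normed, abs_of_pos (by positivity)]
  simp
  field_simp

lemma hasCompactSupport_mollifier (n : ℕ) : HasCompactSupport (mollifier n : E → ℝ) :=
  HasCompactSupport.intro (isCompact_closedBall 0 (1 / ((n : ℝ) + 1))) fun x hx =>
    mollifier_eq_zero (by simpa using (not_le.1 (by simpa using hx)).le)

lemma fderiv_mollifier_eq_zero {n : ℕ} {x : E} (hx : 1 / ((n : ℝ) + 1) < ‖x‖) :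
    fderiv ℝ (mollifier n) x = 0 := by
  have h : (mollifier n : E → ℝ) =ᶠ[𝓝 x] fun _ => 0 := by
    filter_upwards [continuous_norm.continuousAt.eventually (lt_mem_nhds hx)] with y hy
    exact mollifier_eq_zero hy.le
  rw [h.fderiv_eq]
  simp

lemma fderiv_mollifier_neg (n : ℕ) (x : E) :
    fderiv ℝ (mollifier n) (-x) = - fderiv ℝ (mollifier n) x := by
  have h := fderiv_comp_smul (f := (mollifier n : E → ℝ)) (x := x) (𝕜 := ℝ) (-1)
  simp only [neg_smul, one_smul, mollifier_neg] at h
  rw [h, neg_neg]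

variable (E) in
lemma exists_mollifier_bound : ∃ C : ℝ, 0 ≤ C ∧ ∀ (n : ℕ) (x : E),
    mollifier n x ≤ C * ((n : ℝ) + 1) ^ Module.finrank ℝ E ∧
    ‖fderiv ℝ (mollifier n) x‖ ≤ C * ((n : ℝ) + 1) ^ (Module.finrank ℝ E + 1) := by
  set ρ : E → ℝ := (unitBump E).normed volume with hρ
  have hρc : HasCompactSupport ρ := (unitBump E).hasCompactSupport_normed
  have hρd : ContDiff ℝ 1 ρ := (unitBump E).contDiff_normed
  obtain ⟨C₁, h₁⟩ := hρc.exists_bound_of_continuous hρd.continuous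
  obtain ⟨C₂, h₂⟩ := (hρc.fderiv (𝕜 := ℝ)).exists_bound_of_continuous
    (hρd.continuous_fderiv one_ne_zero)
  have h1 : 0 ≤ C₁ := (norm_nonneg _).trans (h₁ 0)
  have h2 : 0 ≤ C₂ := (norm_nonneg _).trans (h₂ 0)
  refine ⟨C₁ + C₂, by positivity, fun n x => ⟨?_, ?_⟩⟩
  · have := (le_abs_self _).trans (h₁ (((n : ℝ) + 1) • x))
    rw [mollifier, mul_comm]
    gcongr
    linarith
  · have hd : fderiv ℝ (mollifier n : E → ℝ) x = ((n : ℝ) + 1) ^ Module.finrank ℝ E •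
        (((n : ℝ) + 1) • fderiv ℝ ρ (((n : ℝ) + 1) • x)) := by
      have : (mollifier n : E → ℝ) =
        fun x => ((n : ℝ) + 1) ^ Module.finrank ℝ E • ρ (((n : ℝ) + 1) • x) := rfl
      rw [this, fderiv_fun_const_smul, fderiv_comp_smul]
      exact ((hρd.differentiable one_ne_zero).comp (differentiable_id.const_smul _)) x
    rw [hd, norm_smul, norm_smul, norm_pow, Real.norm_of_nonneg (by positivity), pow_succ]
    have := h₂ (((n : ℝ) + 1) • x)
    calc _ ≤ ((n : ℝ) + 1) ^ Module.finrank ℝ E * (((n : ℝ) + 1) * (C₁ + C₂)) := by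
          gcongr; linarith
      _ = _ := by ring

end Mollifier

section Divergence

variable {E : Type*} [NormedAddCommGroup E] [InnerProductSpace ℝ E] [FiniteDimensional ℝ E]

/-- The divergence of a vector field. -/
def divergence (V : E → E) (y : E) : ℝ :=
  ∑ i, inner ℝ (stdOrthonormalBasis ℝ E i) (fderiv ℝ V y (stdOrthonormalBasis ℝ E i))

lemma continuous_divergence {V : E → E} (hV : ContDiff ℝ 1 V) : Continuous (divergence V) := by
  have := hV.continuous_fderiv one_ne_zero
  unfold divergence
  fun_prop

lemma abs_divergence_le {V : E → E} {Λ : ℝ} {y : E} (h : ‖fderiv ℝ V y‖ ≤ Λ) :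
    |divergence V y| ≤ Module.finrank ℝ E * Λ := by
  unfold divergence
  refine (Finset.abs_sum_le_sum_abs _ _).trans ?_
  calc _ ≤ ∑ i : Fin (Module.finrank ℝ E), Λ := by
        refine Finset.sum_le_sum fun i _ => ?_
        refine (abs_real_inner_le_norm _ _).trans ?_
        have h1 := (fderiv ℝ V y).le_opNorm (stdOrthonormalBasis ℝ E i)
        simp only [OrthonormalBasis.norm_eq_one, mul_one, one_mul] at h1 ⊢
        exact h1.trans h
    _ = _ := by simp

lemma divergence_smul {u : E → ℝ} {W : E → E} {y : E} (hu : DifferentiableAt ℝ u y)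
    (hW : DifferentiableAt ℝ W y) :
    divergence (fun x => u x • W x) y = u y * divergence W y + fderiv ℝ u y (W y) := by
  unfold divergence
  rw [fderiv_fun_smul hu hW]
  simp only [add_apply, smul_apply,
    ContinuousLinearMap.smulRight_apply, inner_add_right, Finset.sum_add_distrib, inner_smul_right,
    Finset.mul_sum]
  congr 1
  conv_rhs => rw [← (stdOrthonormalBasis ℝ E).sum_repr' (W y)]
  simp [mul_comm]

variable [MeasurableSpace E] [BorelSpace E]

lemma integral_divergence_eq_zero {W : E → E} (hW : ContDiff ℝ 1 W) (hc : HasCompactSupport W) :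
    ∫ y, divergence W y = 0 := by
  have hd := hW.continuous_fderiv one_ne_zero
  have key : ∀ i, Integrable (fun y => inner ℝ (stdOrthonormalBasis ℝ E i)
      (fderiv ℝ W y (stdOrthonormalBasis ℝ E i))) ∧ ∫ y, inner ℝ (stdOrthonormalBasis ℝ E i)
      (fderiv ℝ W y (stdOrthonormalBasis ℝ E i)) = 0 := by
    intro i
    set e := stdOrthonormalBasis ℝ E i
    have hcs : HasCompactSupport (fun y => inner ℝ e (fderiv ℝ W y e)) :=
      (hc.fderiv (𝕜 := ℝ)).comp_left (g := fun A : E →L[ℝ] E => inner ℝ e (A e)) (by simp)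
    have hi : Integrable (fun y => inner ℝ e (fderiv ℝ W y e)) :=
      Continuous.integrable_of_hasCompactSupport (by fun_prop) hcs
    have hi2 : Integrable (fun y => inner ℝ e (W y)) :=
      Continuous.integrable_of_hasCompactSupport (by have := hW.continuous; fun_prop)
        (hc.comp_left (g := fun w : E => inner ℝ e w) (by simp))
    refine ⟨hi, ?_⟩
    have := integral_bilinear_hasFDerivAt_right_eq_neg_left_of_integrable (μ := volume)
      (f := fun _ : E => (1 : ℝ)) (f' := fun _ => 0) (g := fun y => inner ℝ e (W y))
      (g' := fun y => (innerSL ℝ e).comp (fderiv ℝ W y)) (v := e)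
      (B := ContinuousLinearMap.mul ℝ ℝ) (by simp) (by simpa using hi) (by simpa using hi2)
      (fun x _ => hasFDerivAt_const _ _)
      (fun x _ => (innerSL ℝ e).hasFDerivAt.comp x
        (hW.differentiable one_ne_zero x).hasFDerivAt)
    simpa using this
  unfold divergence
  rw [integral_finsetSum _ fun i _ => (key i).1]
  simp [(key _).2]

end Divergence

section Mollify

variable {E : Type*} [NormedAddCommGroup E] [InnerProductSpace ℝ E] [FiniteDimensional ℝ E]
  [MeasurableSpace E] [BorelSpace E]

/-- Convolution with `mollifier n`. -/
def mollify (n : ℕ) (f : E → ℝ) (y : E) : ℝ := ∫ z, f z * mollifier n (y - z)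

lemma mollify_eq_convolution (n : ℕ) (f : E → ℝ) :
    mollify n f = convolution f (mollifier n) (ContinuousLinearMap.lsmul ℝ ℝ) volume := by
  ext y
  simp [mollify, convolution]

lemma contDiff_mollify (n : ℕ) {f : E → ℝ} (hf : LocallyIntegrable f) :
    ContDiff ℝ 1 (mollify n f) := by
  rw [mollify_eq_convolution]
  exact (hasCompactSupport_mollifier n).contDiff_convolution_right _ hf (contDiff_mollifier n)

lemma fderiv_mollify (n : ℕ) {f : E → ℝ} (hf : LocallyIntegrable f) (y v : E) :
    fderiv ℝ (mollify n f) y v = ∫ z, f z * fderiv ℝ (mollifier n) (y - z) v := by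
  rw [mollify_eq_convolution, ((hasCompactSupport_mollifier n).hasFDerivAt_convolution_right _ hf
    (contDiff_mollifier n) y).fderiv]
  rw [convolution_precompR_apply _ hf ((hasCompactSupport_mollifier n).fderiv (𝕜 := ℝ))
    ((contDiff_mollifier n).continuous_fderiv one_ne_zero)]
  simp [convolution]

lemma integrable_mollifier (n : ℕ) : Integrable (mollifier n : E → ℝ) :=
  (contDiff_mollifier n).continuous.integrable_of_hasCompactSupport (hasCompactSupport_mollifier n)

lemma integral_mollifier_sub (n : ℕ) (y : E) : ∫ z : E, mollifier n (y - z) = 1 := by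
  rw [integral_sub_left_eq_self (mollifier n : E → ℝ) volume y, integral_mollifier]

lemma mollifier_sub_comm (n : ℕ) (y z : E) : mollifier n (y - z) = mollifier n (z - y) := by
  rw [← mollifier_neg, neg_sub]

lemma abs_mollify_le {n : ℕ} {u : E → ℝ} {M : ℝ} (hu : ∀ z, |u z| ≤ M) (y : E) :
    |mollify n u y| ≤ M := by
  have : ‖∫ z, u z * mollifier n (y - z)‖ ≤ ∫ z, M * mollifier n (y - z) := by
    refine norm_integral_le_of_norm_le
      (((integrable_mollifier n).comp_sub_left y).const_mul M) (Eventually.of_forall fun z => ?_)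
    rw [norm_mul, Real.norm_of_nonneg (mollifier_nonneg _ _)]
    exact mul_le_mul_of_nonneg_right (hu z) (mollifier_nonneg _ _)
  rwa [integral_const_mul, integral_mollifier_sub, mul_one] at this

lemma locallyIntegrable_of_bounded {u : E → ℝ} {M : ℝ} (hm : Measurable u)
    (hu : ∀ z, |u z| ≤ M) : LocallyIntegrable u :=
  (locallyIntegrable_const M).mono hm.aestronglyMeasurable
    (Eventually.of_forall fun z => (hu z).trans (le_abs_self M))

lemma exists_mollifier_bound' (n : ℕ) : ∃ C : ℝ, 0 ≤ C ∧ ∀ x : E, |mollifier n x| ≤ C ∧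
    ‖fderiv ℝ (mollifier n) x‖ ≤ C := by
  obtain ⟨C, hC, h⟩ := exists_mollifier_bound E
  refine ⟨C * ((n : ℝ) + 1) ^ (Module.finrank ℝ E + 1), by positivity, fun x => ⟨?_, (h n x).2⟩⟩
  rw [abs_of_nonneg (mollifier_nonneg _ _)]
  refine (h n x).1.trans ?_
  gcongr
  · linarith [n.cast_nonneg (α := ℝ)]
  · omega

lemma exists_fderiv_mollify_bound (n : ℕ) {u : E → ℝ} {M : ℝ} (hm : Measurable u)
    (hu : ∀ z, |u z| ≤ M) : ∃ C : ℝ, ∀ y, ‖fderiv ℝ (mollify n u) y‖ ≤ C := by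
  have hc := (contDiff_mollifier (E := E) n).continuous_fderiv one_ne_zero
  have hi : Integrable (fderiv ℝ (mollifier n : E → ℝ)) :=
    hc.integrable_of_hasCompactSupport ((hasCompactSupport_mollifier n).fderiv (𝕜 := ℝ))
  have hM : 0 ≤ M := (abs_nonneg _).trans (hu 0)
  refine ⟨M * ∫ z : E, ‖fderiv ℝ (mollifier n) z‖, fun y => ContinuousLinearMap.opNorm_le_bound _
    (mul_nonneg hM (by positivity)) fun v => ?_⟩
  rw [fderiv_mollify n (locallyIntegrable_of_bounded hm hu)]
  calc _ ≤ ∫ z, (M * ‖v‖) * ‖fderiv ℝ (mollifier n) (y - z)‖ := by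
        refine norm_integral_le_of_norm_le ((hi.norm.comp_sub_left y).const_mul _)
          (Eventually.of_forall fun z => ?_)
        rw [norm_mul]
        calc _ ≤ M * (‖fderiv ℝ (mollifier n) (y - z)‖ * ‖v‖) := by
              gcongr
              · exact hu z
              · exact ContinuousLinearMap.le_opNorm _ _
          _ = _ := by ring
    _ = _ := by
        rw [integral_const_mul,
          integral_sub_left_eq_self (fun z : E => ‖fderiv ℝ (mollifier n : E → ℝ) z‖) volume y]
        ring

lemma integrable_prod_mollifier (n : ℕ) {f : E → ℝ} (hf : Integrable f) :
    Integrable (fun p : E × E => f p.1 * mollifier n (p.2 - p.1)) (volume.prod volume) := by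
  have := hf.convolution_integrand (ContinuousLinearMap.lsmul ℝ ℝ) (integrable_mollifier (E := E) n)
  exact this.swap

lemma integrable_mollify (n : ℕ) {f : E → ℝ} (hf : Integrable f) : Integrable (mollify n f) := by
  rw [mollify_eq_convolution]
  exact hf.integrable_convolution _ (integrable_mollifier n)

lemma integral_mul_mollify (n : ℕ) {f : E → ℝ} (hf : Integrable f) {u : E → ℝ} {M : ℝ}
    (hm : Measurable u) (hu : ∀ z, |u z| ≤ M) :
    ∫ z, mollify n u z * f z = ∫ y, u y * mollify n f y := by
  simp only [mollify]
  have h1 : ∀ y, u y * ∫ z, f z * mollifier n (y - z) = ∫ z, u y * (f z * mollifier n (y - z)) :=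
    fun y => (integral_const_mul _ _).symm
  have h2 : ∀ z, (∫ y, u y * mollifier n (z - y)) * f z
      = ∫ y, u y * (f z * mollifier n (y - z)) := fun z => by
    rw [← integral_mul_const]
    refine integral_congr_ae (Eventually.of_forall fun y => ?_)
    simp only [mollifier_sub_comm n z y]
    ring
  simp_rw [h1, h2]
  refine integral_integral_swap (f := fun z y => u y * (f z * mollifier n (y - z))) ?_
  refine (integrable_prod_mollifier n hf).bdd_mul (c := M)
    (hm.comp measurable_snd).aestronglyMeasurable (Eventually.of_forall fun p => hu p.2)

lemma abs_sign_le_one (r : ℝ) : |Real.sign r| ≤ 1 := by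
  rcases Real.sign_apply_eq r with h | h | h <;> simp [h]

lemma measurable_real_sign : Measurable Real.sign := by
  unfold Real.sign
  exact Measurable.ite measurableSet_Iio measurable_const
    (Measurable.ite measurableSet_Ioi measurable_const measurable_const)

lemma sign_mul_self_eq_abs (r : ℝ) : Real.sign r * r = |r| := by
  rcases lt_trichotomy r 0 with h | h | h
  · simp [Real.sign_of_neg h, abs_of_neg h]
  · simp [h]
  · simp [Real.sign_of_pos h, abs_of_pos h]

lemma integral_abs_mollify_le (n : ℕ) {f : E → ℝ} (hf : Integrable f) :
    ∫ y, |mollify n f y| ≤ ∫ z, |f z| := by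
  have hm : Measurable fun y => Real.sign (mollify n f y) :=
    measurable_real_sign.comp (contDiff_mollify n hf.locallyIntegrable).continuous.measurable
  have hb : ∀ y, |Real.sign (mollify n f y)| ≤ 1 := fun y => abs_sign_le_one _
  have := integral_mul_mollify n hf hm hb
  simp_rw [sign_mul_self_eq_abs] at this
  rw [← this]
  simp_rw [← Real.norm_eq_abs]
  refine (Real.le_norm_self _).trans (norm_integral_le_of_norm_le hf.norm
    (Eventually.of_forall fun z => ?_))
  rw [norm_mul]
  exact mul_le_of_le_one_left (norm_nonneg _) (abs_mollify_le hb z)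

end Mollify

section Commutator

variable {E : Type*} [NormedAddCommGroup E] [InnerProductSpace ℝ E] [FiniteDimensional ℝ E]
  [MeasurableSpace E] [BorelSpace E]

lemma hasCompactSupport_divergence {W : E → E} (hc : HasCompactSupport W) :
    HasCompactSupport (divergence W) :=
  (hc.fderiv (𝕜 := ℝ)).comp_left (g := fun A : E →L[ℝ] E =>
    ∑ i, inner ℝ (stdOrthonormalBasis ℝ E i) (A (stdOrthonormalBasis ℝ E i))) (by simp)

lemma tendsto_sqrt_sq_add (r : ℝ) :
    Tendsto (fun k : ℕ => √(r ^ 2 + (1 / ((k : ℝ) + 1)) ^ 2)) atTop (𝓝 |r|) := by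
  have h : Tendsto (fun k : ℕ => √(r ^ 2 + (1 / ((k : ℝ) + 1)) ^ 2)) atTop
      (𝓝 √(r ^ 2 + 0 ^ 2)) :=
    (continuous_sqrt.tendsto _).comp
      ((tendsto_one_div_add_atTop_nhds_zero_nat.pow 2).const_add _)
  simpa [Real.sqrt_sq_eq_abs] using h

lemma integral_sign_mul_divergence_smul {g : E → ℝ} {W : E → E} (hg : ContDiff ℝ 1 g)
    (hW : ContDiff ℝ 1 W) (hc : HasCompactSupport W) :
    ∫ y, Real.sign (g y) * (g y * divergence W y + fderiv ℝ g y (W y)) = 0 := by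
  have hgc := hg.continuous
  have hgd := hg.continuous_fderiv one_ne_zero
  have hWc := hW.continuous
  have hdW := continuous_divergence hW
  set u : ℕ → E → ℝ := fun k y => √(g y ^ 2 + (1 / ((k : ℝ) + 1)) ^ 2) with hu
  have hpos : ∀ (k : ℕ) y, 0 < g y ^ 2 + (1 / ((k : ℝ) + 1)) ^ 2 := fun k y => by positivity
  have hud : ∀ k, ContDiff ℝ 1 (u k) := fun k =>
    ((hg.pow 2).add contDiff_const).sqrt fun y => (hpos k y).ne'
  have hfd : ∀ k y, fderiv ℝ (u k) y (W y) = g y / u k y * fderiv ℝ g y (W y) := by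
    intro k y
    have h1 := ((hg.differentiable one_ne_zero y).hasFDerivAt.pow 2).add_const
      ((1 / ((k : ℝ) + 1)) ^ 2)
    have h2 := h1.sqrt (hpos k y).ne'
    rw [show u k = fun y => √(g y ^ 2 + (1 / ((k : ℝ) + 1)) ^ 2) from rfl, h2.fderiv]
    have : √(g y ^ 2 + (1 / ((k : ℝ) + 1)) ^ 2) ≠ 0 := (Real.sqrt_pos.2 (hpos k y)).ne'
    simp
    field_simp
  have h0 : ∀ k, ∫ y, (u k y * divergence W y + g y / u k y * fderiv ℝ g y (W y)) = 0 := by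
    intro k
    have := integral_divergence_eq_zero ((hud k).smul hW) (hc.smul_left (f := u k))
    rw [← this]
    refine integral_congr_ae (Eventually.of_forall fun y => ?_)
    have e := divergence_smul (W := W) ((hud k).differentiable one_ne_zero y)
      (hW.differentiable one_ne_zero y)
    simp only [hfd] at e
    exact e.symm
  have hlim : Tendsto (fun k => ∫ y, (u k y * divergence W y + g y / u k y * fderiv ℝ g y (W y)))
      atTop (𝓝 (∫ y, Real.sign (g y) * (g y * divergence W y + fderiv ℝ g y (W y)))) := by
    refine tendsto_integral_of_dominated_convergence
      (fun y => (|g y| + 1) * |divergence W y| + |fderiv ℝ g y (W y)|) (fun k => ?_) ?_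
      (fun k => Eventually.of_forall fun y => ?_) (Eventually.of_forall fun y => ?_)
    · have := (hud k).continuous
      have h3 : ∀ y, u k y ≠ 0 := fun y => (Real.sqrt_pos.2 (hpos k y)).ne'
      exact Continuous.aestronglyMeasurable
        ((this.mul hdW).add ((hgc.div this h3).mul (hgd.clm_apply hWc)))
    · refine Continuous.integrable_of_hasCompactSupport ?_ ?_
      · exact ((hgc.abs.add continuous_const).mul hdW.abs).add (hgd.clm_apply hWc).abs
      · refine HasCompactSupport.add ?_ ?_
        · exact ((hasCompactSupport_divergence hc).norm).mul_left
        · refine hc.mono fun y hy => ?_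
          contrapose! hy
          simp [Function.notMem_support.1 hy]
    · have hk : 1 / ((k : ℝ) + 1) ≤ 1 := by
        rw [div_le_one (by positivity)]; linarith [k.cast_nonneg (α := ℝ)]
      have hk0 : 0 < 1 / ((k : ℝ) + 1) := by positivity
      have h1 : u k y ≤ |g y| + 1 := by
        refine Real.sqrt_le_iff.2 ⟨by positivity, ?_⟩
        nlinarith [sq_abs (g y), abs_nonneg (g y)]
      have h2 : |g y / u k y| ≤ 1 := by
        have hup : 0 < u k y := Real.sqrt_pos.2 (hpos k y)
        rw [abs_div, abs_of_pos hup, div_le_one hup]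
        refine Real.le_sqrt_of_sq_le ?_
        rw [sq_abs]
        nlinarith
      rw [Real.norm_eq_abs]
      refine (abs_add_le _ _).trans ?_
      rw [abs_mul, abs_mul, abs_of_nonneg (show 0 ≤ u k y from Real.sqrt_nonneg _)]
      have := mul_le_mul_of_nonneg_right h2 (abs_nonneg (fderiv ℝ g y (W y)))
      have := mul_le_mul_of_nonneg_right h1 (abs_nonneg (divergence W y))
      linarith
    · have h1 := tendsto_sqrt_sq_add (g y)
      have h2 : Tendsto (fun k => g y / u k y) atTop (𝓝 (Real.sign (g y))) := by
        by_cases hgy : g y = 0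
        · simp [hgy]
        · have := (tendsto_const_nhds (x := g y)).div h1 (abs_ne_zero.2 hgy)
          have e : Real.sign (g y) = g y / |g y| := by
            rw [eq_div_iff (abs_ne_zero.2 hgy), ← sign_mul_self_eq_abs, ← mul_assoc]
            rcases Real.sign_apply_eq_of_ne_zero _ hgy with h | h <;> simp [h]
          rw [e]
          exact this
      have := (h1.mul_const (divergence W y)).add (h2.mul_const (fderiv ℝ g y (W y)))
      convert this using 2
      rw [mul_add, ← mul_assoc, sign_mul_self_eq_abs]
  simp only [h0] at hlim
  exact (tendsto_nhds_unique hlim tendsto_const_nhds)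

lemma divergence_mollifier_smul (n : ℕ) {W : E → E} (hW : ContDiff ℝ 1 W) (z y : E) :
    divergence (fun y => mollifier n (z - y) • W y) y =
      mollifier n (z - y) * divergence W y - fderiv ℝ (mollifier n) (z - y) (W y) := by
  have h := (((contDiff_mollifier (E := E) n).differentiable one_ne_zero (z - y)).hasFDerivAt.comp y
    ((hasFDerivAt_id y).const_sub z))
  have h' : HasFDerivAt (fun y => mollifier n (z - y)) _ y := h
  rw [divergence_smul h'.differentiableAt (hW.differentiable one_ne_zero y), h'.fderiv]
  simp [sub_eq_add_neg]

/-- The kernel `div_y (η (z - y) V y)`. -/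
def divKernel (n : ℕ) (V : E → E) (z y : E) : ℝ :=
  mollifier n (z - y) * divergence V y - fderiv ℝ (mollifier n) (z - y) (V y)

/-- The commutator kernel `div_y (η (z - y) (V y - V z))`. -/
def commKernel (n : ℕ) (V : E → E) (z y : E) : ℝ :=
  fderiv ℝ (mollifier n) (z - y) (V z) + divKernel n V z y

lemma divergence_sub_const {V : E → E} (c : E) (y : E) :
    divergence (fun y => V y - c) y = divergence V y := by
  simp [divergence, fderiv_sub_const]

lemma integral_commKernel (n : ℕ) {V : E → E} (hV : ContDiff ℝ 1 V) (z : E) :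
    ∫ y, commKernel n V z y = 0 := by
  have hW : ContDiff ℝ 1 (fun y => V y - V z) := hV.sub contDiff_const
  have hη : ContDiff ℝ 1 (fun y : E => mollifier n (z - y)) :=
    (contDiff_mollifier n).comp (contDiff_const.sub contDiff_id)
  have hc : HasCompactSupport (fun y : E => mollifier n (z - y)) :=
    (hasCompactSupport_mollifier n).comp_homeomorph (Homeomorph.subLeft z)
  rw [← integral_divergence_eq_zero (hη.smul hW) (hc.smul_right (f' := fun y => V y - V z))]
  refine integral_congr_ae (Eventually.of_forall fun y => ?_)
  have := divergence_mollifier_smul n hW z y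
  rw [divergence_sub_const] at this
  refine Eq.trans ?_ this.symm
  simp [commKernel, divKernel]
  ring

lemma continuous_divKernel (n : ℕ) {V : E → E} (hV : ContDiff ℝ 1 V) :
    Continuous (fun p : E × E => divKernel n V p.1 p.2) := by
  have h1 := (contDiff_mollifier (E := E) n).continuous
  have h2 := (contDiff_mollifier (E := E) n).continuous_fderiv one_ne_zero
  have h3 := continuous_divergence hV
  have h4 := hV.continuous
  unfold divKernel
  fun_prop

lemma continuous_commKernel (n : ℕ) {V : E → E} (hV : ContDiff ℝ 1 V) :
    Continuous (fun p : E × E => commKernel n V p.1 p.2) := by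
  have h2 := (contDiff_mollifier (E := E) n).continuous_fderiv one_ne_zero
  have h3 := continuous_divKernel n hV
  have h4 := hV.continuous
  unfold commKernel
  fun_prop

lemma divKernel_eq_zero {n : ℕ} {V : E → E} {z y : E} (h : 1 / ((n : ℝ) + 1) < ‖z - y‖) :
    divKernel n V z y = 0 := by
  simp [divKernel, mollifier_eq_zero h.le, fderiv_mollifier_eq_zero h]

lemma commKernel_eq_zero {n : ℕ} {V : E → E} {z y : E} (h : 1 / ((n : ℝ) + 1) < ‖z - y‖) :
    commKernel n V z y = 0 := by
  simp [commKernel, divKernel_eq_zero h, fderiv_mollifier_eq_zero h]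

lemma norm_sub_le_of_fderiv_le {V : E → E} {Λ : ℝ} (hV : ContDiff ℝ 1 V)
    (h : ∀ z, ‖fderiv ℝ V z‖ ≤ Λ) (z y : E) : ‖V z - V y‖ ≤ Λ * ‖z - y‖ :=
  convex_univ.norm_image_sub_le_of_norm_fderiv_le
    (fun x _ => hV.differentiable one_ne_zero x) (fun x _ => h x) (Set.mem_univ y) (Set.mem_univ z)

variable (E) in
lemma exists_commKernel_bound : ∃ C : ℝ, 0 ≤ C ∧ ∀ (n : ℕ) (V : E → E) (Λ : ℝ),
    ContDiff ℝ 1 V → (∀ z, ‖fderiv ℝ V z‖ ≤ Λ) → ∀ z,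
    Integrable (commKernel n V z) ∧ ∫ y, |commKernel n V z y| ≤ C * Λ := by
  obtain ⟨C, hC, hb⟩ := exists_mollifier_bound E
  set d := Module.finrank ℝ E with hd
  refine ⟨C * (1 + d) * volume.real (Metric.closedBall (0 : E) 1), by positivity,
    fun n V Λ hV hΛ z => ?_⟩
  have hΛ0 : 0 ≤ Λ := (norm_nonneg _).trans (hΛ 0)
  have hn : (0 : ℝ) < n + 1 := by positivity
  have hpt : ∀ y, ‖commKernel n V z y‖ ≤ (Metric.closedBall z (1 / ((n : ℝ) + 1))).indicator
      (fun _ => C * (1 + d) * Λ * ((n : ℝ) + 1) ^ d) y := by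
    intro y
    by_cases hy : y ∈ Metric.closedBall z (1 / ((n : ℝ) + 1))
    · rw [Set.indicator_of_mem hy]
      rw [Metric.mem_closedBall, dist_comm, dist_eq_norm] at hy
      have e : commKernel n V z y = fderiv ℝ (mollifier n) (z - y) (V z - V y) +
          mollifier n (z - y) * divergence V y := by
        simp [commKernel, divKernel]; ring
      rw [e]
      refine (norm_add_le _ _).trans ?_
      have h1 : ‖fderiv ℝ (mollifier n) (z - y) (V z - V y)‖ ≤ C * Λ * ((n : ℝ) + 1) ^ d := by
        refine (ContinuousLinearMap.le_opNorm _ _).trans ?_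
        calc _ ≤ (C * ((n : ℝ) + 1) ^ (d + 1)) * (Λ * (1 / ((n : ℝ) + 1))) := by
              gcongr
              · exact (hb n _).2
              · exact (norm_sub_le_of_fderiv_le hV hΛ z y).trans (by gcongr)
          _ = _ := by rw [pow_succ]; field_simp
      have h2 : ‖mollifier n (z - y) * divergence V y‖ ≤ (C * ((n : ℝ) + 1) ^ d) * (d * Λ) := by
        rw [norm_mul, Real.norm_of_nonneg (mollifier_nonneg _ _)]
        exact mul_le_mul (hb n _).1 (abs_divergence_le (hΛ y)) (abs_nonneg _) (by positivity)
      calc _ ≤ C * Λ * ((n : ℝ) + 1) ^ d + (C * ((n : ℝ) + 1) ^ d) * (d * Λ) := add_le_add h1 h2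
        _ = _ := by ring
    · rw [Set.indicator_of_notMem hy, commKernel_eq_zero, norm_zero]
      rw [Metric.mem_closedBall, dist_comm, dist_eq_norm] at hy
      exact not_le.1 hy
  have hi : Integrable ((Metric.closedBall z (1 / ((n : ℝ) + 1))).indicator
      (fun _ => C * (1 + d) * Λ * ((n : ℝ) + 1) ^ d)) := by
    rw [integrable_indicator_iff measurableSet_closedBall]
    exact integrableOn_const (measure_closedBall_lt_top).ne
  have hm : AEStronglyMeasurable (commKernel n V z) :=
    ((continuous_commKernel n hV).comp (Continuous.prodMk_right z)).aestronglyMeasurable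
  refine ⟨hi.mono' hm (Eventually.of_forall hpt), ?_⟩
  refine (integral_mono_of_nonneg (Eventually.of_forall fun _ => abs_nonneg _) hi
    (Eventually.of_forall hpt)).trans ?_
  rw [integral_indicator_const _ measurableSet_closedBall, Measure.addHaar_real_closedBall _ _ (by positivity),
    smul_eq_mul, ← hd]
  have : volume.real (Metric.ball (0 : E) 1) = volume.real (Metric.closedBall (0 : E) 1) := by
    have := Measure.addHaar_real_closedBall (volume : Measure E) 0 (r := 1) (by norm_num)
    simpa using this.symm
  rw [this]
  have h3 : (1 / ((n : ℝ) + 1)) ^ d * ((n : ℝ) + 1) ^ d = 1 := by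
    rw [← mul_pow, one_div, inv_mul_cancel₀ hn.ne', one_pow]
  calc _ = C * (1 + d) * volume.real (Metric.closedBall (0 : E) 1) * Λ *
        ((1 / ((n : ℝ) + 1)) ^ d * ((n : ℝ) + 1) ^ d) := by ring
    _ ≤ _ := by rw [h3, mul_one]

end Commutator

section Cutoff

variable (E : Type*) [NormedAddCommGroup E] [InnerProductSpace ℝ E] [FiniteDimensional ℝ E]

/-- A smooth bump function equal to one on the closed unit ball. -/
def cutoffBump : ContDiffBump (0 : E) where
  rIn := 1
  rOut := 2
  rIn_pos := by norm_num
  rIn_lt_rOut := by norm_num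

variable {E}

/-- A smooth cutoff equal to `1` on the ball of radius `R` and vanishing outside that of
radius `2 * R`. -/
def cutoff (R : ℝ) (x : E) : ℝ := cutoffBump E (R⁻¹ • x)

lemma contDiff_cutoff (R : ℝ) : ContDiff ℝ 1 (cutoff R : E → ℝ) :=
  (cutoffBump E).contDiff.comp (contDiff_const_smul _)

lemma cutoff_nonneg (R : ℝ) (x : E) : 0 ≤ cutoff R x := (cutoffBump E).nonneg

lemma cutoff_le_one (R : ℝ) (x : E) : cutoff R x ≤ 1 := (cutoffBump E).le_one

lemma abs_cutoff_le_one (R : ℝ) (x : E) : |cutoff R x| ≤ 1 := by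
  rw [abs_of_nonneg (cutoff_nonneg R x)]; exact cutoff_le_one R x

lemma cutoff_eq_one {R : ℝ} (hR : 0 < R) {x : E} (hx : ‖x‖ ≤ R) : cutoff R x = 1 := by
  refine (cutoffBump E).one_of_mem_closedBall ?_
  simp only [mem_closedBall_zero_iff, norm_smul, norm_inv, Real.norm_of_nonneg hR.le, cutoffBump]
  rwa [inv_mul_le_one₀ hR]

lemma cutoff_eq_zero {R : ℝ} (hR : 0 < R) {x : E} (hx : 2 * R ≤ ‖x‖) : cutoff R x = 0 := by
  refine (cutoffBump E).zero_of_le_dist ?_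
  simp only [dist_zero_right, norm_smul, norm_inv, Real.norm_of_nonneg hR.le, cutoffBump]
  rwa [le_inv_mul_iff₀ hR, mul_comm]

lemma hasCompactSupport_cutoff {R : ℝ} (hR : 0 < R) : HasCompactSupport (cutoff R : E → ℝ) :=
  HasCompactSupport.intro (isCompact_closedBall 0 (2 * R)) fun x hx =>
    cutoff_eq_zero hR (by simpa using (not_le.1 (by simpa using hx)).le)

lemma fderiv_cutoff_eq_zero {R : ℝ} (hR : 0 < R) {x : E} (hx : 2 * R < ‖x‖) :
    fderiv ℝ (cutoff R) x = 0 := by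
  have h : (cutoff R : E → ℝ) =ᶠ[𝓝 x] fun _ => 0 := by
    filter_upwards [continuous_norm.continuousAt.eventually (lt_mem_nhds hx)] with y hy
    exact cutoff_eq_zero hR hy.le
  rw [h.fderiv_eq]
  simp

lemma fderiv_cutoff_eq_zero_of_lt {R : ℝ} (hR : 0 < R) {x : E} (hx : ‖x‖ < R) :
    fderiv ℝ (cutoff R) x = 0 := by
  have h : (cutoff R : E → ℝ) =ᶠ[𝓝 x] fun _ => 1 := by
    filter_upwards [continuous_norm.continuousAt.eventually (gt_mem_nhds hx)] with y hy
    exact cutoff_eq_one hR (le_of_lt hy)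
  rw [h.fderiv_eq]
  simp

variable (E) in
lemma exists_cutoff_bound : ∃ C : ℝ, 0 ≤ C ∧ ∀ R : ℝ, 0 < R → ∀ x : E,
    ‖fderiv ℝ (cutoff R) x‖ ≤ C / R := by
  set ρ : E → ℝ := fun x => cutoffBump E x with hρ
  have hρd : ContDiff ℝ 1 ρ := (cutoffBump E).contDiff
  obtain ⟨C, h⟩ := ((cutoffBump E).hasCompactSupport.fderiv (𝕜 := ℝ)).exists_bound_of_continuous
    (hρd.continuous_fderiv one_ne_zero)
  refine ⟨C, (norm_nonneg _).trans (h 0), fun R hR x => ?_⟩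
  have hd : fderiv ℝ (cutoff R : E → ℝ) x = R⁻¹ • fderiv ℝ ρ (R⁻¹ • x) := by
    have : (cutoff R : E → ℝ) = fun x => ρ (R⁻¹ • x) := rfl
    rw [this, fderiv_comp_smul]
  rw [hd, norm_smul, norm_inv, Real.norm_of_nonneg hR.le, div_eq_inv_mul]
  have := h (R⁻¹ • x)
  gcongr

end Cutoff

section Renormalization

variable {E : Type*} [NormedAddCommGroup E] [InnerProductSpace ℝ E] [FiniteDimensional ℝ E]
  [MeasurableSpace E] [BorelSpace E]

lemma integral_mul_divKernel (n : ℕ) {f : E → ℝ} (hf : Integrable f) (V : E → E) (y : E) :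
    ∫ z, f z * divKernel n V z y =
      mollify n f y * divergence V y + fderiv ℝ (mollify n f) y (V y) := by
  have hc := (contDiff_mollifier (E := E) n).continuous
  have hc' := (contDiff_mollifier (E := E) n).continuous_fderiv one_ne_zero
  obtain ⟨C, hC, hb⟩ := exists_mollifier_bound' (E := E) n
  have e : ∀ z, f z * divKernel n V z y = f z * mollifier n (y - z) * divergence V y +
      f z * fderiv ℝ (mollifier n) (y - z) (V y) := fun z => by
    rw [divKernel, ← mollifier_sub_comm n y z, ← neg_sub y z, fderiv_mollifier_neg]
    simp; ring
  simp_rw [e]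
  rw [integral_add, integral_mul_const, fderiv_mollify n hf.locallyIntegrable, mollify]
  · refine Integrable.mul_const ?_ _
    refine hf.mul_bdd (c := C) (Continuous.aestronglyMeasurable (by fun_prop))
      (Eventually.of_forall fun z => (hb _).1)
  · refine hf.mul_bdd (c := C * ‖V y‖) (Continuous.aestronglyMeasurable (by fun_prop))
      (Eventually.of_forall fun z => (ContinuousLinearMap.le_opNorm _ _).trans ?_)
    have := (hb (y - z)).2
    gcongr

lemma integral_mul_integral_cutoff_divKernel (n : ℕ) {f : E → ℝ} (hf : Integrable f)
    {V : E → E} (hV : ContDiff ℝ 1 V) {χ : E → ℝ} (hχ : ContDiff ℝ 1 χ)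
    (hχc : HasCompactSupport χ) :
    ∫ z, f z * ∫ y, Real.sign (mollify n f y) * (χ y * divKernel n V z y) =
      - ∫ y, |mollify n f y| * fderiv ℝ χ y (V y) := by
  set g := mollify n f with hg
  have hgd : ContDiff ℝ 1 g := contDiff_mollify n hf.locallyIntegrable
  have hgc := hgd.continuous
  have hVc := hV.continuous
  have hdV := continuous_divergence hV
  have hχ' := hχ.continuous_fderiv one_ne_zero
  have hσm : Measurable fun y => Real.sign (g y) := measurable_real_sign.comp hgc.measurable
  obtain ⟨C, hC, hb⟩ := exists_mollifier_bound' (E := E) n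
  have hw : Integrable fun y => C * (|χ y| * (|divergence V y| + ‖V y‖)) := by
    refine Integrable.const_mul (Continuous.integrable_of_hasCompactSupport
      (hχ.continuous.abs.mul (hdV.abs.add hVc.norm)) ?_) C
    exact (hχc.norm).mul_right
  have hprod : Integrable (fun p : E × E =>
      f p.1 * (Real.sign (g p.2) * (χ p.2 * divKernel n V p.1 p.2))) (volume.prod volume) := by
    refine (hf.norm.mul_prod hw).mono' ?_ (Eventually.of_forall fun p => ?_)
    · refine hf.aestronglyMeasurable.comp_fst.mul ?_
      refine ((hσm.comp measurable_snd).aestronglyMeasurable).mul ?_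
      exact ((hχ.continuous.comp continuous_snd).mul
        (continuous_divKernel n hV)).aestronglyMeasurable
    · rw [norm_mul]
      refine mul_le_mul_of_nonneg_left ?_ (norm_nonneg _)
      rw [norm_mul, norm_mul, Real.norm_eq_abs, Real.norm_eq_abs]
      have h1 : ‖divKernel n V p.1 p.2‖ ≤ C * (|divergence V p.2| + ‖V p.2‖) := by
        rw [divKernel, mul_add]
        refine (norm_sub_le _ _).trans (add_le_add ?_ ?_)
        · rw [norm_mul]
          exact mul_le_mul_of_nonneg_right (hb _).1 (norm_nonneg _)
        · exact (ContinuousLinearMap.le_opNorm _ _).trans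
            (mul_le_mul_of_nonneg_right (hb _).2 (norm_nonneg _))
      calc _ ≤ 1 * (|χ p.2| * (C * (|divergence V p.2| + ‖V p.2‖))) := by
            gcongr
            exact abs_sign_le_one _
        _ = _ := by ring
  have hswap : ∫ z, f z * ∫ y, Real.sign (g y) * (χ y * divKernel n V z y) =
      ∫ y, Real.sign (g y) * (χ y * (g y * divergence V y + fderiv ℝ g y (V y))) := by
    simp_rw [← integral_const_mul]
    rw [integral_integral_swap (f := fun z y => f z *
      (Real.sign (g y) * (χ y * divKernel n V z y))) hprod]
    refine integral_congr_ae (Eventually.of_forall fun y => ?_)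
    simp only
    rw [← integral_mul_divKernel n hf V y, ← integral_const_mul, ← integral_const_mul]
    refine integral_congr_ae (Eventually.of_forall fun z => ?_)
    simp only
    ring
  have h0 := integral_sign_mul_divergence_smul hgd (hχ.smul hV) (hχc.smul_right (f' := V))
  have hi1 : Integrable fun y =>
      Real.sign (g y) * (χ y * (g y * divergence V y + fderiv ℝ g y (V y))) := by
    refine Integrable.bdd_mul (c := 1) ?_ hσm.aestronglyMeasurable
      (Eventually.of_forall fun y => abs_sign_le_one _)
    refine Continuous.integrable_of_hasCompactSupport ?_ hχc.mul_right
    exact hχ.continuous.mul ((hgc.mul hdV).add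
      ((hgd.continuous_fderiv one_ne_zero).clm_apply hVc))
  have hi2 : Integrable fun y => |g y| * fderiv ℝ χ y (V y) := by
    refine Continuous.integrable_of_hasCompactSupport (hgc.abs.mul (hχ'.clm_apply hVc)) ?_
    refine HasCompactSupport.mul_left ?_
    refine (hχc.fderiv (𝕜 := ℝ)).mono fun y hy => ?_
    contrapose! hy
    simp [Function.notMem_support.1 hy]
  rw [hswap, eq_neg_iff_add_eq_zero, ← integral_add hi1 hi2, ← h0]
  refine integral_congr_ae (Eventually.of_forall fun y => ?_)
  have e := divergence_smul (hχ.differentiable one_ne_zero y) (hV.differentiable one_ne_zero y)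
  simp only [Pi.smul_apply'] at e ⊢
  rw [show divergence (χ • V) y = _ from e, ← sign_mul_self_eq_abs, map_smul, smul_eq_mul]
  ring

lemma exists_divKernel_bound (n : ℕ) {V : E → E} {Λ : ℝ} (hV : ContDiff ℝ 1 V)
    (hΛ : ∀ z, ‖fderiv ℝ V z‖ ≤ Λ) : ∃ A : ℝ, 0 ≤ A ∧ ∀ z y, |divKernel n V z y| ≤
      (Metric.closedBall z 1).indicator (fun _ => A * (1 + ‖z‖)) y := by
  obtain ⟨C, hC, hb⟩ := exists_mollifier_bound' (E := E) n
  have hΛ0 : 0 ≤ Λ := (norm_nonneg _).trans (hΛ 0)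
  refine ⟨C * (Module.finrank ℝ E * Λ + ‖V 0‖ + Λ), by positivity, fun z y => ?_⟩
  by_cases hy : y ∈ Metric.closedBall z 1
  · rw [Set.indicator_of_mem hy]
    rw [Metric.mem_closedBall, dist_eq_norm] at hy
    have hVy : ‖V y‖ ≤ ‖V 0‖ + Λ * (1 + ‖z‖) := by
      have h1 := norm_sub_le_of_fderiv_le hV hΛ y 0
      have h2 : ‖V y‖ ≤ ‖V y - V 0‖ + ‖V 0‖ := by
        simpa using norm_add_le (V y - V 0) (V 0)
      have h3 : ‖y‖ ≤ 1 + ‖z‖ := by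
        have := norm_add_le (y - z) z
        simp only [sub_add_cancel] at this
        linarith
      rw [sub_zero] at h1
      nlinarith
    rw [divKernel, ← Real.norm_eq_abs]
    calc _ ≤ C * (Module.finrank ℝ E * Λ) + C * (‖V 0‖ + Λ * (1 + ‖z‖)) := by
          refine (norm_sub_le _ _).trans (add_le_add ?_ ?_)
          · rw [norm_mul]
            exact mul_le_mul (hb _).1 (abs_divergence_le (hΛ y)) (abs_nonneg _) hC
          · refine (ContinuousLinearMap.le_opNorm _ _).trans ?_
            exact mul_le_mul (hb _).2 hVy (norm_nonneg _) hC
      _ ≤ _ := by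
          have h1 : 0 ≤ C * (Module.finrank ℝ E * Λ) * ‖z‖ := by positivity
          have h2 : 0 ≤ C * ‖V 0‖ * ‖z‖ := by positivity
          nlinarith
  · rw [Set.indicator_of_notMem hy, divKernel_eq_zero, abs_zero]
    rw [Metric.mem_closedBall, dist_comm, dist_eq_norm, not_le] at hy
    refine lt_of_le_of_lt ?_ hy
    rw [div_le_one (by positivity)]; linarith [n.cast_nonneg (α := ℝ)]

lemma integral_mul_integral_sign_divKernel (n : ℕ) {f : E → ℝ} (hf : Integrable f)
    {V : E → E} {Λ : ℝ} (hV : ContDiff ℝ 1 V) (hΛ : ∀ z, ‖fderiv ℝ V z‖ ≤ Λ)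
    (hi : Integrable fun z => f z * ∫ y, Real.sign (mollify n f y) * divKernel n V z y) :
    ∫ z, f z * ∫ y, Real.sign (mollify n f y) * divKernel n V z y = 0 := by
  set σ : E → ℝ := fun y => Real.sign (mollify n f y) with hσ
  have hgd : ContDiff ℝ 1 (mollify n f) := contDiff_mollify n hf.locallyIntegrable
  have hΛ0 : 0 ≤ Λ := (norm_nonneg _).trans (hΛ 0)
  have hσm : Measurable σ := measurable_real_sign.comp hgd.continuous.measurable
  obtain ⟨A, hA, hdiv⟩ := exists_divKernel_bound n hV hΛ
  obtain ⟨C, hC, hcut⟩ := exists_cutoff_bound E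
  have hr : ∀ m : ℕ, (0 : ℝ) < m + 1 := fun m => by positivity
  set T : E → ℝ := fun z => ∫ y, σ y * divKernel n V z y with hT
  set TR : ℕ → E → ℝ := fun m z => ∫ y, σ y * (cutoff ((m : ℝ) + 1) y * divKernel n V z y)
    with hTR
  have hσ1 : ∀ y, |σ y| ≤ 1 := fun y => abs_sign_le_one _
  have hdc : ∀ z, Continuous fun y => divKernel n V z y := fun z =>
    (continuous_divKernel n hV).comp (Continuous.prodMk_right z)
  have hballi : ∀ (z : E) (c : ℝ), Integrable ((Metric.closedBall z 1).indicator fun _ => c) :=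
    fun z c => by
      rw [integrable_indicator_iff measurableSet_closedBall]
      exact integrableOn_const (measure_closedBall_lt_top).ne
  have hdi : ∀ z, Integrable fun y => divKernel n V z y := fun z =>
    (hballi z (A * (1 + ‖z‖))).mono' (hdc z).aestronglyMeasurable
      (Eventually.of_forall fun y => hdiv z y)
  have hi1 : ∀ z, Integrable fun y => σ y * divKernel n V z y := fun z =>
    (hdi z).bdd_mul (c := 1) hσm.aestronglyMeasurable (Eventually.of_forall hσ1)
  have hi2 : ∀ m z, Integrable fun y => σ y * (cutoff ((m : ℝ) + 1) y * divKernel n V z y) :=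
    fun m z => ((hdi z).bdd_mul (c := 1) (contDiff_cutoff _).continuous.aestronglyMeasurable
      (Eventually.of_forall fun y => abs_cutoff_le_one _ y)).bdd_mul (c := 1)
      hσm.aestronglyMeasurable (Eventually.of_forall hσ1)
  set M : ℝ := 4 * C * A * volume.real (Metric.closedBall (0 : E) 1) with hM
  have hdiff : ∀ m z, |TR m z| ≤ M + |T z| := by
    intro m z
    have hm1 : (1 : ℝ) ≤ m + 1 := by linarith [m.cast_nonneg (α := ℝ)]
    have h1 : |TR m z - cutoff ((m : ℝ) + 1) z * T z| ≤ M := by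
      rw [hTR, hT]
      simp only
      rw [← integral_const_mul, ← integral_sub (hi2 m z) ((hi1 z).const_mul _)]
      have : ∫ y, (Metric.closedBall z 1).indicator (fun _ => 4 * C * A) y = M := by
        rw [integral_indicator_const _ measurableSet_closedBall, smul_eq_mul, hM,
          Measure.real, Measure.real, Measure.addHaar_closedBall_center, mul_comm]
      rw [← this, ← Real.norm_eq_abs]
      refine norm_integral_le_of_norm_le (hballi z _) (Eventually.of_forall fun y => ?_)
      have e : σ y * (cutoff ((m : ℝ) + 1) y * divKernel n V z y) -
          cutoff ((m : ℝ) + 1) z * (σ y * divKernel n V z y) =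
          σ y * ((cutoff ((m : ℝ) + 1) y - cutoff ((m : ℝ) + 1) z) * divKernel n V z y) := by ring
      rw [e, norm_mul, norm_mul]
      have hd := hdiv z y
      by_cases hy : y ∈ Metric.closedBall z 1
      · rw [Set.indicator_of_mem hy] at hd ⊢
        rw [mem_closedBall_iff_norm] at hy
        have hlip : ‖cutoff ((m : ℝ) + 1) y - cutoff ((m : ℝ) + 1) z‖ ≤ C / (m + 1) := by
          have := convex_univ.norm_image_sub_le_of_norm_fderiv_le (𝕜 := ℝ)
            (f := (cutoff ((m : ℝ) + 1) : E → ℝ)) (C := C / (m + 1))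
            (fun x _ => (contDiff_cutoff _).differentiable one_ne_zero x)
            (fun x _ => hcut _ (hr m) x) (Set.mem_univ z) (Set.mem_univ y)
          exact this.trans (mul_le_of_le_one_right (by positivity) hy)
        by_cases hz : ‖z‖ ≤ 2 * (m + 1) + 1
        · calc _ ≤ 1 * ((C / (m + 1)) * (A * (1 + (2 * (m + 1) + 1)))) := by
                gcongr
                · exact hσ1 y
                · exact hd.trans (by gcongr)
            _ = C * A * ((1 + (2 * (m + 1) + 1)) / (m + 1)) := by ring
            _ ≤ C * A * 4 := by
                gcongr
                rw [div_le_iff₀ (hr m)]; linarith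
            _ = _ := by ring
        · rw [not_le] at hz
          have h3 : 2 * ((m : ℝ) + 1) ≤ ‖y‖ := by
            have := norm_sub_norm_le z y
            rw [norm_sub_rev] at this
            linarith
          rw [cutoff_eq_zero (hr m) h3, cutoff_eq_zero (hr m) (by linarith)]
          simp only [sub_zero, norm_zero, zero_mul, mul_zero]
          positivity
      · rw [Set.indicator_of_notMem hy] at hd ⊢
        have : divKernel n V z y = 0 := abs_nonpos_iff.1 hd
        simp [this]
    have h2 : |cutoff ((m : ℝ) + 1) z * T z| ≤ |T z| := by
      rw [abs_mul]
      exact mul_le_of_le_one_left (abs_nonneg _) (abs_cutoff_le_one _ _)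
    have h3 := abs_add_le (TR m z - cutoff ((m : ℝ) + 1) z * T z) (cutoff ((m : ℝ) + 1) z * T z)
    rw [sub_add_cancel] at h3
    linarith
  have hTRm : ∀ m, AEStronglyMeasurable (TR m) := fun m => by
    refine AEStronglyMeasurable.integral_prod_right' (f := fun p : E × E =>
      σ p.2 * (cutoff ((m : ℝ) + 1) p.2 * divKernel n V p.1 p.2)) ?_
    exact ((hσm.comp measurable_snd).aestronglyMeasurable).mul
      ((((contDiff_cutoff _).continuous).comp continuous_snd).mul
        (continuous_divKernel n hV)).aestronglyMeasurable
  have hev : ∀ z, ∀ᶠ m : ℕ in atTop, TR m z = T z := by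
    intro z
    filter_upwards [eventually_ge_atTop ⌈‖z‖⌉₊] with m hm
    refine integral_congr_ae (Eventually.of_forall fun y => ?_)
    simp only
    by_cases hy : y ∈ Metric.closedBall z 1
    · rw [cutoff_eq_one (hr m), one_mul]
      rw [mem_closedBall_iff_norm] at hy
      have := norm_add_le (y - z) z
      simp only [sub_add_cancel] at this
      have h3 := Nat.ceil_le.1 hm
      linarith
    · have hd := hdiv z y
      rw [Set.indicator_of_notMem hy] at hd
      rw [abs_nonpos_iff.1 hd]; simp
  have hlim : Tendsto (fun m => ∫ z, f z * TR m z) atTop (𝓝 (∫ z, f z * T z)) := by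
    refine tendsto_integral_of_dominated_convergence (fun z => |f z| * M + |f z * T z|)
      (fun m => hf.aestronglyMeasurable.mul (hTRm m))
      ((hf.abs.mul_const M).add hi.abs) (fun m => Eventually.of_forall fun z => ?_)
      (Eventually.of_forall fun z => ?_)
    · rw [norm_mul, abs_mul, ← mul_add]
      exact mul_le_mul_of_nonneg_left (hdiff m z) (norm_nonneg _)
    · exact tendsto_const_nhds.congr' ((hev z).mono fun m hm => by simp only [hm])
  have hlim0 : Tendsto (fun m : ℕ => ∫ z, f z * TR m z) atTop (𝓝 0) := by
    have e : ∀ m : ℕ, ∫ z, f z * TR m z =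
        - ∫ y, |mollify n f y| * fderiv ℝ (cutoff ((m : ℝ) + 1)) y (V y) := fun m =>
      integral_mul_integral_cutoff_divKernel n hf hV (contDiff_cutoff _)
        (hasCompactSupport_cutoff (hr m))
    simp_rw [e]
    rw [← neg_zero, ← integral_zero E ℝ (μ := volume)]
    refine Tendsto.neg (tendsto_integral_of_dominated_convergence
      (fun y => |mollify n f y| * (C * (‖V 0‖ + 2 * Λ)))
      (fun m => ?_) ((integrable_mollify n hf).abs.mul_const _)
      (fun m => Eventually.of_forall fun y => ?_) (Eventually.of_forall fun y => ?_))
    · exact (hgd.continuous.abs.mul (((contDiff_cutoff _).continuous_fderiv one_ne_zero).clm_apply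
        hV.continuous)).aestronglyMeasurable
    · rw [norm_mul, Real.norm_eq_abs, abs_abs]
      refine mul_le_mul_of_nonneg_left ?_ (abs_nonneg _)
      by_cases hy : 2 * ((m : ℝ) + 1) < ‖y‖
      · rw [fderiv_cutoff_eq_zero (hr m) hy]
        simp only [zero_apply, norm_zero]
        positivity
      · rw [not_lt] at hy
        refine (ContinuousLinearMap.le_opNorm _ _).trans ?_
        have h1 := norm_sub_le_of_fderiv_le hV hΛ y 0
        have h2 : ‖V y‖ ≤ ‖V y - V 0‖ + ‖V 0‖ := by
          simpa using norm_add_le (V y - V 0) (V 0)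
        rw [sub_zero] at h1
        have h4 : ‖V y‖ ≤ ‖V 0‖ + Λ * (2 * (m + 1)) := by nlinarith
        calc _ ≤ C / (m + 1) * (‖V 0‖ + Λ * (2 * (m + 1))) :=
              mul_le_mul (hcut _ (hr m) y) h4 (norm_nonneg _) (by positivity)
          _ = C * (‖V 0‖ / (m + 1) + 2 * Λ) := by
              field_simp
          _ ≤ _ := by
              gcongr
              exact div_le_self (norm_nonneg _) (by linarith [m.cast_nonneg (α := ℝ)])
    · refine tendsto_const_nhds.congr' ?_
      filter_upwards [eventually_ge_atTop ⌈‖y‖⌉₊] with m hm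
      rw [fderiv_cutoff_eq_zero_of_lt (hr m)]
      · simp
      · have h3 := Nat.ceil_le.1 hm
        linarith
  exact tendsto_nhds_unique hlim hlim0

end Renormalization

section RenormalizationLimit

variable {E : Type*} [NormedAddCommGroup E] [InnerProductSpace ℝ E] [FiniteDimensional ℝ E]
  [MeasurableSpace E] [BorelSpace E]

lemma ae_eventually_mollify_near {f : E → ℝ} (hf : Integrable f) :
    ∀ᵐ z, ∀ δ > 0, ∀ᶠ n : ℕ in atTop, ∀ y ∈ Metric.closedBall z (1 / ((n : ℝ) + 1)),
      |mollify n f y - f z| ≤ δ := by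
  obtain ⟨C, hC, hb⟩ := exists_mollifier_bound E
  set d := Module.finrank ℝ E with hd
  filter_upwards [(Besicovitch.vitaliFamily (volume : Measure E)).ae_tendsto_average_norm_sub
    hf.locallyIntegrable] with z hz δ hδ
  have h1 : Tendsto (fun n : ℕ => 2 * (1 / ((n : ℝ) + 1))) atTop (𝓝[>] 0) := by
    refine tendsto_nhdsWithin_iff.2 ⟨?_, Eventually.of_forall fun n => ?_⟩
    · simpa using (tendsto_one_div_add_atTop_nhds_zero_nat (𝕜 := ℝ)).const_mul 2
    · simp only [Set.mem_Ioi]; positivity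
  have h2 := (hz.comp ((Besicovitch.tendsto_filterAt volume z).comp h1)).const_mul
    (C * 2 ^ d * volume.real (Metric.closedBall (0 : E) 1))
  rw [mul_zero] at h2
  filter_upwards [h2.eventually_le_const hδ] with n hn y hy
  refine le_trans ?_ hn
  simp only [Function.comp_apply]
  set r := 2 * (1 / ((n : ℝ) + 1)) with hr
  have hr0 : 0 < r := by positivity
  have hball : volume.real (Metric.closedBall z r) =
      r ^ d * volume.real (Metric.closedBall (0 : E) 1) := by
    rw [Measure.addHaar_real_closedBall _ _ hr0.le, ← hd]
    have := Measure.addHaar_real_closedBall (volume : Measure E) 0 (r := 1) (by norm_num)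
    rw [this]; simp
  have hne : volume.real (Metric.closedBall z r) ≠ 0 := by
    rw [Measure.real, ENNReal.toReal_ne_zero]
    exact ⟨(Metric.measure_closedBall_pos _ _ hr0).ne', measure_closedBall_lt_top.ne⟩
  rw [setAverage_eq, smul_eq_mul]
  have hi1 : IntegrableOn (fun w => ‖f w - f z‖) (Metric.closedBall z r) :=
    (hf.integrableOn.sub (integrableOn_const measure_closedBall_lt_top.ne)).norm
  have key : |mollify n f y - f z| ≤ ∫ w in Metric.closedBall z r,
      C * ((n : ℝ) + 1) ^ d * ‖f w - f z‖ := by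
    have hfi : Integrable fun w => f w * mollifier n (y - w) := by
      obtain ⟨C', -, hb'⟩ := exists_mollifier_bound' (E := E) n
      have := (contDiff_mollifier (E := E) n).continuous
      exact hf.mul_bdd (c := C') (Continuous.aestronglyMeasurable (by fun_prop))
        (Eventually.of_forall fun w => (hb' _).1)
    have e : mollify n f y - f z = ∫ w, (f w - f z) * mollifier n (y - w) := by
      simp_rw [sub_mul]
      rw [integral_sub hfi (((integrable_mollifier n).comp_sub_left y).const_mul _),
        integral_const_mul, integral_mollifier_sub, mul_one, mollify]
    rw [e, ← integral_indicator measurableSet_closedBall, ← Real.norm_eq_abs]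
    refine norm_integral_le_of_norm_le
      ((integrable_indicator_iff measurableSet_closedBall).2
        (Integrable.const_mul hi1 (C * ((n : ℝ) + 1) ^ d)))
      (Eventually.of_forall fun w => ?_)
    by_cases hw : w ∈ Metric.closedBall z r
    · rw [Set.indicator_of_mem hw, norm_mul, mul_comm, Real.norm_of_nonneg (mollifier_nonneg _ _)]
      exact mul_le_mul_of_nonneg_right (hb n _).1 (norm_nonneg _)
    · rw [Set.indicator_of_notMem hw, mollifier_eq_zero, mul_zero, norm_zero]
      rw [Metric.mem_closedBall, not_le] at hw
      rw [Metric.mem_closedBall] at hy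
      rw [← dist_eq_norm, dist_comm]
      have := dist_triangle w y z
      linarith
  refine key.trans (le_of_eq ?_)
  rw [integral_const_mul]
  have e2 : C * ((n : ℝ) + 1) ^ d = C * 2 ^ d * volume.real (Metric.closedBall (0 : E) 1) *
      (volume.real (Metric.closedBall z r))⁻¹ := by
    rw [hball] at hne ⊢
    have hv : volume.real (Metric.closedBall (0 : E) 1) ≠ 0 := (mul_ne_zero_iff.1 hne).2
    rw [hr, mul_pow, one_div, inv_pow]
    field_simp
  rw [e2]; ring

lemma ae_tendsto_mollify {f : E → ℝ} (hf : Integrable f) :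
    ∀ᵐ z, Tendsto (fun n => mollify n f z) atTop (𝓝 (f z)) := by
  filter_upwards [ae_eventually_mollify_near hf] with z hz
  rw [Metric.tendsto_nhds]
  intro ε hε
  filter_upwards [hz (ε / 2) (by positivity)] with n hn
  rw [Real.dist_eq]
  have := hn z (Metric.mem_closedBall_self (by positivity))
  linarith

/-- The `C¹` test function regularizing the sign of `f` at scale `1 / (n + 1)`. -/
def signTest (n : ℕ) (f : E → ℝ) : E → ℝ := mollify n fun y => Real.sign (mollify n f y)

lemma measurable_sign_mollify (n : ℕ) {f : E → ℝ} (hf : Integrable f) :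
    Measurable fun y => Real.sign (mollify n f y) :=
  measurable_real_sign.comp (contDiff_mollify n hf.locallyIntegrable).continuous.measurable

lemma integral_signTest_mul (n : ℕ) {f : E → ℝ} (hf : Integrable f) :
    ∫ z, signTest n f z * f z = ∫ y, |mollify n f y| := by
  rw [signTest, integral_mul_mollify n hf (measurable_sign_mollify n hf)
    fun _ => abs_sign_le_one _]
  simp_rw [sign_mul_self_eq_abs]

lemma integral_signTest_mul_le (n : ℕ) {f h : E → ℝ} (hf : Integrable f) (hh : Integrable h) :
    ∫ z, signTest n f z * h z ≤ ∫ y, |mollify n h y| := by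
  rw [signTest, integral_mul_mollify n hh (measurable_sign_mollify n hf)
    fun _ => abs_sign_le_one _]
  have hi := (integrable_mollify n hh)
  refine integral_mono (hi.bdd_mul (c := 1) (measurable_sign_mollify n hf).aestronglyMeasurable
    (Eventually.of_forall fun _ => abs_sign_le_one _)) hi.abs fun y => ?_
  refine (le_abs_self _).trans ?_
  rw [abs_mul]
  exact mul_le_of_le_one_left (abs_nonneg _) (abs_sign_le_one _)

variable (E) in
lemma exists_renormalization_bound : ∃ C : ℝ, 0 ≤ C ∧ ∀ (f : E → ℝ) (V : E → E) (Λ : ℝ),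
    Integrable f → ContDiff ℝ 1 V → (∀ z, ‖fderiv ℝ V z‖ ≤ Λ) →
    (∀ n, |∫ z, fderiv ℝ (signTest n f) z (V z) * f z| ≤ C * Λ * ∫ z, |f z|) ∧
    Tendsto (fun n => ∫ z, fderiv ℝ (signTest n f) z (V z) * f z) atTop (𝓝 0) := by
  obtain ⟨C, hC, hcomm⟩ := exists_commKernel_bound E
  refine ⟨C, hC, fun f V Λ hf hV hΛ => ?_⟩
  have hΛ0 : 0 ≤ Λ := (norm_nonneg _).trans (hΛ 0)
  set σ : ℕ → E → ℝ := fun n y => Real.sign (mollify n f y) with hσ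
  have hσm : ∀ n, Measurable (σ n) := fun n => measurable_sign_mollify n hf
  have hσ1 : ∀ n y, |σ n y| ≤ 1 := fun n y => abs_sign_le_one _
  set S : ℕ → E → ℝ := fun n z => ∫ y, σ n y * commKernel n V z y with hS
  have hSb : ∀ n z, |S n z| ≤ C * Λ := by
    intro n z
    refine le_trans ?_ (hcomm n V Λ hV hΛ z).2
    rw [← Real.norm_eq_abs]
    refine norm_integral_le_of_norm_le (hcomm n V Λ hV hΛ z).1.abs
      (Eventually.of_forall fun y => ?_)
    rw [norm_mul]
    exact mul_le_of_le_one_left (norm_nonneg _) (hσ1 n y)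
  have hSm : ∀ n, AEStronglyMeasurable (S n) := fun n => by
    refine AEStronglyMeasurable.integral_prod_right' (f := fun p : E × E =>
      σ n p.2 * commKernel n V p.1 p.2) ?_
    exact (((hσm n).comp measurable_snd).aestronglyMeasurable).mul
      (continuous_commKernel n hV).aestronglyMeasurable
  have hSi : ∀ n, Integrable fun z => f z * S n z := fun n =>
    hf.mul_bdd (c := C * Λ) (hSm n) (Eventually.of_forall (hSb n))
  have hdecomp : ∀ n z, fderiv ℝ (signTest n f) z (V z) =
      S n z - ∫ y, σ n y * divKernel n V z y := by
    intro n z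
    obtain ⟨C', -, hb'⟩ := exists_mollifier_bound' (E := E) n
    obtain ⟨A, hA, hdiv⟩ := exists_divKernel_bound n hV hΛ
    have hi1 : Integrable fun y => σ n y * commKernel n V z y :=
      (hcomm n V Λ hV hΛ z).1.bdd_mul (c := 1) (hσm n).aestronglyMeasurable
        (Eventually.of_forall (hσ1 n))
    have hi2 : Integrable fun y => σ n y * divKernel n V z y := by
      refine Integrable.bdd_mul (c := 1) ?_ (hσm n).aestronglyMeasurable
        (Eventually.of_forall (hσ1 n))
      have hbi : Integrable ((Metric.closedBall z 1).indicator fun _ => A * (1 + ‖z‖)) := by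
        rw [integrable_indicator_iff measurableSet_closedBall]
        exact integrableOn_const (measure_closedBall_lt_top).ne
      exact hbi.mono' ((continuous_divKernel n hV).comp
        (Continuous.prodMk_right z)).aestronglyMeasurable (Eventually.of_forall fun y => hdiv z y)
    rw [signTest, fderiv_mollify n (locallyIntegrable_of_bounded (hσm n) (hσ1 n)),
      ← integral_sub hi1 hi2]
    refine integral_congr_ae (Eventually.of_forall fun y => ?_)
    simp only [commKernel]
    ring
  have hD : ∀ n, |∫ z, fderiv ℝ (signTest n f) z (V z) * f z| ≤ |∫ z, f z * S n z| := by
    intro n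
    by_cases hi : Integrable fun z => fderiv ℝ (signTest n f) z (V z) * f z
    · have e : ∀ z, fderiv ℝ (signTest n f) z (V z) * f z =
          f z * S n z - f z * ∫ y, σ n y * divKernel n V z y := fun z => by
        rw [hdecomp]; ring
      simp_rw [e] at hi ⊢
      have hT : Integrable fun z => f z * ∫ y, σ n y * divKernel n V z y := by
        refine ((hSi n).sub hi).congr (Eventually.of_forall fun z => ?_)
        simp
      rw [integral_sub (hSi n) hT, integral_mul_integral_sign_divKernel n hf hV hΛ hT, sub_zero]
    · rw [integral_undef hi, abs_zero]
      exact abs_nonneg _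
  constructor
  · intro n
    refine (hD n).trans ?_
    rw [← integral_const_mul, ← Real.norm_eq_abs]
    refine norm_integral_le_of_norm_le (hf.abs.const_mul _) (Eventually.of_forall fun z => ?_)
    rw [norm_mul, mul_comm]
    exact mul_le_mul_of_nonneg_right (hSb n z) (abs_nonneg _)
  · have hlim : Tendsto (fun n => ∫ z, f z * S n z) atTop (𝓝 0) := by
      rw [← integral_zero E ℝ (μ := volume)]
      refine tendsto_integral_of_dominated_convergence (fun z => |f z| * (C * Λ))
        (fun n => (hSi n).aestronglyMeasurable) (hf.abs.mul_const _)
        (fun n => Eventually.of_forall fun z => ?_) ?_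
      · rw [norm_mul]
        exact mul_le_mul_of_nonneg_left (hSb n z) (abs_nonneg _)
      · filter_upwards [ae_eventually_mollify_near hf] with z hz
        by_cases hfz : f z = 0
        · simp [hfz]
        · refine tendsto_const_nhds.congr' ?_
          filter_upwards [hz (|f z| / 2) (by positivity)] with n hn
          have hs : ∀ y, σ n y * commKernel n V z y = Real.sign (f z) * commKernel n V z y := by
            intro y
            by_cases hy : y ∈ Metric.closedBall z (1 / ((n : ℝ) + 1))
            · congr 1
              have h1 := abs_le.1 (hn y hy)
              simp only [hσ]
              rcases lt_or_gt_of_ne hfz with h | h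
              · rw [abs_of_neg h] at h1
                rw [Real.sign_of_neg h, Real.sign_of_neg (by linarith)]
              · rw [abs_of_pos h] at h1
                rw [Real.sign_of_pos h, Real.sign_of_pos (by linarith)]
            · rw [commKernel_eq_zero, mul_zero, mul_zero]
              rw [Metric.mem_closedBall, dist_comm, dist_eq_norm] at hy
              exact not_le.1 hy
          simp only [hS, hs]
          rw [integral_const_mul, integral_commKernel n hV, mul_zero, mul_zero]
    exact squeeze_zero_norm (fun n => hD n) (by simpa using hlim.abs)

end RenormalizationLimit

section GlidingHump

variable {X : Type*} [MeasurableSpace X] {μ : Measure X}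

lemma tendsto_setIntegral_compl_zero {A : ℕ → Set X} (hA : ∀ m, MeasurableSet (A m))
    (hex : ∀ x, ∀ᶠ m in atTop, x ∈ A m) {f : X → ℝ} (hf : Integrable f μ) :
    Tendsto (fun m => ∫ x in (A m)ᶜ, |f x| ∂μ) atTop (𝓝 0) := by
  simp_rw [← integral_indicator (hA _).compl]
  rw [← integral_zero X ℝ (μ := μ)]
  refine tendsto_integral_of_dominated_convergence (fun x => |f x|)
    (fun m => hf.abs.aestronglyMeasurable.indicator (hA m).compl) hf.abs
    (fun m => Eventually.of_forall fun x => ?_) (Eventually.of_forall fun x => ?_)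
  · refine (norm_indicator_le_norm_self _ _).trans ?_
    simp
  · refine tendsto_const_nhds.congr' ?_
    filter_upwards [hex x] with m hm
    simp [hm]

lemma tendsto_integral_abs_zero_of_weak {A : ℕ → Set X} (hA : ∀ m, MeasurableSet (A m))
    (hmono : Monotone A) (hex : ∀ x, ∀ᶠ m in atTop, x ∈ A m) {h : ℕ → X → ℝ}
    (hm : ∀ k, Measurable (h k)) (hi : ∀ k, Integrable (h k) μ)
    (hloc : ∀ m, Tendsto (fun k => ∫ x in A m, |h k x| ∂μ) atTop (𝓝 0))
    (hweak : ∀ σ : X → ℝ, Measurable σ → (∀ x, |σ x| ≤ 1) →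
      Tendsto (fun k => ∫ x, σ x * h k x ∂μ) atTop (𝓝 0)) :
    Tendsto (fun k => ∫ x, |h k x| ∂μ) atTop (𝓝 0) := by
  by_contra hcon
  obtain ⟨ε, hε, hfreq⟩ : ∃ ε > 0, ∃ᶠ k in atTop, ε ≤ ∫ x, |h k x| ∂μ := by
    rw [Metric.tendsto_nhds] at hcon
    push Not at hcon
    obtain ⟨ε, hε, hf⟩ := hcon
    refine ⟨ε, hε, hf.mono fun k hk => ?_⟩
    rw [Real.dist_eq, sub_zero, abs_of_nonneg (integral_nonneg fun _ => abs_nonneg _)] at hk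
    exact hk
  have step : ∀ p : ℕ × ℕ, ∃ q : ℕ × ℕ, p.1 < q.1 ∧ p.2 < q.2 ∧ ε ≤ ∫ x, |h q.1 x| ∂μ ∧
      ∫ x in A p.2, |h q.1 x| ∂μ < ε / 8 ∧ ∫ x in (A q.2)ᶜ, |h q.1 x| ∂μ < ε / 8 := by
    intro p
    obtain ⟨k, hk1, hk2, hk3⟩ := (hfreq.and_eventually
      (((hloc p.2).eventually_lt_const (show (0 : ℝ) < ε / 8 by positivity)).and
        (eventually_gt_atTop p.1))).exists
    obtain ⟨m, hm1, hm2⟩ := (((tendsto_setIntegral_compl_zero hA hex (hi k)).eventually_lt_const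
      (show (0 : ℝ) < ε / 8 by positivity)).and (eventually_gt_atTop p.2)).exists
    exact ⟨(k, m), hk3, hm2, hk1, hk2, hm1⟩
  choose F hF1 hF2 hF3 hF4 hF5 using step
  set s : ℕ → ℕ × ℕ := fun i => F^[i] (0, 0) with hs
  have hsucc : ∀ i, s (i + 1) = F (s i) := fun i => Function.iterate_succ_apply' _ _ _
  have hs1 : StrictMono fun i => (s i).1 := strictMono_nat_of_lt_succ fun i => by
    rw [hsucc]; exact hF1 _
  have hs2 : StrictMono fun i => (s i).2 := strictMono_nat_of_lt_succ fun i => by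
    rw [hsucc]; exact hF2 _
  have hcov : ∀ x, ∃ i, x ∈ A (s i).2 := fun x => by
    obtain ⟨m, hm⟩ := (hex x).exists
    exact ⟨m, hmono (hs2.id_le m) hm⟩
  classical
  set idx : X → ℕ := fun x => Nat.find (hcov x) with hidx
  have hidxm : Measurable idx := measurable_find hcov fun i => hA _
  set σ : X → ℝ := fun x => Real.sign (h (s (idx x)).1 x) with hσ
  have hσm : Measurable σ := by
    have : Measurable (fun p : ℕ × X => Real.sign (h (s p.1).1 p.2)) :=
      measurable_from_prod_countable_right fun i => by
        exact measurable_real_sign.comp (hm (s i).1)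
    exact this.comp (hidxm.prodMk measurable_id)
  have hσ1 : ∀ x, |σ x| ≤ 1 := fun x => abs_sign_le_one _
  have hlim := (hweak σ hσm hσ1).comp ((tendsto_add_atTop_iff_nat 1).2 hs1.tendsto_atTop)
  obtain ⟨i, hlt⟩ := (hlim.eventually_lt_const (show (0 : ℝ) < ε / 2 by positivity)).exists
  simp only [Function.comp_apply] at hlt
  rw [hsucc] at hlt
  set k := (F (s i)).1 with hk
  have hpt : ∀ x, |h k x| - 2 * (A (s i).2).indicator (fun x => |h k x|) x -
      2 * ((A (F (s i)).2)ᶜ).indicator (fun x => |h k x|) x ≤ σ x * h k x := by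
    intro x
    have hge : -|h k x| ≤ σ x * h k x := by
      have := neg_abs_le (σ x * h k x)
      rw [abs_mul] at this
      have h2 := mul_le_mul_of_nonneg_right (hσ1 x) (abs_nonneg (h k x))
      linarith
    have h0 := abs_nonneg (h k x)
    by_cases h1 : x ∈ A (s i).2
    · rw [Set.indicator_of_mem h1]
      have : 0 ≤ ((A (F (s i)).2)ᶜ).indicator (fun x => |h k x|) x :=
        Set.indicator_nonneg (fun _ _ => abs_nonneg _) _
      linarith
    · by_cases h2 : x ∈ A (F (s i)).2
      · have hx : idx x = i + 1 := by
          rw [hidx]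
          simp only
          rw [Nat.find_eq_iff]
          refine ⟨by rw [hsucc]; exact h2, fun j hj hjx => h1 ?_⟩
          exact hmono (hs2.monotone (Nat.lt_succ_iff.1 hj)) hjx
        rw [Set.indicator_of_notMem h1, Set.indicator_of_notMem (by simpa using h2)]
        simp only [hσ, hx, hsucc, ← hk, sign_mul_self_eq_abs]
        linarith
      · rw [Set.indicator_of_notMem h1, Set.indicator_of_mem (by simpa using h2)]
        linarith
  have i1 : Integrable ((A (s i).2).indicator fun x => |h k x|) μ := (hi k).abs.indicator (hA _)
  have i2 : Integrable (((A (F (s i)).2)ᶜ).indicator fun x => |h k x|) μ :=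
    (hi k).abs.indicator (hA _).compl
  have hint := integral_mono (((hi k).abs.sub (i1.const_mul 2)).sub (i2.const_mul 2))
    ((hi k).bdd_mul (c := 1) hσm.aestronglyMeasurable (Eventually.of_forall hσ1)) hpt
  simp only [Pi.sub_apply] at hint
  have i3 : Integrable (fun x => |h k x| - 2 * (A (s i).2).indicator (fun x => |h k x|) x) μ :=
    (hi k).abs.sub (i1.const_mul 2)
  rw [integral_sub i3 (i2.const_mul 2), integral_sub (hi k).abs (i1.const_mul 2), integral_const_mul, integral_const_mul,
    integral_indicator (hA _), integral_indicator (hA _).compl] at hint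
  have := hF3 (s i)
  have := hF4 (s i)
  have := hF5 (s i)
  linarith

end GlidingHump

section TouchingFunctions

lemma sub_le_mul_of_touching {Q : ℝ → ℝ} {a b M : ℝ} (hab : a ≤ b) (hQ : ContinuousOn Q (Set.Icc a b))
    (h : ∀ x ∈ Set.Ico a b, ∃ (ψ : ℝ → ℝ) (D : ℝ), D ≤ M ∧ ψ x = Q x ∧
      (∀ s ∈ Set.Ioo x b, Q s ≤ ψ s) ∧ HasDerivAt ψ D x) :
    Q b - Q a ≤ M * (b - a) := by
  have := image_le_of_liminf_slope_right_le_deriv_boundary hQ (B := fun x => Q a + M * (x - a))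
    (B' := fun _ => M) (by simp) (by fun_prop)
    (fun x _ => by
      simpa using ((((hasDerivAt_id x).sub_const a).const_mul M).const_add (Q a)).hasDerivWithinAt)
    (fun x hx r hr => ?_) (Set.right_mem_Icc.2 hab)
  · linarith
  · obtain ⟨ψ, D, hD, hx0, hle, hder⟩ := h x hx
    have h1 := (hasDerivAt_iff_tendsto_slope.1 hder).mono_left
      (nhdsWithin_mono x (fun y (hy : x < y) => hy.ne'))
    refine Eventually.frequently ?_
    filter_upwards [h1.eventually_lt_const (lt_of_le_of_lt hD hr), self_mem_nhdsWithin,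
      Ioo_mem_nhdsGT hx.2] with z hz hz1 hz2
    refine lt_of_le_of_lt ?_ hz
    rw [slope_def_field, slope_def_field, hx0]
    have : 0 < z - x := sub_pos.2 hz1
    have := hle z hz2
    gcongr

lemma lipschitzOnWith_of_touching_below {Q : ℝ → ℝ} {p q : ℝ} {M : ℝ≥0} (hpq : p < q)
    (hQ : ContinuousOn Q (Set.Icc p q))
    (h : ∀ x ∈ Set.Ioo p q, ∃ (ψ : ℝ → ℝ) (D : ℝ), |D| ≤ M ∧ ψ x = Q x ∧
      (∀ s ∈ Set.Icc p q, ψ s ≤ Q s) ∧ HasDerivAt ψ D x) :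
    LipschitzOnWith M Q (Set.Icc p q) := by
  rw [← closure_Ioo hpq.ne] at hQ ⊢
  refine LipschitzOnWith.closure hQ ?_
  rw [closure_Ioo hpq.ne] at hQ
  refine LipschitzOnWith.of_dist_le_mul fun a ha b hb => ?_
  wlog hab : a ≤ b generalizing a b
  · rw [dist_comm, dist_comm a b]
    exact this b hb a ha (le_of_not_ge hab)
  have hsub : ∀ x, a ≤ x → x ≤ b → x ∈ Set.Ioo p q := fun x h1 h2 =>
    ⟨ha.1.trans_le h1, h2.trans_lt hb.2⟩
  have hsub' : ∀ x, a ≤ x → x ≤ b → x ∈ Set.Icc p q := fun x h1 h2 =>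
    Set.Ioo_subset_Icc_self (hsub x h1 h2)
  have h1 : -Q b - -Q a ≤ M * (b - a) := by
    refine sub_le_mul_of_touching (Q := fun x => -Q x) hab
      ((hQ.mono fun x hx => hsub' x hx.1 hx.2).neg) fun x hx => ?_
    obtain ⟨ψ, D, hD, hx0, hle, hder⟩ := h x (hsub x hx.1 hx.2.le)
    refine ⟨fun s => -ψ s, -D, (neg_le_abs D).trans hD, by simp [hx0], fun s hs => ?_, hder.neg⟩
    exact neg_le_neg (hle s (hsub' s (hx.1.trans hs.1.le) hs.2.le))
  have h2 : -Q (- -a) - -Q (- -b) ≤ M * (-a - -b) := by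
    refine sub_le_mul_of_touching (Q := fun x => -Q (-x)) (neg_le_neg hab) ?_ fun x hx => ?_
    · refine ContinuousOn.neg (hQ.comp continuous_neg.continuousOn fun x hx => ?_)
      exact hsub' (-x) (by linarith [hx.2]) (by linarith [hx.1])
    · obtain ⟨ψ, D, hD, hx0, hle, hder⟩ := h (-x)
        (hsub (-x) (by linarith [hx.2]) (by linarith [hx.1]))
      refine ⟨fun s => -ψ (-s), D, (le_abs_self D).trans hD, by simp [hx0], fun s hs => ?_, ?_⟩
      · exact neg_le_neg (hle (-s) (hsub' (-s) (by linarith [hs.2])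
          (by linarith [hs.1, hx.1])))
      · have := (hder.comp x (hasDerivAt_neg x)).neg
        rw [mul_neg_one, neg_neg] at this
        exact this
  rw [neg_neg, neg_neg] at h2
  rw [Real.dist_eq, dist_comm, Real.dist_eq, abs_of_nonneg (sub_nonneg.2 hab), abs_le]
  constructor <;> linarith

end TouchingFunctions

section Conservation

variable {E : Type*} [NormedAddCommGroup E] [InnerProductSpace ℝ E] [FiniteDimensional ℝ E]
  [MeasurableSpace E] [BorelSpace E]

/-- Bounded functions of class `C¹` with bounded derivative. -/
structure IsTestFunction (φ : E → ℝ) : Prop where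
  contDiff : ContDiff ℝ 1 φ
  bounded : ∃ C : ℝ, ∀ z, |φ z| ≤ C
  fderiv_bounded : ∃ C : ℝ, ∀ z, ‖fderiv ℝ φ z‖ ≤ C

lemma IsTestFunction.integrable_mul {φ f : E → ℝ} (hφ : IsTestFunction φ) (hf : Integrable f) :
    Integrable fun z => φ z * f z := by
  obtain ⟨C, hC⟩ := hφ.bounded
  exact hf.bdd_mul (c := C) hφ.contDiff.continuous.aestronglyMeasurable (Eventually.of_forall hC)

lemma IsTestFunction.const (c : ℝ) : IsTestFunction fun _ : E => c :=
  ⟨contDiff_const, ⟨|c|, fun _ => le_rfl⟩, ⟨0, fun z => by simp⟩⟩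

lemma isTestFunction_mollify (n : ℕ) {u : E → ℝ} {M : ℝ} (hm : Measurable u)
    (hu : ∀ z, |u z| ≤ M) : IsTestFunction (mollify n u) :=
  ⟨contDiff_mollify n (locallyIntegrable_of_bounded hm hu), ⟨M, abs_mollify_le hu⟩,
    exists_fderiv_mollify_bound n hm hu⟩

lemma isTestFunction_signTest (n : ℕ) {f : E → ℝ} (hf : Integrable f) :
    IsTestFunction (signTest n f) :=
  isTestFunction_mollify n (measurable_sign_mollify n hf) fun _ => abs_sign_le_one _

lemma isTestFunction_mollifier_sub (n : ℕ) (y : E) :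
    IsTestFunction fun z : E => mollifier n (y - z) := by
  obtain ⟨C, -, hC⟩ := exists_mollifier_bound' (E := E) n
  simp_rw [mollifier_sub_comm n y]
  refine ⟨(contDiff_mollifier n).comp (contDiff_id.sub contDiff_const), ⟨C, fun z => (hC _).1⟩,
    ⟨C, fun z => ?_⟩⟩
  rw [fderiv_comp_sub (f := (mollifier n : E → ℝ)) y]
  exact (hC _).2

lemma integrable_mul_mollifier_sub (n : ℕ) {f : E → ℝ} (hf : Integrable f) (y : E) :
    Integrable fun z => f z * mollifier n (y - z) := by
  simpa only [mul_comm] using (isTestFunction_mollifier_sub n y).integrable_mul hf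

lemma mollify_sub (n : ℕ) {f g : E → ℝ} (hf : Integrable f) (hg : Integrable g) (y : E) :
    mollify n (fun z => f z - g z) y = mollify n f y - mollify n g y := by
  simp only [mollify, sub_mul]
  exact integral_sub (integrable_mul_mollifier_sub n hf y) (integrable_mul_mollifier_sub n hg y)

lemma tendsto_integral_abs_mollify (n : ℕ) {h : ℕ → E → ℝ} {c : ℝ} (hi : ∀ k, Integrable (h k))
    (hc : ∀ k, ∫ z, |h k z| ≤ c)
    (hweak : ∀ φ : E → ℝ, IsTestFunction φ → Tendsto (fun k => ∫ z, φ z * h k z) atTop (𝓝 0)) :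
    Tendsto (fun k => ∫ z, |mollify n (h k) z|) atTop (𝓝 0) := by
  have hcont : ∀ k, Continuous (mollify n (h k)) := fun k =>
    (contDiff_mollify n (hi k).locallyIntegrable).continuous
  refine tendsto_integral_abs_zero_of_weak (A := fun m : ℕ => Metric.closedBall (0 : E) m)
    (fun m => measurableSet_closedBall)
    (fun a b hab => Metric.closedBall_subset_closedBall (by exact_mod_cast hab))
    (fun x => ?_) (fun k => (hcont k).measurable) (fun k => integrable_mollify n (hi k))
    (fun m => ?_) (fun σ hσ hσ1 => ?_)
  · filter_upwards [eventually_ge_atTop ⌈‖x‖⌉₊] with m hm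
    rw [mem_closedBall_zero_iff]
    exact Nat.ceil_le.1 hm
  · obtain ⟨C, hC0, hC⟩ := exists_mollifier_bound' (E := E) n
    rw [← integral_zero E ℝ (μ := volume.restrict (Metric.closedBall (0 : E) m))]
    refine tendsto_integral_of_dominated_convergence (fun _ => c * C)
      (fun k => (hcont k).abs.aestronglyMeasurable)
      (integrableOn_const measure_closedBall_lt_top.ne)
      (fun k => Eventually.of_forall fun y => ?_) (Eventually.of_forall fun y => ?_)
    · rw [Real.norm_eq_abs, abs_abs]
      calc |mollify n (h k) y| ≤ ∫ z, |h k z| * C := by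
            rw [mollify, ← Real.norm_eq_abs]
            refine norm_integral_le_of_norm_le ((hi k).abs.mul_const C)
              (Eventually.of_forall fun z => ?_)
            rw [norm_mul, Real.norm_eq_abs, Real.norm_eq_abs]
            exact mul_le_mul_of_nonneg_left (hC _).1 (abs_nonneg _)
        _ = (∫ z, |h k z|) * C := integral_mul_const _ _
        _ ≤ c * C := mul_le_mul_of_nonneg_right (hc k) hC0
    · have := (hweak _ (isTestFunction_mollifier_sub n y)).abs
      simpa only [mollify, mul_comm, abs_zero] using this
  · refine (hweak _ (isTestFunction_mollify n hσ hσ1)).congr fun k => ?_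
    exact integral_mul_mollify n (hi k) hσ hσ1

lemma continuousOn_integral_abs_mollify (n : ℕ) {h : ℝ → E → ℝ} {s : Set ℝ} {c : ℝ}
    (hi : ∀ t ∈ s, Integrable (h t)) (hc : ∀ t ∈ s, ∫ z, |h t z| ≤ c)
    (hcont : ∀ φ : E → ℝ, IsTestFunction φ → ContinuousOn (fun t => ∫ z, φ z * h t z) s) :
    ContinuousOn (fun t => ∫ z, |mollify n (h t) z|) s := by
  intro t₀ ht₀
  refine tendsto_of_seq_tendsto fun u hu => ?_
  have hus : ∀ᶠ k in atTop, u k ∈ s := hu.eventually self_mem_nhdsWithin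
  obtain ⟨N, hN⟩ := eventually_atTop.1 hus
  rw [← tendsto_add_atTop_iff_nat N]
  have hu' : Tendsto (fun k => u (k + N)) atTop (𝓝[s] t₀) := hu.comp (tendsto_add_atTop_nat N)
  have hmem : ∀ k, u (k + N) ∈ s := fun k => hN _ (by lia)
  have hlim := tendsto_integral_abs_mollify n (h := fun k z => h (u (k + N)) z - h t₀ z)
    (c := c + c) (fun k => (hi _ (hmem k)).sub (hi _ ht₀)) (fun k => ?_) (fun φ hφ => ?_)
  · rw [tendsto_iff_dist_tendsto_zero]
    refine squeeze_zero (fun _ => dist_nonneg) (fun k => ?_) hlim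
    have i1 := integrable_mollify n (hi _ (hmem k))
    have i2 := integrable_mollify n (hi _ ht₀)
    simp only [Function.comp_apply]
    rw [Real.dist_eq, ← integral_sub i1.abs i2.abs, ← Real.norm_eq_abs]
    simp_rw [mollify_sub n (hi _ (hmem k)) (hi _ ht₀)]
    exact norm_integral_le_of_norm_le (i1.sub i2).abs
      (Eventually.of_forall fun z => abs_abs_sub_abs_le_abs_sub _ _)
  · calc ∫ z, |h (u (k + N)) z - h t₀ z| ≤ ∫ z, (|h (u (k + N)) z| + |h t₀ z|) :=
          integral_mono ((hi _ (hmem k)).sub (hi _ ht₀)).abs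
            ((hi _ (hmem k)).abs.add (hi _ ht₀).abs) fun z => abs_sub _ _
      _ = (∫ z, |h (u (k + N)) z|) + ∫ z, |h t₀ z| :=
          integral_add (hi _ (hmem k)).abs (hi _ ht₀).abs
      _ ≤ c + c := add_le_add (hc _ (hmem k)) (hc _ ht₀)
  · have h1 := ((hcont φ hφ t₀ ht₀).tendsto.comp hu').sub_const (∫ z, φ z * h t₀ z)
    rw [sub_self] at h1
    refine h1.congr fun k => ?_
    simp only [Function.comp_apply, mul_sub]
    exact (integral_sub (hφ.integrable_mul (hi _ (hmem k))) (hφ.integrable_mul (hi _ ht₀))).symm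

lemma tendsto_integral_abs_mollify_self {f : E → ℝ} (hf : Integrable f) :
    Tendsto (fun n => ∫ z, |mollify n f z|) atTop (𝓝 (∫ z, |f z|)) := by
  have hm : ∀ n, Integrable (mollify n f) := fun n => integrable_mollify n hf
  have key : Tendsto (fun n => ∫⁻ z, ‖mollify n f z‖ₑ) atTop (𝓝 (∫⁻ z, ‖f z‖ₑ)) := by
    refine tendsto_of_le_liminf_of_limsup_le ?_ ?_
    · calc ∫⁻ z, ‖f z‖ₑ = ∫⁻ z, liminf (fun n => ‖mollify n f z‖ₑ) atTop := by
            refine lintegral_congr_ae ?_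
            filter_upwards [ae_tendsto_mollify hf] with z hz
            exact (hz.enorm).liminf_eq.symm
        _ ≤ _ := lintegral_liminf_le' fun n => (hm n).aestronglyMeasurable.enorm
    · refine limsup_le_of_le (h := Eventually.of_forall fun n => ?_)
      rw [← ofReal_integral_norm_eq_lintegral_enorm (hm n),
        ← ofReal_integral_norm_eq_lintegral_enorm hf]
      exact ENNReal.ofReal_le_ofReal (integral_abs_mollify_le n hf)
  have := (ENNReal.tendsto_toReal hf.hasFiniteIntegral.ne).comp key
  simpa only [Function.comp_def, ← integral_norm_eq_lintegral_enorm hf.aestronglyMeasurable,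
    ← integral_norm_eq_lintegral_enorm (hm _).aestronglyMeasurable, Real.norm_eq_abs] using this

/-- Conservation of the total variation for weak solutions of a linear transport equation with
Lipschitz drift. -/
theorem integral_abs_eq_of_transport {h : ℝ → E → ℝ} {V : ℝ → E → E} {p q c Λ : ℝ} (hpq : p ≤ q)
    (hi : ∀ t ∈ Set.Icc p q, Integrable (h t)) (hc : ∀ t ∈ Set.Icc p q, ∫ z, |h t z| ≤ c)
    (hV : ∀ t ∈ Set.Ioo p q, ContDiff ℝ 1 (V t))
    (hΛ : ∀ t ∈ Set.Ioo p q, ∀ z, ‖fderiv ℝ (V t) z‖ ≤ Λ)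
    (hcont : ∀ φ : E → ℝ, IsTestFunction φ →
      ContinuousOn (fun t => ∫ z, φ z * h t z) (Set.Icc p q))
    (hder : ∀ φ : E → ℝ, IsTestFunction φ → ∀ t ∈ Set.Ioo p q,
      HasDerivAt (fun s => ∫ z, φ z * h s z) (∫ z, fderiv ℝ φ z (V t z) * h t z) t) :
    ∫ z, |h p z| = ∫ z, |h q z| := by
  rcases hpq.eq_or_lt with rfl | hpq
  · rfl
  obtain ⟨C, hC0, hC⟩ := exists_renormalization_bound E
  have hsub : ∀ t ∈ Set.Ioo p q, t ∈ Set.Icc p q := fun t ht => Set.Ioo_subset_Icc_self ht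
  obtain ⟨t₁, ht₁⟩ := Set.nonempty_Ioo.2 hpq
  have hΛ0 : 0 ≤ Λ := (norm_nonneg _).trans (hΛ t₁ ht₁ 0)
  have hc0 : 0 ≤ c := (integral_nonneg fun _ => abs_nonneg _).trans (hc t₁ (hsub t₁ ht₁))
  set Q : ℕ → ℝ → ℝ := fun n t => ∫ z, |mollify n (h t) z| with hQ
  set D : ℕ → ℝ → ℝ := fun n t => ∫ z, fderiv ℝ (signTest n (h t)) z (V t z) * h t z with hD
  have hDb : ∀ n, ∀ t ∈ Set.Ioo p q, |D n t| ≤ C * Λ * c := fun n t ht =>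
    ((hC (h t) (V t) Λ (hi t (hsub t ht)) (hV t ht) (hΛ t ht)).1 n).trans
      (mul_le_mul_of_nonneg_left (hc t (hsub t ht)) (by positivity))
  have htouch : ∀ n, ∀ t ∈ Set.Ioo p q, ∃ ψ : ℝ → ℝ, ψ t = Q n t ∧
      (∀ s ∈ Set.Icc p q, ψ s ≤ Q n s) ∧ HasDerivAt ψ (D n t) t := fun n t ht =>
    ⟨fun s => ∫ z, signTest n (h t) z * h s z, integral_signTest_mul n (hi t (hsub t ht)),
      fun s hs => integral_signTest_mul_le n (hi t (hsub t ht)) (hi s hs),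
      hder _ (isTestFunction_signTest n (hi t (hsub t ht))) t ht⟩
  have hlip : ∀ n, LipschitzOnWith (Real.toNNReal (C * Λ * c)) (Q n) (Set.Icc p q) := by
    intro n
    refine lipschitzOnWith_of_touching_below hpq
      (continuousOn_integral_abs_mollify n hi hc hcont) fun t ht => ?_
    obtain ⟨ψ, h1, h2, h3⟩ := htouch n t ht
    refine ⟨ψ, D n t, ?_, h1, h2, h3⟩
    rw [Real.coe_toNNReal _ (by positivity)]
    exact hDb n t ht
  have hac : ∀ n, AbsolutelyContinuousOnInterval (Q n) p q := fun n =>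
    (Set.uIcc_of_le hpq.le ▸ hlip n).absolutelyContinuousOnInterval
  have hderiv : ∀ n, ∀ᵐ t : ℝ, t ∈ Set.Ioo p q → deriv (Q n) t = D n t := by
    intro n
    filter_upwards [(hac n).ae_differentiableAt] with t ht htm
    have hdt := ht (by rw [Set.uIcc_of_le hpq.le]; exact hsub t htm)
    obtain ⟨ψ, h1, h2, h3⟩ := htouch n t htm
    have hmin : IsLocalMin (fun s => Q n s - ψ s) t := by
      filter_upwards [Icc_mem_nhds htm.1 htm.2] with s hs
      rw [h1, sub_self]
      exact sub_nonneg.2 (h2 s hs)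
    exact sub_eq_zero.1 (hmin.hasDerivAt_eq_zero (hdt.hasDerivAt.sub h3))
  have hpqne : ∀ᵐ t : ℝ, t ≠ q := by
    simp [ae_iff]
  have hlim : Tendsto (fun n => ∫ t in p..q, deriv (Q n) t) atTop (𝓝 0) := by
    rw [← intervalIntegral.integral_zero (μ := volume) (a := p) (b := q)]
    have hae : ∀ᵐ t : ℝ, t ∈ Set.uIoc p q → t ∈ Set.Ioo p q := by
      filter_upwards [hpqne] with t ht htm
      rw [Set.uIoc_of_le hpq.le] at htm
      exact ⟨htm.1, lt_of_le_of_ne htm.2 ht⟩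
    refine intervalIntegral.tendsto_integral_filter_of_dominated_convergence
      (fun _ => C * Λ * c) (Eventually.of_forall fun n => (measurable_deriv _).aestronglyMeasurable)
      (Eventually.of_forall fun n => ?_) intervalIntegrable_const ?_
    · filter_upwards [hae, hderiv n] with t h1 h2 h3
      rw [h2 (h1 h3)]
      exact hDb n t (h1 h3)
    · filter_upwards [hae, ae_all_iff.2 hderiv] with t h1 h2 h3
      simp_rw [fun n => h2 n (h1 h3)]
      have ht := h1 h3
      exact (hC (h t) (V t) Λ (hi t (hsub t ht)) (hV t ht) (hΛ t ht)).2
  simp_rw [(hac _).integral_deriv_eq_sub] at hlim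
  have h1 := (tendsto_integral_abs_mollify_self (hi q (Set.right_mem_Icc.2 hpq.le))).sub
    (tendsto_integral_abs_mollify_self (hi p (Set.left_mem_Icc.2 hpq.le)))
  have := tendsto_nhds_unique h1 hlim
  linarith

end Conservation

section LocallyBoundedConservation

lemma eq_of_eventually_bounded_Ioc {T : ℝ → ℝ} (hcl : ∀ c, IsClosed {t | T t ≤ c})
    (hcons : ∀ p q c, p ≤ q → (∀ t ∈ Set.Icc p q, T t ≤ c) → T p = T q) {a s : ℝ} (has : a < s)
    (hloc : ∀ x ∈ Set.Ioc a s, ∃ c, ∀ᶠ y in 𝓝 x, T y ≤ c) : T a = T s := by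
  have h1 : ∀ p ∈ Set.Ioc a s, T p = T s := by
    intro p hp
    have : ∃ c, ∀ t ∈ Set.Icc p s, T t ≤ c := by
      refine isCompact_Icc.induction_on (p := fun A => ∃ c, ∀ t ∈ A, T t ≤ c) ⟨0, by simp⟩
        (fun A B hAB ⟨c, hc⟩ => ⟨c, fun t ht => hc t (hAB ht)⟩)
        (fun A B ⟨c, hc⟩ ⟨c', hc'⟩ => ⟨max c c', fun t ht => ht.elim
          (fun h => (hc t h).trans (le_max_left _ _)) fun h => (hc' t h).trans (le_max_right _ _)⟩)
        fun x hx => ?_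
      obtain ⟨c, hc⟩ := hloc x ⟨hp.1.trans_le hx.1, hx.2⟩
      exact ⟨_, mem_nhdsWithin_of_mem_nhds hc, c, fun t ht => ht⟩
    obtain ⟨c, hc⟩ := this
    exact hcons p s c hp.2 hc
  have h2 : a ∈ {t | T t ≤ T s} := by
    refine (hcl (T s)).mem_of_frequently_of_tendsto (f := fun x => x) (b := 𝓝[>] a)
      (Eventually.frequently ?_) (tendsto_id'.2 nhdsWithin_le_nhds)
    filter_upwards [Ioc_mem_nhdsGT has] with x hx
    exact (h1 x hx).le
  refine hcons a s (T s) has.le fun t ht => ?_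
  rcases ht.1.eq_or_lt with rfl | h
  · exact h2
  · exact (h1 t ⟨h, ht.2⟩).le

lemma le_of_eventually_bounded_right {T : ℝ → ℝ} (hcl : ∀ c, IsClosed {t | T t ≤ c})
    (hcons : ∀ p q c, p ≤ q → (∀ t ∈ Set.Icc p q, T t ≤ c) → T p = T q) {x₀ s c : ℝ} (hs : x₀ ≤ s)
    (hx₀ : ¬ ∃ c, ∀ᶠ y in 𝓝 x₀, T y ≤ c)
    (hc : ∀ x ∈ Set.Icc x₀ s, (¬ ∃ c, ∀ᶠ y in 𝓝 x, T y ≤ c) → T x ≤ c) : T s ≤ c := by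
  set B : Set ℝ := {x | ∃ c, ∀ᶠ y in 𝓝 x, T y ≤ c}ᶜ with hB
  have hBcl : IsClosed B := by
    rw [hB, isClosed_compl_iff, isOpen_iff_mem_nhds]
    rintro x ⟨c, hc⟩
    filter_upwards [eventually_eventually_nhds.2 hc] with y hy
    exact ⟨c, hy⟩
  obtain ⟨a, ⟨haB, ha⟩, hgr⟩ := (isCompact_Icc.inter_left hBcl).exists_isGreatest
    ⟨x₀, hx₀, Set.left_mem_Icc.2 hs⟩
  rcases ha.2.eq_or_lt with rfl | has
  · exact hc a ha haB
  · rw [← eq_of_eventually_bounded_Ioc hcl hcons has fun x hx => ?_]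
    · exact hc a ha haB
    · by_contra hxB
      exact absurd (hgr ⟨hxB, ha.1.trans hx.1.le, hx.2⟩) (not_le.2 hx.1)

/-- A lower semicontinuous function which is constant on every interval where it is bounded is
constant. -/
theorem eq_of_const_of_bounded {T : ℝ → ℝ} (hcl : ∀ c, IsClosed {t | T t ≤ c})
    (hcons : ∀ p q c, p ≤ q → (∀ t ∈ Set.Icc p q, T t ≤ c) → T p = T q) (p q : ℝ) :
    T p = T q := by
  set B : Set ℝ := {x | ∃ c, ∀ᶠ y in 𝓝 x, T y ≤ c}ᶜ with hB
  have hBcl : IsClosed B := by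
    rw [hB, isClosed_compl_iff, isOpen_iff_mem_nhds]
    rintro x ⟨c, hc⟩
    filter_upwards [eventually_eventually_nhds.2 hc] with y hy
    exact ⟨c, hy⟩
  have hBe : B = ∅ := by
    by_contra hne
    have : Nonempty B := (Set.nonempty_iff_ne_empty.2 hne).to_subtype
    have : CompleteSpace B := hBcl.completeSpace_coe
    obtain ⟨n, x, hx⟩ := nonempty_interior_of_iUnion_of_closed
      (f := fun n : ℕ => {x : B | T x ≤ n}) (fun n => (hcl n).preimage continuous_subtype_val)
      (by
        rw [Set.eq_univ_iff_forall]
        intro x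
        obtain ⟨n, hn⟩ := exists_nat_ge (T x)
        exact Set.mem_iUnion.2 ⟨n, hn⟩)
    rw [mem_interior_iff_mem_nhds, Metric.mem_nhds_iff] at hx
    obtain ⟨ε, hε, hball⟩ := hx
    have hbd : ∀ y ∈ B, |y - x| < ε → T y ≤ n := fun y hy hyx =>
      hball (show (⟨y, hy⟩ : B) ∈ Metric.ball x ε from hyx)
    refine x.2 ⟨n, ?_⟩
    filter_upwards [Metric.ball_mem_nhds (x : ℝ) hε] with s hs
    rw [Metric.mem_ball, Real.dist_eq, abs_lt] at hs
    rcases le_total (x : ℝ) s with h | h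
    · refine le_of_eventually_bounded_right hcl hcons h x.2 fun y hy hyB => hbd y hyB ?_
      rw [abs_lt]
      constructor <;> linarith [hy.1, hy.2]
    · have hneg : ∀ y, (∃ c, ∀ᶠ u in 𝓝 (-y), T u ≤ c) ↔ ∃ c, ∀ᶠ u in 𝓝 y, T (-u) ≤ c := by
        intro y
        have : 𝓝 (-y) = map Neg.neg (𝓝 y) := ((Homeomorph.neg ℝ).map_nhds_eq y).symm
        simp_rw [this, eventually_map]
      rw [← neg_neg s]
      refine le_of_eventually_bounded_right (T := fun t => T (-t)) (x₀ := -x)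
        (fun c => (hcl c).preimage continuous_neg) (fun p q c hpq h => ?_) (neg_le_neg h) ?_ ?_
      · refine (hcons (-q) (-p) c (neg_le_neg hpq) fun t ht => ?_).symm
        simpa using h (-t) ⟨by linarith [ht.2], by linarith [ht.1]⟩
      · rw [← hneg, neg_neg]
        exact x.2
      · intro y hy hyB
        rw [← hneg] at hyB
        refine hbd _ hyB ?_
        rw [abs_lt]
        constructor <;> linarith [hy.1, hy.2]
  wlog hpq : p ≤ q generalizing p q
  · exact (this q p (le_of_not_ge hpq)).symm
  rcases hpq.eq_or_lt with rfl | hpq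
  · rfl
  refine eq_of_eventually_bounded_Ioc hcl hcons hpq fun x _ => ?_
  by_contra hx
  have : x ∈ B := hx
  simp [hBe] at this

end LocallyBoundedConservation

section MeanField

variable {E : Type*} [NormedAddCommGroup E] [InnerProductSpace ℝ E] [FiniteDimensional ℝ E]
  [MeasurableSpace E] [BorelSpace E]

/-- Antisymmetric interaction kernels of class `C¹`, Lipschitz in each variable. -/
structure IsInteractionKernel (L : ℝ) (K : E × E → E) : Prop where
  nonneg : 0 ≤ L
  contDiff : ContDiff ℝ 1 K
  antisymm : ∀ z z', K (z, z') = -K (z', z)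
  fderiv_left : ∀ z z', ‖fderiv ℝ (fun w => K (w, z')) z‖ ≤ L
  fderiv_right : ∀ z z', ‖fderiv ℝ (fun w => K (z, w)) z'‖ ≤ L

/-- The mean field velocity created by the density `g`. -/
def meanField (K : E × E → E) (g : E → ℝ) (z : E) : E := ∫ z', g z' • K (z, z')

/-- Integrable weak solutions of the mean field equation. -/
structure IsMeanFieldSolution (K : E × E → E) (f : ℝ → E → ℝ) : Prop where
  integrable : ∀ t, Integrable (f t)
  hasDerivAt : ∀ φ : E → ℝ, IsTestFunction φ → ∀ t,
    HasDerivAt (fun s => ∫ z, φ z * f s z) (∫ z, fderiv ℝ φ z (meanField K (f t) z) * f t z) t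

namespace IsInteractionKernel

variable {L : ℝ} {K : E × E → E} (hK : IsInteractionKernel L K)
include hK

lemma norm_sub_left_le (z w z' : E) : ‖K (z, z') - K (w, z')‖ ≤ L * ‖z - w‖ :=
  norm_sub_le_of_fderiv_le (hK.contDiff.comp (contDiff_id.prodMk contDiff_const))
    (fun y => hK.fderiv_left y z') z w

lemma norm_sub_right_le (z z' w : E) : ‖K (z, z') - K (z, w)‖ ≤ L * ‖z' - w‖ :=
  norm_sub_le_of_fderiv_le (hK.contDiff.comp (contDiff_const.prodMk contDiff_id))
    (fun y => hK.fderiv_right z y) z' w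

lemma self_eq_zero (z : E) : K (z, z) = 0 := by
  have h : (2 : ℝ) • K (z, z) = 0 := by
    rw [two_smul]
    exact eq_neg_iff_add_eq_zero.1 (hK.antisymm z z)
  exact (smul_eq_zero.1 h).resolve_left two_ne_zero

lemma norm_le (z z' : E) : ‖K (z, z')‖ ≤ L * ‖z - z'‖ := by
  have := hK.norm_sub_left_le z z' z'
  rwa [hK.self_eq_zero, sub_zero] at this

lemma continuous_right (z : E) : Continuous fun z' => K (z, z') :=
  hK.contDiff.continuous.comp (by fun_prop)

lemma integrable_smul_iff {g : E → ℝ} (hg : Integrable g) (z w : E) :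
    Integrable (fun z' => g z' • K (z, z')) ↔ Integrable (fun z' => g z' • K (w, z')) := by
  have key : ∀ z w : E, Integrable (fun z' => g z' • K (w, z')) →
      Integrable (fun z' => g z' • K (z, z')) := by
    intro z w h
    have : Integrable (fun z' => g z' • (K (z, z') - K (w, z'))) :=
      hg.smul_bdd (L * ‖z - w‖)
        ((hK.continuous_right z).sub (hK.continuous_right w)).aestronglyMeasurable
        (Eventually.of_forall fun z' => hK.norm_sub_left_le z w z')
    refine (h.add this).congr (Eventually.of_forall fun z' => ?_)
    simp only [Pi.add_apply, smul_sub]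
    abel
  exact ⟨key w z, key z w⟩

lemma hasFDerivAt_left (z z' : E) : HasFDerivAt (fun w => K (w, z'))
    ((fderiv ℝ K (z, z')).comp (ContinuousLinearMap.inl ℝ E E)) z :=
  ((hK.contDiff.differentiable one_ne_zero (z, z')).hasFDerivAt).comp z
    (hasFDerivAt_prodMk_left z z')

lemma contDiff_meanField {g : E → ℝ} (hg : Integrable g) :
    ContDiff ℝ 1 (meanField K g) ∧ ∀ z, ‖fderiv ℝ (meanField K g) z‖ ≤ L * ∫ z, |g z| := by
  by_cases hi : Integrable (fun z' => g z' • K (0, z'))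
  · have hiz : ∀ z, Integrable (fun z' => g z' • K (z, z')) := fun z =>
      (hK.integrable_smul_iff hg z 0).2 hi
    set F' : E → E → E →L[ℝ] E := fun z z' =>
      g z' • (fderiv ℝ K (z, z')).comp (ContinuousLinearMap.inl ℝ E E) with hF'
    have hdc : Continuous (fderiv ℝ K) := hK.contDiff.continuous_fderiv one_ne_zero
    have hFm : ∀ z, AEStronglyMeasurable (F' z) := fun z =>
      hg.aestronglyMeasurable.smul (Continuous.aestronglyMeasurable
        ((hdc.comp (by fun_prop)).clm_comp continuous_const))
    have hFb : ∀ z z', ‖F' z z'‖ ≤ L * |g z'| := by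
      intro z z'
      rw [hF', norm_smul, Real.norm_eq_abs, mul_comm L]
      refine mul_le_mul_of_nonneg_left ?_ (abs_nonneg _)
      rw [← (hK.hasFDerivAt_left z z').fderiv]
      exact hK.fderiv_left z z'
    have hbi : Integrable (fun z' => L * |g z'|) := hg.abs.const_mul L
    have hd : ∀ z, HasFDerivAt (meanField K g) (∫ z', F' z z') z := fun z =>
      hasFDerivAt_integral_of_dominated_of_fderiv_le (s := Set.univ) univ_mem
        (Eventually.of_forall fun w => (hiz w).aestronglyMeasurable) (hiz z) (hFm z)
        (Eventually.of_forall fun z' w _ => hFb w z') hbi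
        (Eventually.of_forall fun z' w _ => (hK.hasFDerivAt_left w z').const_smul (g z'))
    refine ⟨contDiff_one_iff_fderiv.2 ⟨fun z => (hd z).differentiableAt, ?_⟩, fun z => ?_⟩
    · rw [funext fun z => (hd z).fderiv]
      refine continuous_of_dominated hFm (fun z => Eventually.of_forall fun z' => hFb z z') hbi
        (Eventually.of_forall fun z' => ?_)
      exact (((hdc.comp (by fun_prop)).clm_comp continuous_const)).const_smul (g z')
    · rw [(hd z).fderiv, ← integral_const_mul]
      exact norm_integral_le_of_norm_le hbi (Eventually.of_forall fun z' => hFb z z')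
  · have : meanField K g = fun _ => 0 := by
      funext z
      exact integral_undef fun h => hi ((hK.integrable_smul_iff hg 0 z).2 h)
    rw [this]
    refine ⟨contDiff_const, fun z => ?_⟩
    simp only [fderiv_fun_const, Pi.zero_apply, norm_zero]
    exact mul_nonneg hK.nonneg (integral_nonneg fun _ => abs_nonneg _)

end IsInteractionKernel

namespace IsMeanFieldSolution

variable {L : ℝ} {K : E × E → E} {f : ℝ → E → ℝ} (hf : IsMeanFieldSolution K f)
include hf

lemma continuous_integral {φ : E → ℝ} (hφ : IsTestFunction φ) :
    Continuous fun t => ∫ z, φ z * f t z :=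
  continuous_iff_continuousAt.2 fun t => (hf.hasDerivAt φ hφ t).continuousAt

lemma isClosed_integral_abs_le (c : ℝ) : IsClosed {t | ∫ z, |f t z| ≤ c} := by
  have : {t | ∫ z, |f t z| ≤ c} =
      ⋂ (n : ℕ) (r : ℝ), {t | ∫ z, signTest n (f r) z * f t z ≤ c} := by
    ext t
    simp only [Set.mem_ofPred_eq, Set.mem_iInter]
    refine ⟨fun h n r => ((integral_signTest_mul_le n (hf.integrable r) (hf.integrable t)).trans
      (integral_abs_mollify_le n (hf.integrable t))).trans h, fun h => ?_⟩
    refine le_of_tendsto' (tendsto_integral_abs_mollify_self (hf.integrable t)) fun n => ?_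
    rw [← integral_signTest_mul n (hf.integrable t)]
    exact h n t
  rw [this]
  exact isClosed_iInter fun n => isClosed_iInter fun r =>
    isClosed_le (hf.continuous_integral (isTestFunction_signTest n (hf.integrable r)))
      continuous_const

lemma integral_abs_eq (hK : IsInteractionKernel L K) (s t : ℝ) :
    ∫ z, |f s z| = ∫ z, |f t z| := by
  refine eq_of_const_of_bounded (T := fun t => ∫ z, |f t z|) hf.isClosed_integral_abs_le
    (fun p q c hpq h => ?_) s t
  exact integral_abs_eq_of_transport (V := fun t => meanField K (f t)) (c := c) (Λ := L * c) hpq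
    (fun t _ => hf.integrable t) h (fun t _ => (hK.contDiff_meanField (hf.integrable t)).1)
    (fun t ht z => ((hK.contDiff_meanField (hf.integrable t)).2 z).trans
      (mul_le_mul_of_nonneg_left (h t (Set.Ioo_subset_Icc_self ht)) hK.nonneg))
    (fun φ hφ => (hf.continuous_integral hφ).continuousOn)
    (fun φ hφ t _ => hf.hasDerivAt φ hφ t)

lemma integral_eq (s t : ℝ) : ∫ z, f s z = ∫ z, f t z := by
  have h := hf.hasDerivAt (fun _ => 1) (IsTestFunction.const 1)
  simp only [one_mul, fderiv_fun_const, Pi.zero_apply, zero_apply, zero_mul,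
    integral_zero] at h
  exact is_const_of_deriv_eq_zero (fun t => (h t).differentiableAt) (fun t => (h t).deriv) s t

lemma ae_nonneg (hK : IsInteractionKernel L K) (h0 : 0 ≤ᵐ[volume] f 0) (t : ℝ) :
    0 ≤ᵐ[volume] f t := by
  have h1 : ∫ z, (|f t z| - f t z) = 0 := by
    rw [integral_sub (hf.integrable t).abs (hf.integrable t), hf.integral_abs_eq hK t 0,
      hf.integral_eq t 0, sub_eq_zero]
    refine integral_congr_ae ?_
    filter_upwards [h0] with z hz using abs_of_nonneg hz
  rw [integral_eq_zero_iff_of_nonneg (fun z => sub_nonneg.2 (le_abs_self _))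
    ((hf.integrable t).abs.sub (hf.integrable t))] at h1
  filter_upwards [h1] with z hz
  have : |f t z| - f t z = 0 := hz
  rw [sub_eq_zero] at this
  exact abs_eq_self.1 this

end IsMeanFieldSolution

end MeanField

section TruncatedMoment

variable {E : Type*} [NormedAddCommGroup E] [InnerProductSpace ℝ E] [FiniteDimensional ℝ E]
  [MeasurableSpace E] [BorelSpace E]

/-- A bounded truncation of `‖w‖ ^ 2` at scale `R`. -/
def quadTrunc (R : ℝ) (w : E) : ℝ := R ^ 2 * ‖w‖ ^ 2 / (R ^ 2 + ‖w‖ ^ 2)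

lemma quadTrunc_nonneg (R : ℝ) (w : E) : 0 ≤ quadTrunc R w := by
  unfold quadTrunc; positivity

lemma quadTrunc_eq_sub {R : ℝ} (hR : 0 < R) (w : E) :
    quadTrunc R w = R ^ 2 - R ^ 4 / (R ^ 2 + ‖w‖ ^ 2) := by
  have : R ^ 2 + ‖w‖ ^ 2 ≠ 0 := by positivity
  unfold quadTrunc
  field_simp
  ring

lemma quadTrunc_le {R : ℝ} (hR : 0 < R) (w : E) : quadTrunc R w ≤ R ^ 2 := by
  rw [quadTrunc_eq_sub hR]
  have : 0 ≤ R ^ 4 / (R ^ 2 + ‖w‖ ^ 2) := by positivity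
  linarith

lemma quadTrunc_le_sq {R : ℝ} (hR : 0 < R) (w : E) : quadTrunc R w ≤ ‖w‖ ^ 2 := by
  unfold quadTrunc
  rw [div_le_iff₀ (by positivity)]
  nlinarith [sq_nonneg (‖w‖ ^ 2)]

lemma hasFDerivAt_quadTrunc {R : ℝ} (hR : 0 < R) (w : E) :
    HasFDerivAt (quadTrunc R) ((2 * R ^ 4 / (R ^ 2 + ‖w‖ ^ 2) ^ 2) • innerSL ℝ w) w := by
  have hne : R ^ 2 + ‖w‖ ^ 2 ≠ 0 := by positivity
  have h1 : HasFDerivAt (fun w : E => R ^ 2 + ‖w‖ ^ 2) ((2 : ℝ) • innerSL ℝ w) w := by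
    refine (((hasStrictFDerivAt_norm_sq w).hasFDerivAt).const_add (R ^ 2)).congr_fderiv ?_
    ext v
    simp
  have h2 : HasDerivAt (fun s : ℝ => R ^ 2 - R ^ 4 / s) (R ^ 4 / (R ^ 2 + ‖w‖ ^ 2) ^ 2)
      (R ^ 2 + ‖w‖ ^ 2) := by
    have := ((hasDerivAt_inv hne).const_mul (R ^ 4)).const_sub (R ^ 2)
    simpa [div_eq_mul_inv] using this
  have h3 := h2.comp_hasFDerivAt w h1
  rw [funext fun w : E => quadTrunc_eq_sub hR w]
  refine h3.congr_fderiv ?_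
  rw [smul_smul]
  congr 1
  ring

lemma contDiff_quadTrunc {R : ℝ} (hR : 0 < R) : ContDiff ℝ 1 (quadTrunc R : E → ℝ) := by
  unfold quadTrunc
  exact ((contDiff_const.mul (contDiff_norm_sq ℝ)).div
    (contDiff_const.add (contDiff_norm_sq ℝ)) fun w => by positivity)

lemma fderiv_quadTrunc_apply {R : ℝ} (hR : 0 < R) (w v : E) :
    fderiv ℝ (quadTrunc R) w v = 2 * R ^ 4 / (R ^ 2 + ‖w‖ ^ 2) ^ 2 * inner ℝ w v := by
  rw [(hasFDerivAt_quadTrunc hR w).fderiv]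
  simp

lemma abs_fderiv_quadTrunc_le {R L : ℝ} (hR : 0 < R) (hL : 0 ≤ L) {w v : E}
    (h : ‖v‖ ≤ L * ‖w‖) : |fderiv ℝ (quadTrunc R) w v| ≤ 2 * L * quadTrunc R w := by
  rw [fderiv_quadTrunc_apply hR, abs_mul, abs_of_nonneg (by positivity)]
  have h1 : |inner ℝ w v| ≤ L * ‖w‖ ^ 2 := by
    refine (abs_real_inner_le_norm w v).trans ?_
    nlinarith [norm_nonneg w]
  calc 2 * R ^ 4 / (R ^ 2 + ‖w‖ ^ 2) ^ 2 * |inner ℝ w v|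
      ≤ 2 * R ^ 4 / (R ^ 2 + ‖w‖ ^ 2) ^ 2 * (L * ‖w‖ ^ 2) := by gcongr
    _ = (R ^ 2 / (R ^ 2 + ‖w‖ ^ 2)) * (2 * L * quadTrunc R w) := by
        unfold quadTrunc
        have : R ^ 2 + ‖w‖ ^ 2 ≠ 0 := by positivity
        field_simp
    _ ≤ 1 * (2 * L * quadTrunc R w) := by
        refine mul_le_mul_of_nonneg_right ?_ (mul_nonneg (by positivity) (quadTrunc_nonneg R w))
        rw [div_le_one (by positivity)]
        nlinarith [sq_nonneg ‖w‖]
    _ = _ := one_mul _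

lemma norm_fderiv_quadTrunc_le {R : ℝ} (hR : 0 < R) (w : E) :
    ‖fderiv ℝ (quadTrunc R) w‖ ≤ 2 * R := by
  refine ContinuousLinearMap.opNorm_le_bound _ (by positivity) fun v => ?_
  rw [fderiv_quadTrunc_apply hR, Real.norm_eq_abs, abs_mul, abs_of_nonneg (by positivity)]
  have h1 := abs_real_inner_le_norm w v
  have h2 : R * ‖w‖ ≤ R ^ 2 + ‖w‖ ^ 2 := by nlinarith [sq_nonneg (R - ‖w‖), norm_nonneg w]
  have h3 : R ^ 2 ≤ R ^ 2 + ‖w‖ ^ 2 := by nlinarith [sq_nonneg ‖w‖]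
  calc 2 * R ^ 4 / (R ^ 2 + ‖w‖ ^ 2) ^ 2 * |inner ℝ w v|
      ≤ 2 * R ^ 4 / (R ^ 2 + ‖w‖ ^ 2) ^ 2 * (‖w‖ * ‖v‖) := by gcongr
    _ = 2 * R * ((R ^ 2 * (R * ‖w‖)) / (R ^ 2 + ‖w‖ ^ 2) ^ 2) * ‖v‖ := by ring
    _ ≤ 2 * R * 1 * ‖v‖ := by
        gcongr
        rw [div_le_one (by positivity), sq (R ^ 2 + ‖w‖ ^ 2)]
        gcongr
    _ = _ := by ring

lemma isTestFunction_quadTrunc_sub {R : ℝ} (hR : 0 < R) (α : E) :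
    IsTestFunction fun z : E => quadTrunc R (z - α) := by
  refine ⟨(contDiff_quadTrunc hR).comp (contDiff_id.sub contDiff_const), ⟨R ^ 2, fun z => ?_⟩,
    ⟨2 * R, fun z => ?_⟩⟩
  · rw [abs_of_nonneg (quadTrunc_nonneg _ _)]
    exact quadTrunc_le hR _
  · rw [fderiv_comp_sub (f := (quadTrunc R : E → ℝ)) α]
    exact norm_fderiv_quadTrunc_le hR _

/-- The truncated second moment of the density `g` around `α`. -/
def truncMoment (R : ℝ) (g : E → ℝ) (α : E) : ℝ := ∫ z, quadTrunc R (z - α) * g z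

lemma isTestFunction_cutoff {R : ℝ} (hR : 0 < R) : IsTestFunction (cutoff R : E → ℝ) := by
  obtain ⟨C, -, hC⟩ := exists_cutoff_bound E
  exact ⟨contDiff_cutoff R, ⟨1, abs_cutoff_le_one R⟩, ⟨C / R, hC R hR⟩⟩

lemma tendsto_integral_cutoff_mul {f : E → ℝ} (hf : Integrable f) :
    Tendsto (fun n : ℕ => ∫ z, cutoff ((n : ℝ) + 1) z * f z) atTop (𝓝 (∫ z, f z)) := by
  refine tendsto_integral_of_dominated_convergence (fun z => |f z|)
    (fun n => ((isTestFunction_cutoff (by positivity)).integrable_mul hf).aestronglyMeasurable)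
    hf.abs (fun n => Eventually.of_forall fun z => ?_) (Eventually.of_forall fun z => ?_)
  · rw [norm_mul, Real.norm_eq_abs, Real.norm_eq_abs]
    exact mul_le_of_le_one_left (abs_nonneg _) (abs_cutoff_le_one _ z)
  · refine tendsto_const_nhds.congr' ?_
    filter_upwards [eventually_ge_atTop ⌈‖z‖⌉₊] with n hn
    have := Nat.ceil_le.1 hn
    rw [cutoff_eq_one (by positivity) (by linarith), one_mul]

/-- Weak solutions of the mean field equation with values in probability densities. -/
structure IsProbabilitySolution (L : ℝ) (K : E × E → E) (f : ℝ → E → ℝ) : Prop where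
  kernel : IsInteractionKernel L K
  solution : IsMeanFieldSolution K f
  ae_nonneg : ∀ t, 0 ≤ᵐ[volume] f t
  integral_eq_one : ∀ t, ∫ z, f t z = 1

namespace IsProbabilitySolution

variable {L : ℝ} {K : E × E → E} {f : ℝ → E → ℝ} (h : IsProbabilitySolution L K f)
include h

lemma integrable (t : ℝ) : Integrable (f t) := h.solution.integrable t

lemma integral_abs_eq_one (t : ℝ) : ∫ z, |f t z| = 1 := by
  rw [← h.integral_eq_one t]
  refine integral_congr_ae ?_
  filter_upwards [h.ae_nonneg t] with z hz using abs_of_nonneg hz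

lemma exists_tight (a b : ℝ) {ε : ℝ} (hε : 0 < ε) : ∃ ρ : ℝ, 0 < ρ ∧ ∀ t ∈ Set.Icc a b,
    1 - ε ≤ ∫ z in Metric.closedBall 0 ρ, f t z := by
  have hmono : ∀ t {ρ ρ' : ℝ}, ρ ≤ ρ' → ∫ z in Metric.closedBall 0 ρ, f t z ≤
      ∫ z in Metric.closedBall 0 ρ', f t z := fun t ρ ρ' hρ =>
    setIntegral_mono_set (h.integrable t).integrableOn (ae_restrict_of_ae (h.ae_nonneg t))
      (Metric.closedBall_subset_closedBall hρ).eventuallyLE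
  refine isCompact_Icc.induction_on (p := fun A => ∃ ρ : ℝ, 0 < ρ ∧ ∀ t ∈ A,
    1 - ε ≤ ∫ z in Metric.closedBall 0 ρ, f t z) ⟨1, by simp⟩
    (fun A B hAB ⟨ρ, h0, hρ⟩ => ⟨ρ, h0, fun t ht => hρ t (hAB ht)⟩)
    (fun A B ⟨ρ, h0, hρ⟩ ⟨ρ', h0', hρ'⟩ => ⟨max ρ ρ', lt_max_of_lt_left h0, fun t ht => ht.elim
      (fun hA => (hρ t hA).trans (hmono t (le_max_left _ _)))
      fun hB => (hρ' t hB).trans (hmono t (le_max_right _ _))⟩) fun t _ => ?_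
  have h1 := tendsto_integral_cutoff_mul (h.integrable t)
  rw [h.integral_eq_one t] at h1
  obtain ⟨n, hn⟩ := (h1.eventually_const_lt (show 1 - ε < 1 by linarith)).exists
  have hn0 : (0 : ℝ) < n + 1 := by positivity
  have h2 := (h.solution.continuous_integral (isTestFunction_cutoff hn0)).continuousAt.eventually
    (lt_mem_nhds hn)
  refine ⟨_, mem_nhdsWithin_of_mem_nhds h2, 2 * (n + 1), by positivity, fun s hs => hs.le.trans ?_⟩
  rw [← integral_indicator measurableSet_closedBall]
  refine integral_mono_ae ((isTestFunction_cutoff hn0).integrable_mul (h.integrable s))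
    ((h.integrable s).indicator measurableSet_closedBall) ?_
  filter_upwards [h.ae_nonneg s] with z hz
  by_cases hz' : z ∈ Metric.closedBall (0 : E) (2 * (n + 1))
  · rw [Set.indicator_of_mem hz']
    exact mul_le_of_le_one_left hz (cutoff_le_one _ _)
  · rw [Set.indicator_of_notMem hz', cutoff_eq_zero hn0, zero_mul]
    rw [mem_closedBall_zero_iff, not_le] at hz'
    exact hz'.le

lemma const_mul_mass_le {t R ρ c : ℝ} {α : E} (hR : 0 < R)
    (hc : ∀ z ∈ Metric.closedBall (0 : E) ρ, c ≤ quadTrunc R (z - α)) :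
    c * ∫ z in Metric.closedBall 0 ρ, f t z ≤ truncMoment R (f t) α := by
  rw [← integral_const_mul, ← integral_indicator measurableSet_closedBall]
  refine integral_mono_ae (((h.integrable t).const_mul c).indicator measurableSet_closedBall)
    ((isTestFunction_quadTrunc_sub hR α).integrable_mul (h.integrable t)) ?_
  filter_upwards [h.ae_nonneg t] with z hz
  by_cases hz' : z ∈ Metric.closedBall (0 : E) ρ
  · rw [Set.indicator_of_mem hz']
    exact mul_le_mul_of_nonneg_right (hc z hz') hz
  · rw [Set.indicator_of_notMem hz']
    exact mul_nonneg (quadTrunc_nonneg _ _) hz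

lemma truncMoment_zero_le {t R ρ : ℝ} (hR : 0 < R) :
    truncMoment R (f t) 0 ≤
      R ^ 2 - R ^ 4 / (R ^ 2 + ρ ^ 2) * ∫ z in Metric.closedBall 0 ρ, f t z := by
  have h1 : R ^ 2 = ∫ z, R ^ 2 * f t z := by rw [integral_const_mul, h.integral_eq_one, mul_one]
  have i1 := (h.integrable t).const_mul (R ^ 2)
  have i2 : Integrable ((Metric.closedBall (0 : E) ρ).indicator
      fun z => R ^ 4 / (R ^ 2 + ρ ^ 2) * f t z) :=
    ((h.integrable t).const_mul _).indicator measurableSet_closedBall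
  suffices hs : truncMoment R (f t) 0 ≤ (∫ z, R ^ 2 * f t z) -
      R ^ 4 / (R ^ 2 + ρ ^ 2) * ∫ z in Metric.closedBall 0 ρ, f t z by rwa [← h1] at hs
  rw [← integral_const_mul (R ^ 4 / (R ^ 2 + ρ ^ 2)),
    ← integral_indicator measurableSet_closedBall, ← integral_sub i1 i2]
  refine integral_mono_ae ((isTestFunction_quadTrunc_sub hR 0).integrable_mul (h.integrable t))
    (i1.sub i2) ?_
  filter_upwards [h.ae_nonneg t] with z hz
  rw [sub_zero]
  by_cases hz' : z ∈ Metric.closedBall (0 : E) ρ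
  · simp only [Set.indicator_of_mem hz', ← sub_mul]
    refine mul_le_mul_of_nonneg_right ?_ hz
    rw [mem_closedBall_zero_iff] at hz'
    rw [quadTrunc_eq_sub hR]
    gcongr
  · simp only [Set.indicator_of_notMem hz', sub_zero]
    exact mul_le_mul_of_nonneg_right (quadTrunc_le hR _) hz

lemma exists_center_radius (a b : ℝ) {R : ℝ} (hR : 0 < R) : ∃ A : ℝ, 0 < A ∧
    ∀ t ∈ Set.Icc a b, ∀ α : E, A ≤ ‖α‖ → truncMoment R (f t) 0 < truncMoment R (f t) α := by
  obtain ⟨ρ₁, hρ₁, hm₁⟩ := h.exists_tight a b (show (0 : ℝ) < 1 / 2 by norm_num)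
  set c : ℝ := R ^ 4 / (R ^ 2 + ρ₁ ^ 2) / 2 with hc
  have hc0 : 0 < c := by positivity
  obtain ⟨ρ₂, hρ₂, hm₂⟩ := h.exists_tight a b (show 0 < c / (4 * R ^ 2) by positivity)
  refine ⟨ρ₂ + (4 * R ^ 4 / c + 1), by positivity, fun t ht α hα => ?_⟩
  have h1 : truncMoment R (f t) 0 ≤ R ^ 2 - c := by
    refine (h.truncMoment_zero_le (ρ := ρ₁) hR).trans ?_
    have := mul_le_mul_of_nonneg_left (hm₁ t ht) (show 0 ≤ R ^ 4 / (R ^ 2 + ρ₁ ^ 2) by positivity)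
    rw [hc]
    linarith
  have h2 : ∀ z ∈ Metric.closedBall (0 : E) ρ₂, R ^ 2 - c / 4 ≤ quadTrunc R (z - α) := by
    intro z hz
    rw [mem_closedBall_zero_iff] at hz
    have h3 : 4 * R ^ 4 / c + 1 ≤ ‖z - α‖ := by
      have := norm_sub_norm_le α z
      rw [norm_sub_rev]
      linarith
    have h4 : 0 ≤ 4 * R ^ 4 / c := by positivity
    have h5 : 4 * R ^ 4 / c ≤ R ^ 2 + ‖z - α‖ ^ 2 := by nlinarith [sq_nonneg R]
    rw [quadTrunc_eq_sub hR]
    have h6 : R ^ 4 / (R ^ 2 + ‖z - α‖ ^ 2) ≤ c / 4 := by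
      rw [div_le_iff₀ hc0] at h5
      rw [div_le_iff₀ (by positivity)]
      linarith
    linarith
  have hcR : c ≤ R ^ 2 := by
    have : R ^ 4 / (R ^ 2 + ρ₁ ^ 2) ≤ R ^ 2 := by
      rw [div_le_iff₀ (by positivity)]
      nlinarith [sq_nonneg (R * ρ₁)]
    rw [hc]
    nlinarith [sq_nonneg R]
  have h7 := h.const_mul_mass_le (t := t) hR h2
  have h8 := mul_le_mul_of_nonneg_left (hm₂ t ht) (show 0 ≤ R ^ 2 - c / 4 by linarith)
  have h9 : (R ^ 2 - c / 4) * (1 - c / (4 * R ^ 2)) = R ^ 2 - c / 2 + c ^ 2 / (16 * R ^ 2) := by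
    field_simp
    ring
  have h10 : 0 ≤ c ^ 2 / (16 * R ^ 2) := by positivity
  linarith

lemma abs_truncMoment_sub_le {R : ℝ} (hR : 0 < R) (t : ℝ) (α β : E) :
    |truncMoment R (f t) α - truncMoment R (f t) β| ≤ 2 * R * ‖α - β‖ := by
  have i1 := (isTestFunction_quadTrunc_sub hR α).integrable_mul (h.integrable t)
  have i2 := (isTestFunction_quadTrunc_sub hR β).integrable_mul (h.integrable t)
  rw [truncMoment, truncMoment, ← integral_sub i1 i2, ← Real.norm_eq_abs]
  calc _ ≤ ∫ z, 2 * R * ‖α - β‖ * |f t z| := by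
        refine norm_integral_le_of_norm_le ((h.integrable t).abs.const_mul _)
          (Eventually.of_forall fun z => ?_)
        rw [← sub_mul, norm_mul, Real.norm_eq_abs (f t z)]
        refine mul_le_mul_of_nonneg_right ?_ (abs_nonneg _)
        have := Convex.norm_image_sub_le_of_norm_fderiv_le (𝕜 := ℝ) (s := Set.univ)
          (f := (quadTrunc R : E → ℝ)) (C := 2 * R) (x := z - β) (y := z - α)
          (fun x _ => (contDiff_quadTrunc hR).differentiable one_ne_zero x)
          (fun x _ => norm_fderiv_quadTrunc_le hR x) convex_univ trivial trivial
        rwa [sub_sub_sub_cancel_left, norm_sub_rev β α] at this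
    _ = _ := by rw [integral_const_mul, h.integral_abs_eq_one, mul_one]

lemma continuous_truncMoment {R : ℝ} (hR : 0 < R) :
    Continuous fun p : ℝ × E => truncMoment R (f p.1) p.2 := by
  refine continuous_prod_of_continuous_lipschitzWith' _ (Real.toNNReal (2 * R)) (fun t => ?_)
    fun α => h.solution.continuous_integral (isTestFunction_quadTrunc_sub hR α)
  refine LipschitzWith.of_dist_le_mul fun α β => ?_
  rw [Real.dist_eq, dist_eq_norm, Real.coe_toNNReal _ (by positivity)]
  exact h.abs_truncMoment_sub_le hR t α β

lemma integral_fderiv_quadTrunc_eq_zero {R t : ℝ} (hR : 0 < R) {α : E}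
    (hα : IsLocalMin (truncMoment R (f t)) α) (v : E) :
    ∫ z, fderiv ℝ (quadTrunc R) (z - α) v * f t z = 0 := by
  have hd : HasDerivAt (fun s : ℝ => truncMoment R (f t) (α + s • v))
      (∫ z, -fderiv ℝ (quadTrunc R) (z - α) v * f t z) 0 := by
    have := (hasDerivAt_integral_of_dominated_loc_of_deriv_le (μ := volume) (x₀ := (0 : ℝ))
      (F := fun s z => quadTrunc R (z - (α + s • v)) * f t z)
      (F' := fun s z => -fderiv ℝ (quadTrunc R) (z - (α + s • v)) v * f t z)
      (bound := fun z => 2 * R * ‖v‖ * |f t z|) (s := Set.univ) univ_mem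
      (Eventually.of_forall fun s =>
        ((isTestFunction_quadTrunc_sub hR _).integrable_mul (h.integrable t)).aestronglyMeasurable)
      ((isTestFunction_quadTrunc_sub hR _).integrable_mul (h.integrable t)) ?_
      (Eventually.of_forall fun z s _ => ?_) ((h.integrable t).abs.const_mul _)
      (Eventually.of_forall fun z s _ => ?_)).2
    · simp only [zero_smul, add_zero] at this
      exact this
    · refine (Continuous.aestronglyMeasurable ?_).mul (h.integrable t).aestronglyMeasurable
      exact ((((contDiff_quadTrunc hR).continuous_fderiv one_ne_zero).comp
        (continuous_id.sub continuous_const)).clm_apply continuous_const).neg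
    · rw [norm_mul, Real.norm_eq_abs (f t z), norm_neg]
      refine mul_le_mul_of_nonneg_right ?_ (abs_nonneg _)
      exact (ContinuousLinearMap.le_opNorm _ _).trans
        (mul_le_mul_of_nonneg_right (norm_fderiv_quadTrunc_le hR _) (norm_nonneg _))
    · refine HasDerivAt.mul_const ?_ _
      have h1 : HasDerivAt (fun s : ℝ => z - (α + s • v)) (-v) s := by
        simpa using (((hasDerivAt_id s).smul_const v).const_add α).const_sub z
      have h2 := (((contDiff_quadTrunc hR).differentiable one_ne_zero
        (z - (α + s • v))).hasFDerivAt).comp_hasDerivAt s h1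
      rw [map_neg] at h2
      exact h2
  have hmin : IsLocalMin (fun s : ℝ => truncMoment R (f t) (α + s • v)) 0 := by
    have hc : ContinuousAt (fun s : ℝ => α + s • v) 0 := by fun_prop
    have h0 : α + (0 : ℝ) • v = α := by simp
    have hα' : IsLocalMin (truncMoment R (f t)) ((fun s : ℝ => α + s • v) 0) := by
      simpa only [h0] using hα
    exact IsLocalMin.comp_continuous (g := fun s : ℝ => α + s • v) hα' hc
  have := hmin.hasDerivAt_eq_zero hd
  simp only [neg_mul, integral_neg] at this
  linarith

lemma norm_meanField_sub_le (t : ℝ) (z w : E) :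
    ‖meanField K (f t) z - meanField K (f t) w‖ ≤ L * ‖z - w‖ := by
  obtain ⟨h1, h2⟩ := h.kernel.contDiff_meanField (h.integrable t)
  simp_rw [h.integral_abs_eq_one, mul_one] at h2
  exact norm_sub_le_of_fderiv_le h1 h2 z w

lemma continuous_meanField (t : ℝ) : Continuous (meanField K (f t)) :=
  (h.kernel.contDiff_meanField (h.integrable t)).1.continuous

lemma integral_fderiv_quadTrunc_meanField_le {R t : ℝ} (hR : 0 < R) {α : E}
    (hα : IsLocalMin (truncMoment R (f t)) α) :
    ∫ z, fderiv ℝ (fun z => quadTrunc R (z - α)) z (meanField K (f t) z) * f t z ≤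
      2 * L * truncMoment R (f t) α := by
  simp_rw [fderiv_comp_sub (f := (quadTrunc R : E → ℝ)) α]
  set V := meanField K (f t) with hV
  have hcd : Continuous fun z : E => fderiv ℝ (quadTrunc R) (z - α) :=
    ((contDiff_quadTrunc hR).continuous_fderiv one_ne_zero).comp
      (continuous_id.sub continuous_const)
  have hle : ∀ z, |fderiv ℝ (quadTrunc R) (z - α) (V z - V α)| ≤
      2 * L * quadTrunc R (z - α) := fun z =>
    abs_fderiv_quadTrunc_le hR h.kernel.nonneg (h.norm_meanField_sub_le t z α)
  have i0 := ((isTestFunction_quadTrunc_sub hR α).integrable_mul (h.integrable t)).const_mul (2 * L)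
  have i1 : Integrable fun z => fderiv ℝ (quadTrunc R) (z - α) (V z - V α) * f t z := by
    refine i0.mono' (((hcd.clm_apply ((h.continuous_meanField t).sub
      continuous_const)).aestronglyMeasurable).mul (h.integrable t).aestronglyMeasurable) ?_
    filter_upwards [h.ae_nonneg t] with z hz
    rw [norm_mul, Real.norm_eq_abs, Real.norm_eq_abs, abs_of_nonneg hz, ← mul_assoc]
    exact mul_le_mul_of_nonneg_right (hle z) hz
  have i2 : Integrable fun z => fderiv ℝ (quadTrunc R) (z - α) (V α) * f t z := by
    refine (h.integrable t).bdd_mul (c := 2 * R * ‖V α‖)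
      (hcd.clm_apply continuous_const).aestronglyMeasurable (Eventually.of_forall fun z => ?_)
    exact (ContinuousLinearMap.le_opNorm _ _).trans
      (mul_le_mul_of_nonneg_right (norm_fderiv_quadTrunc_le hR _) (norm_nonneg _))
  calc ∫ z, fderiv ℝ (quadTrunc R) (z - α) (V z) * f t z
      = (∫ z, fderiv ℝ (quadTrunc R) (z - α) (V z - V α) * f t z) +
          ∫ z, fderiv ℝ (quadTrunc R) (z - α) (V α) * f t z := by
        rw [← integral_add i1 i2]
        refine integral_congr_ae (Eventually.of_forall fun z => ?_)
        simp only [map_sub]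
        ring
    _ = ∫ z, fderiv ℝ (quadTrunc R) (z - α) (V z - V α) * f t z := by
        rw [h.integral_fderiv_quadTrunc_eq_zero hR hα, add_zero]
    _ ≤ ∫ z, 2 * L * (quadTrunc R (z - α) * f t z) := by
        refine integral_mono_ae i1 i0 ?_
        filter_upwards [h.ae_nonneg t] with z hz
        rw [← mul_assoc]
        exact mul_le_mul_of_nonneg_right ((le_abs_self _).trans (hle z)) hz
    _ = _ := integral_const_mul _ _

lemma exists_truncMoment_le {R b : ℝ} (hR : 0 < R) (hb : 0 ≤ b) :
    ∃ α : E, truncMoment R (f b) α ≤ truncMoment R (f 0) 0 * exp (2 * L * b) := by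
  obtain ⟨A, hA, hAm⟩ := h.exists_center_radius 0 b hR
  set B := Metric.closedBall (0 : E) A with hB
  have hBc : IsCompact B := isCompact_closedBall 0 A
  have h0B : (0 : E) ∈ B := Metric.mem_closedBall_self hA.le
  set P : ℝ → ℝ := fun t => sInf (truncMoment R (f t) '' B) with hP
  have hPc : Continuous P := hBc.continuous_sInf (h.continuous_truncMoment hR)
  have hpc : ∀ t, Continuous (truncMoment R (f t)) := fun t =>
    (h.continuous_truncMoment hR).comp (by fun_prop : Continuous fun α : E => (t, α))
  have hPle : ∀ t, ∀ α ∈ B, P t ≤ truncMoment R (f t) α := fun t α hα =>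
    csInf_le (hBc.image (hpc t)).bddBelow (Set.mem_image_of_mem _ hα)
  have hmin : ∀ t, ∃ α ∈ B, P t = truncMoment R (f t) α ∧ IsMinOn (truncMoment R (f t)) B α := by
    intro t
    obtain ⟨α, hα, hαm⟩ := hBc.exists_isMinOn ⟨0, h0B⟩ (hpc t).continuousOn
    refine ⟨α, hα, ?_, hαm⟩
    refine IsLeast.csInf_eq ⟨Set.mem_image_of_mem _ hα, ?_⟩
    rintro _ ⟨β, hβ, rfl⟩
    exact hαm hβ
  have hgr := le_gronwallBound_of_liminf_deriv_right_le (f := P) (f' := fun t => 2 * L * P t)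
    (δ := truncMoment R (f 0) 0) (K := 2 * L) (ε := 0) (a := 0) (b := b) hPc.continuousOn
    (fun t ht r hr => ?_) (hPle 0 0 h0B) (fun t _ => by simp) b ⟨hb, le_rfl⟩
  · obtain ⟨α, -, hα, -⟩ := hmin b
    refine ⟨α, ?_⟩
    rwa [gronwallBound_ε0, sub_zero, hα] at hgr
  · obtain ⟨α, hαB, hα, hαm⟩ := hmin t
    have hαlt : ‖α‖ < A := by
      by_contra hcon
      exact absurd (hAm t (Set.Ico_subset_Icc_self ht) α (not_lt.1 hcon)) (not_lt.2 (hαm h0B))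
    have hloc : IsLocalMin (truncMoment R (f t)) α := by
      refine hαm.isLocalMin ?_
      refine mem_of_superset (Metric.isOpen_ball.mem_nhds (mem_ball_zero_iff.2 hαlt))
        Metric.ball_subset_closedBall
    have hder := h.solution.hasDerivAt _ (isTestFunction_quadTrunc_sub hR α) t
    have hD := h.integral_fderiv_quadTrunc_meanField_le hR hloc
    rw [← hα] at hD
    have h1 := (hasDerivAt_iff_tendsto_slope.1 hder).mono_left
      (nhdsWithin_mono t (fun y (hy : t < y) => hy.ne'))
    refine Eventually.frequently ?_
    filter_upwards [h1.eventually_lt_const (hD.trans_lt hr), self_mem_nhdsWithin] with z hz hz1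
    refine lt_of_le_of_lt ?_ hz
    rw [slope_def_field, hα, ← div_eq_inv_mul]
    have h2 : 0 < z - t := sub_pos.2 hz1
    have h3 := hPle z α hαB
    unfold truncMoment at h3 ⊢
    gcongr

lemma exists_second_moment_bound {b : ℝ}
    (h2 : Integrable fun z => ‖z‖ ^ 2 * f 0 z) : ∃ C : ℝ, ∀ t ∈ Set.Icc 0 b,
      Integrable (fun z => ‖z‖ ^ 2 * f t z) ∧ ∫ z, ‖z‖ ^ 2 * f t z ≤ C := by
  obtain ⟨ρ, hρ, hm⟩ := h.exists_tight 0 b (show (0 : ℝ) < 1 / 2 by norm_num)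
  set M : ℝ := (∫ z, ‖z‖ ^ 2 * f 0 z) * exp (2 * L * b) with hM
  have hL := h.kernel.nonneg
  have hM0 : 0 ≤ M := by
    refine mul_nonneg (integral_nonneg_of_ae ?_) (exp_pos _).le
    filter_upwards [h.ae_nonneg 0] with z hz using mul_nonneg (sq_nonneg _) hz
  set A : ℝ := ρ + 2 * √M with hA
  set C : ℝ := 2 * M + 2 * A ^ 2 with hC
  have key : ∀ t ∈ Set.Icc 0 b, ∀ R : ℝ, 0 < R → 4 * M ≤ R ^ 2 → truncMoment R (f t) 0 ≤ C := by
    intro t ht R hR hRM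
    obtain ⟨α, hα⟩ := h.exists_truncMoment_le hR ht.1
    have hα' : truncMoment R (f t) α ≤ M := by
      refine hα.trans ?_
      have h3 : truncMoment R (f 0) 0 ≤ ∫ z, ‖z‖ ^ 2 * f 0 z := by
        refine integral_mono_ae
          ((isTestFunction_quadTrunc_sub hR 0).integrable_mul (h.integrable 0)) h2 ?_
        filter_upwards [h.ae_nonneg 0] with z hz
        rw [sub_zero]
        exact mul_le_mul_of_nonneg_right (quadTrunc_le_sq hR z) hz
      have h4 : 0 ≤ ∫ z, ‖z‖ ^ 2 * f 0 z := by
        refine integral_nonneg_of_ae ?_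
        filter_upwards [h.ae_nonneg 0] with z hz using mul_nonneg (sq_nonneg _) hz
      have h5 : t ≤ b := ht.2
      exact mul_le_mul h3 (exp_le_exp.2 (by gcongr)) (exp_pos _).le h4
    have hαA : ‖α‖ ≤ A := by
      by_contra! hcon
      set x : ℝ := ‖α‖ - ρ with hx
      have hsq := Real.sq_sqrt hM0
      have hs0 := Real.sqrt_nonneg M
      have hx2 : 2 * √M < x := by linarith
      have hx4 : 4 * M < x ^ 2 := by nlinarith
      have h6 : ∀ z ∈ Metric.closedBall (0 : E) ρ, R ^ 2 * x ^ 2 / (R ^ 2 + x ^ 2) ≤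
          quadTrunc R (z - α) := by
        intro z hz
        rw [mem_closedBall_zero_iff] at hz
        have h7 : x ≤ ‖z - α‖ := by
          have := norm_sub_norm_le α z
          rw [norm_sub_rev]
          linarith
        rw [quadTrunc, div_le_div_iff₀ (by positivity) (by positivity)]
        have h8 : x ^ 2 ≤ ‖z - α‖ ^ 2 := pow_le_pow_left₀ (by linarith) h7 2
        nlinarith [mul_le_mul_of_nonneg_left h8 (sq_nonneg (R ^ 2))]
      have h9 := (h.const_mul_mass_le (t := t) hR h6).trans hα'
      have h10 := mul_le_mul_of_nonneg_left (hm t ht)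
        (show 0 ≤ R ^ 2 * x ^ 2 / (R ^ 2 + x ^ 2) by positivity)
      have h11 : R ^ 2 * x ^ 2 / (R ^ 2 + x ^ 2) ≤ 2 * M := by linarith
      rw [div_le_iff₀ (by positivity)] at h11
      have h19 := mul_le_mul_of_nonneg_right hRM (sq_nonneg x)
      have h20 := mul_pos (pow_pos hR 2) (sub_pos.2 hx4)
      linarith
    have h12 : ∀ z : E, quadTrunc R z ≤ 2 * quadTrunc R (z - α) + 2 * A ^ 2 := by
      intro z
      have h13 : ‖z‖ ^ 2 ≤ 2 * ‖z - α‖ ^ 2 + 2 * A ^ 2 := by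
        have h14 : ‖z‖ ≤ ‖z - α‖ + A := by
          calc ‖z‖ = ‖(z - α) + α‖ := by rw [sub_add_cancel]
            _ ≤ _ := (norm_add_le _ _).trans (by linarith)
        have := norm_nonneg z
        nlinarith [sq_nonneg (‖z - α‖ - A)]
      have h15 : quadTrunc R z ≤
          R ^ 2 * (2 * ‖z - α‖ ^ 2 + 2 * A ^ 2) / (R ^ 2 + (2 * ‖z - α‖ ^ 2 + 2 * A ^ 2)) := by
        rw [quadTrunc, div_le_div_iff₀ (by positivity) (by positivity)]
        nlinarith [mul_le_mul_of_nonneg_left h13 (sq_nonneg (R ^ 2))]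
      refine h15.trans ?_
      have h16 : R ^ 2 * (2 * ‖z - α‖ ^ 2 + 2 * A ^ 2) / (R ^ 2 + (2 * ‖z - α‖ ^ 2 + 2 * A ^ 2)) =
          2 * (R ^ 2 * ‖z - α‖ ^ 2 / (R ^ 2 + (2 * ‖z - α‖ ^ 2 + 2 * A ^ 2))) +
          2 * A ^ 2 * (R ^ 2 / (R ^ 2 + (2 * ‖z - α‖ ^ 2 + 2 * A ^ 2))) := by ring
      rw [h16]
      have h17 : R ^ 2 / (R ^ 2 + (2 * ‖z - α‖ ^ 2 + 2 * A ^ 2)) ≤ 1 := by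
        rw [div_le_one (by positivity)]
        nlinarith [sq_nonneg ‖z - α‖, sq_nonneg A]
      have h18 : R ^ 2 * ‖z - α‖ ^ 2 / (R ^ 2 + (2 * ‖z - α‖ ^ 2 + 2 * A ^ 2)) ≤
          quadTrunc R (z - α) := by
        unfold quadTrunc
        gcongr
        nlinarith [sq_nonneg ‖z - α‖, sq_nonneg A]
      have := mul_le_mul_of_nonneg_left h17 (show 0 ≤ 2 * A ^ 2 by positivity)
      linarith
    have i1 := (isTestFunction_quadTrunc_sub hR α).integrable_mul (h.integrable t)
    calc truncMoment R (f t) 0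
        ≤ ∫ z, (2 * (quadTrunc R (z - α) * f t z) + 2 * A ^ 2 * f t z) := by
          refine integral_mono_ae
            ((isTestFunction_quadTrunc_sub hR 0).integrable_mul (h.integrable t))
            ((i1.const_mul 2).add ((h.integrable t).const_mul _)) ?_
          filter_upwards [h.ae_nonneg t] with z hz
          rw [sub_zero, ← mul_assoc, ← add_mul]
          exact mul_le_mul_of_nonneg_right (h12 z) hz
      _ = 2 * truncMoment R (f t) α + 2 * A ^ 2 := by
          rw [integral_add (i1.const_mul 2) ((h.integrable t).const_mul _), integral_const_mul,
            integral_const_mul, h.integral_eq_one, mul_one, truncMoment]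
      _ ≤ C := by rw [hC]; linarith
  refine ⟨C, fun t ht => ?_⟩
  have hC0 : 0 ≤ C := by positivity
  have hmeas : AEStronglyMeasurable (fun z => ‖z‖ ^ 2 * f t z) volume :=
    (by fun_prop : Continuous fun z : E => ‖z‖ ^ 2).aestronglyMeasurable.mul
      (h.integrable t).aestronglyMeasurable
  have hlim : ∀ z : E, Tendsto (fun n : ℕ => quadTrunc (n : ℝ) z * f t z) atTop
      (𝓝 (‖z‖ ^ 2 * f t z)) := by
    intro z
    refine Tendsto.mul_const _ ?_
    have h1 : Tendsto (fun n : ℕ => ‖z‖ ^ 2 / ((n : ℝ) ^ 2)) atTop (𝓝 0) :=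
      tendsto_const_nhds.div_atTop
        ((tendsto_pow_atTop two_ne_zero).comp tendsto_natCast_atTop_atTop)
    have h3 : Tendsto (fun n : ℕ => ‖z‖ ^ 2 / (1 + ‖z‖ ^ 2 / ((n : ℝ) ^ 2))) atTop
        (𝓝 (‖z‖ ^ 2 / (1 + 0))) :=
      tendsto_const_nhds.div (tendsto_const_nhds.add h1) (by norm_num)
    rw [add_zero, div_one] at h3
    refine h3.congr' ?_
    filter_upwards [eventually_gt_atTop 0] with n hn
    have : (0 : ℝ) < n := by exact_mod_cast hn
    unfold quadTrunc
    field_simp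
  have hen : ∫⁻ z, ‖‖z‖ ^ 2 * f t z‖ₑ ≤ ENNReal.ofReal C := by
    calc ∫⁻ z, ‖‖z‖ ^ 2 * f t z‖ₑ
        = ∫⁻ z, liminf (fun n : ℕ => ‖quadTrunc (n : ℝ) z * f t z‖ₑ) atTop :=
          lintegral_congr fun z => ((hlim z).enorm).liminf_eq.symm
      _ ≤ liminf (fun n : ℕ => ∫⁻ z, ‖quadTrunc (n : ℝ) z * f t z‖ₑ) atTop := by
          refine lintegral_liminf_le' fun n => (AEStronglyMeasurable.enorm ?_)
          refine AEStronglyMeasurable.mul (Measurable.aestronglyMeasurable ?_)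
            (h.integrable t).aestronglyMeasurable
          unfold quadTrunc
          fun_prop
      _ ≤ ENNReal.ofReal C := by
          refine liminf_le_of_le (by isBoundedDefault) fun c hc => ?_
          obtain ⟨n, hn1, hn2, hn3⟩ := (hc.and ((eventually_gt_atTop 0).and
            (eventually_ge_atTop ⌈4 * M⌉₊))).exists
          refine hn1.trans ?_
          have hn : (0 : ℝ) < n := by exact_mod_cast hn2
          have hn1' : (1 : ℝ) ≤ n := by exact_mod_cast hn2
          have i0 := (isTestFunction_quadTrunc_sub hn (0 : E)).integrable_mul (h.integrable t)
          simp only [sub_zero] at i0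
          rw [← ofReal_integral_norm_eq_lintegral_enorm i0]
          refine ENNReal.ofReal_le_ofReal ?_
          refine le_trans (le_of_eq ?_) (key t ht n hn ?_)
          · refine integral_congr_ae ?_
            filter_upwards [h.ae_nonneg t] with z hz
            rw [sub_zero]
            exact Real.norm_of_nonneg (mul_nonneg (quadTrunc_nonneg _ _) hz)
          · have := Nat.ceil_le.1 hn3
            nlinarith
  have hi : Integrable fun z => ‖z‖ ^ 2 * f t z := ⟨hmeas, hen.trans_lt ENNReal.ofReal_lt_top⟩
  refine ⟨hi, ?_⟩
  rw [← ofReal_integral_norm_eq_lintegral_enorm hi, ENNReal.ofReal_le_ofReal_iff hC0] at hen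
  refine le_trans (integral_mono hi hi.norm fun z => Real.le_norm_self _) hen

end IsProbabilitySolution

end TruncatedMoment

section LipschitzFlow

variable {E : Type*} [NormedAddCommGroup E] [InnerProductSpace ℝ E] [FiniteDimensional ℝ E]
  [MeasurableSpace E] [BorelSpace E]

lemma abs_cutoff_sub_le {R C : ℝ} (hC : ∀ x : E, ‖fderiv ℝ (cutoff R) x‖ ≤ C) (x y : E) :
    |cutoff R x - cutoff R y| ≤ C * ‖x - y‖ := by
  have := Convex.norm_image_sub_le_of_norm_fderiv_le (𝕜 := ℝ) (s := Set.univ)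
    (f := (cutoff R : E → ℝ)) (C := C) (x := y) (y := x)
    (fun x _ => (contDiff_cutoff R).differentiable one_ne_zero x)
    (fun x _ => hC x) convex_univ trivial trivial
  exact this

/-- Global solvability, on a compact time interval, of an ordinary differential equation driven
by a globally Lipschitz vector field. -/
lemma exists_integralCurve_of_lipschitz {b L : ℝ} {W : ℝ → E → E} (hb : 0 ≤ b) (hL : 0 ≤ L)
    (hWc : ∀ z, Continuous fun t => W t z) (hW : ∀ t z w, ‖W t z - W t w‖ ≤ L * ‖z - w‖) (z : E) :
    ∃ x : ℝ → E, x 0 = z ∧ ContinuousOn x (Set.Icc 0 b) ∧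
      ∀ s ∈ Set.Ioo 0 b, HasDerivAt x (W s (x s)) s := by
  obtain ⟨M, hM⟩ := isCompact_Icc.exists_bound_of_continuousOn (s := Set.Icc 0 b)
    (hWc 0).continuousOn
  have hM0 : 0 ≤ M := (norm_nonneg _).trans (hM 0 ⟨le_rfl, hb⟩)
  have hlin : ∀ t ∈ Set.Icc 0 b, ∀ x, ‖W t x‖ ≤ L * ‖x‖ + M := by
    intro t ht x
    have h1 := hW t x 0
    rw [sub_zero] at h1
    have h2 := norm_sub_norm_le (W t x) (W t 0)
    have h3 := hM t ht
    linarith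
  set R : ℝ := gronwallBound ‖z‖ L M b + 1 with hR
  have hgb : ∀ s ∈ Set.Icc 0 b, gronwallBound ‖z‖ L M s ≤ gronwallBound ‖z‖ L M b := fun s hs =>
    gronwallBound_mono (norm_nonneg _) hM0 hL hs.2
  have hR1 : 0 < R := by
    have := hgb 0 ⟨le_rfl, hb⟩
    rw [gronwallBound_x0] at this
    have := norm_nonneg z
    linarith
  obtain ⟨C, hC0, hC⟩ := exists_cutoff_bound E
  set v : ℝ → E → E := fun t x => cutoff R x • W t x with hv
  have hvlin : ∀ t ∈ Set.Icc 0 b, ∀ x, ‖v t x‖ ≤ L * ‖x‖ + M := fun t ht x => by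
    rw [hv, norm_smul, Real.norm_eq_abs]
    exact (mul_le_of_le_one_left (norm_nonneg _) (abs_cutoff_le_one R x)).trans (hlin t ht x)
  set B : ℝ := L * (2 * R) + M with hB
  have hB0 : 0 ≤ B := by positivity
  have hvB : ∀ t ∈ Set.Icc 0 b, ∀ x, ‖v t x‖ ≤ B := fun t ht x => by
    by_cases hx : 2 * R ≤ ‖x‖
    · simp only [hv, cutoff_eq_zero hR1 hx, zero_smul, norm_zero]
      exact hB0
    · refine (hvlin t ht x).trans ?_
      have := mul_le_mul_of_nonneg_left (not_le.1 hx).le hL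
      linarith
  have hPL : IsPicardLindelof v (⟨0, le_rfl, hb⟩ : Set.Icc 0 b) z (Real.toNNReal (B * b)) 0
      (Real.toNNReal B) (Real.toNNReal (L + C / R * (L * (‖z‖ + B * b) + M))) := by
    refine ⟨fun t ht => ?_, fun x _ => ?_, fun t ht x _ => ?_, ?_⟩
    · refine LipschitzOnWith.of_dist_le_mul fun x hx y hy => ?_
      rw [Real.coe_toNNReal _ (by positivity), dist_eq_norm, dist_eq_norm]
      have h1 : v t x - v t y = cutoff R x • (W t x - W t y) +
          (cutoff R x - cutoff R y) • W t y := by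
        simp only [hv, smul_sub, sub_smul]
        abel
      have h2 : ‖y‖ ≤ ‖z‖ + B * b := by
        rw [mem_closedBall_iff_norm, Real.coe_toNNReal _ (by positivity)] at hy
        have := norm_le_norm_add_norm_sub' y z
        linarith
      have h3 : ‖W t y‖ ≤ L * (‖z‖ + B * b) + M :=
        (hlin t ht y).trans (by gcongr)
      rw [h1, add_mul]
      refine (norm_add_le _ _).trans (add_le_add ?_ ?_)
      · rw [norm_smul, Real.norm_eq_abs]
        exact (mul_le_of_le_one_left (norm_nonneg _) (abs_cutoff_le_one R x)).trans (hW t x y)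
      · rw [norm_smul, Real.norm_eq_abs]
        calc |cutoff R x - cutoff R y| * ‖W t y‖
            ≤ (C / R * ‖x - y‖) * (L * (‖z‖ + B * b) + M) :=
              mul_le_mul (abs_cutoff_sub_le (hC R hR1) x y) h3 (norm_nonneg _) (by positivity)
          _ = _ := by ring
    · exact (continuous_const.smul (hWc x)).continuousOn
    · rw [Real.coe_toNNReal _ hB0]
      exact hvB t ht x
    · rw [Real.coe_toNNReal _ hB0, Real.coe_toNNReal _ (by positivity)]
      simp [hb]
  obtain ⟨x, hx0, hx⟩ := hPL.exists_eq_forall_mem_Icc_hasDerivWithinAt₀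
  replace hx0 : x 0 = z := hx0
  have hxc : ContinuousOn x (Set.Icc 0 b) := fun s hs => (hx s hs).continuousWithinAt
  have hxb := norm_le_gronwallBound_of_norm_deriv_right_le (f := x) (f' := fun s => v s (x s))
    (δ := ‖z‖) (K := L) (ε := M) hxc (fun s hs => ((hx s
      (Set.Ico_subset_Icc_self hs)).mono_of_mem_nhdsWithin (Icc_mem_nhdsGE_of_mem hs))) (by rw [hx0]) (fun s hs => hvlin s (Set.Ico_subset_Icc_self hs) _)
  refine ⟨x, hx0, hxc, fun s hs => ?_⟩
  have hs' := Set.Ioo_subset_Icc_self hs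
  have h1 := (hx s hs').hasDerivAt (Icc_mem_nhds hs.1 hs.2)
  have h2 : ‖x s‖ ≤ R := by
    have h3 := hxb s hs'
    rw [sub_zero] at h3
    exact h3.trans ((hgb s hs').trans (by linarith))
  simp only [hv, cutoff_eq_one hR1 h2, one_smul] at h1
  exact h1

lemma norm_sub_le_exp_of_hasDerivAt {b L : ℝ} {W : ℝ → E → E}
    (hW : ∀ t z w, ‖W t z - W t w‖ ≤ L * ‖z - w‖) {x y : ℝ → E}
    (hxc : ContinuousOn x (Set.Icc 0 b)) (hyc : ContinuousOn y (Set.Icc 0 b))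
    (hx : ∀ s ∈ Set.Ioo 0 b, HasDerivAt x (W s (x s)) s)
    (hy : ∀ s ∈ Set.Ioo 0 b, HasDerivAt y (W s (y s)) s) {s : ℝ} (hs : s ∈ Set.Icc 0 b) :
    ‖x s - y s‖ ≤ exp (L * s) * ‖x 0 - y 0‖ ∧ ‖x 0 - y 0‖ ≤ exp (L * s) * ‖x s - y s‖ := by
  have h0 : (0 : ℝ) ∈ Set.Icc 0 b := ⟨le_rfl, hs.1.trans hs.2⟩
  have hder : ∀ c, ∀ r ∈ Set.Ioo 0 b, HasDerivAt (fun r => exp (c * r) * ‖x r - y r‖ ^ 2)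
      (exp (c * r) * (c * ‖x r - y r‖ ^ 2 +
        2 * inner ℝ (x r - y r) (W r (x r) - W r (y r)))) r := by
    intro c r hr
    have h1 : HasDerivAt (fun r => exp (c * r)) (exp (c * r) * (c * 1)) r :=
      ((hasDerivAt_id r).const_mul c).exp
    have h2 := h1.mul ((hx r hr).sub (hy r hr)).norm_sq
    refine h2.congr_deriv ?_
    simp only [Pi.sub_apply]
    ring
  have hcont : ∀ c, ContinuousOn (fun r => exp (c * r) * ‖x r - y r‖ ^ 2) (Set.Icc 0 b) := fun c =>
    (by fun_prop : Continuous fun r : ℝ => exp (c * r)).continuousOn.mul ((hxc.sub hyc).norm.pow 2)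
  have hin : ∀ r, |inner ℝ (x r - y r) (W r (x r) - W r (y r))| ≤ L * ‖x r - y r‖ ^ 2 := by
    intro r
    refine (abs_real_inner_le_norm _ _).trans ?_
    nlinarith [hW r (x r) (y r), norm_nonneg (x r - y r)]
  have hsqrt : ∀ {p q : ℝ}, 0 ≤ q → p ^ 2 ≤ q ^ 2 → p ≤ q := fun hq h =>
    (abs_le_of_sq_le_sq' h hq).2
  constructor
  · have hanti : AntitoneOn (fun r => exp (-(2 * L) * r) * ‖x r - y r‖ ^ 2) (Set.Icc 0 b) := by
      refine antitoneOn_of_deriv_nonpos (convex_Icc 0 b) (hcont _) ?_ ?_ <;> rw [interior_Icc]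
      · exact fun r hr => (hder _ r hr).differentiableAt.differentiableWithinAt
      · intro r hr
        rw [(hder _ r hr).deriv]
        refine mul_nonpos_of_nonneg_of_nonpos (exp_pos _).le ?_
        have := (abs_le.1 (hin r)).2
        linarith
    have h1 := hanti h0 hs hs.1
    simp only [mul_zero, exp_zero, one_mul] at h1
    refine hsqrt (by positivity) ?_
    have h2 : exp (-(2 * L) * s) * (exp (L * s)) ^ 2 = 1 := by
      rw [← exp_nat_mul, ← exp_add]
      simp; ring
    rw [mul_pow]
    have h3 := mul_le_mul_of_nonneg_left h1 (sq_nonneg (exp (L * s)))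
    calc ‖x s - y s‖ ^ 2 = (exp (-(2 * L) * s) * (exp (L * s)) ^ 2) * ‖x s - y s‖ ^ 2 := by
          rw [h2, one_mul]
      _ ≤ _ := by linarith
  · have hmono : MonotoneOn (fun r => exp ((2 * L) * r) * ‖x r - y r‖ ^ 2) (Set.Icc 0 b) := by
      refine monotoneOn_of_deriv_nonneg (convex_Icc 0 b) (hcont _) ?_ ?_ <;> rw [interior_Icc]
      · exact fun r hr => (hder _ r hr).differentiableAt.differentiableWithinAt
      · intro r hr
        rw [(hder _ r hr).deriv]
        refine mul_nonneg (exp_pos _).le ?_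
        have := (abs_le.1 (hin r)).1
        linarith
    have h1 := hmono h0 hs hs.1
    simp only [mul_zero, exp_zero, one_mul] at h1
    refine hsqrt (by positivity) ?_
    have h2 : exp (2 * L * s) = (exp (L * s)) ^ 2 := by
      rw [← exp_nat_mul]
      congr 1
      push_cast
      ring
    rwa [mul_pow, ← h2]

/-- The flow, on a compact time interval, of a globally Lipschitz vector field, extended to be
constant in time outside that interval. -/
structure IsFlowOn (b L : ℝ) (W : ℝ → E → E) (X : ℝ → E → E) : Prop where
  zero : ∀ z, X 0 z = z
  continuous_time : ∀ z, Continuous fun s => X s z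
  norm_sub_le : ∀ s z w, ‖X s z - X s w‖ ≤ exp (L * b) * ‖z - w‖
  le_norm_sub : ∀ s z w, ‖z - w‖ ≤ exp (L * b) * ‖X s z - X s w‖
  hasDerivAt : ∀ z, ∀ s ∈ Set.Ioo 0 b, HasDerivAt (fun s => X s z) (W s (X s z)) s

theorem exists_isFlowOn {b L : ℝ} {W : ℝ → E → E} (hb : 0 ≤ b) (hL : 0 ≤ L)
    (hWc : ∀ z, Continuous fun t => W t z) (hW : ∀ t z w, ‖W t z - W t w‖ ≤ L * ‖z - w‖) :
    ∃ X, IsFlowOn b L W X := by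
  choose x hx0 hxc hx using exists_integralCurve_of_lipschitz hb hL hWc hW
  have hcl : ∀ s : ℝ, (Set.projIcc 0 b hb s : ℝ) ∈ Set.Icc 0 b := fun s => (Set.projIcc 0 b hb s).2
  have hexp : ∀ s : ℝ, exp (L * Set.projIcc 0 b hb s) ≤ exp (L * b) := fun s =>
    exp_le_exp.2 (mul_le_mul_of_nonneg_left (hcl s).2 hL)
  refine ⟨fun s z => x z (Set.projIcc 0 b hb s), fun z => ?_, fun z => ?_, fun s z w => ?_,
    fun s z w => ?_, fun z s hs => ?_⟩
  · rw [Set.projIcc_of_mem hb ⟨le_rfl, hb⟩, hx0]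
  · exact (hxc z).comp_continuous (continuous_subtype_val.comp continuous_projIcc) hcl
  · have := (norm_sub_le_exp_of_hasDerivAt hW (hxc z) (hxc w) (hx z) (hx w) (hcl s)).1
    rw [hx0, hx0] at this
    exact this.trans (mul_le_mul_of_nonneg_right (hexp s) (norm_nonneg _))
  · have := (norm_sub_le_exp_of_hasDerivAt hW (hxc z) (hxc w) (hx z) (hx w) (hcl s)).2
    rw [hx0, hx0] at this
    exact this.trans (mul_le_mul_of_nonneg_right (hexp s) (norm_nonneg _))
  · have h1 : (Set.projIcc 0 b hb s : ℝ) = s := by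
      rw [Set.projIcc_of_mem hb (Set.Ioo_subset_Icc_self hs)]
    simp only [h1]
    refine (hx z s hs).congr_of_eventuallyEq ?_
    filter_upwards [Ioo_mem_nhds hs.1 hs.2] with r hr
    rw [Set.projIcc_of_mem hb (Set.Ioo_subset_Icc_self hr)]

namespace IsFlowOn

variable {b L : ℝ} {W X : ℝ → E → E} (h : IsFlowOn b L W X)
include h

lemma continuous_uncurry : Continuous fun p : ℝ × E => X p.1 p.2 := by
  refine continuous_prod_of_continuous_lipschitzWith' _ (Real.toNNReal (exp (L * b))) (fun t => ?_)
    h.continuous_time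
  refine LipschitzWith.of_dist_le_mul fun α β => ?_
  rw [dist_eq_norm, dist_eq_norm, Real.coe_toNNReal _ (exp_pos _).le]
  exact h.norm_sub_le t α β

lemma continuous (s : ℝ) : Continuous (X s) :=
  h.continuous_uncurry.comp (by fun_prop : Continuous fun z : E => (s, z))

lemma exists_norm_le : ∃ C, 0 ≤ C ∧ ∀ s ∈ Set.Icc 0 b, ∀ z, ‖X s z‖ ≤ C * (1 + ‖z‖) := by
  obtain ⟨M, hM⟩ := isCompact_Icc.exists_bound_of_continuousOn (s := Set.Icc 0 b)
    (h.continuous_time 0).continuousOn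
  refine ⟨|M| + exp (L * b), by positivity, fun s hs z => ?_⟩
  have h1 := h.norm_sub_le s z 0
  rw [sub_zero] at h1
  have h2 := norm_sub_norm_le (X s z) (X s 0)
  have h3 := (hM s hs).trans (le_abs_self M)
  have h4 := exp_pos (L * b)
  nlinarith [norm_nonneg z, abs_nonneg M]

lemma map_absolutelyContinuous (s : ℝ) {μ : Measure E} (hμ : μ ≪ volume) :
    μ.map (X s) ≪ volume := by
  refine Measure.AbsolutelyContinuous.mk fun A hA h0 => ?_
  rw [Measure.map_apply (h.continuous s).measurable hA]
  refine hμ ?_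
  have hanti : AntilipschitzWith (Real.toNNReal (exp (L * b))) (X s) := by
    refine AntilipschitzWith.of_le_mul_dist fun z w => ?_
    rw [dist_eq_norm, dist_eq_norm, Real.coe_toNNReal _ (exp_pos _).le]
    exact h.le_norm_sub s z w
  have h1 : (volume : Measure E) ≪ Measure.hausdorffMeasure (Module.finrank ℝ E) :=
    Measure.absolutelyContinuous_isAddHaarMeasure _ _
  have h2 : (Measure.hausdorffMeasure (Module.finrank ℝ E) : Measure E) ≪ volume :=
    Measure.absolutelyContinuous_isAddHaarMeasure _ _
  refine h1 (le_antisymm ?_ bot_le)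
  refine (hanti.hausdorffMeasure_preimage_le (Nat.cast_nonneg _) A).trans ?_
  rw [h2 h0, mul_zero]

end IsFlowOn

end LipschitzFlow

section MeanFieldContinuity

variable {E : Type*} [NormedAddCommGroup E] [InnerProductSpace ℝ E] [FiniteDimensional ℝ E]
  [MeasurableSpace E] [BorelSpace E]

lemma IsTestFunction.of_hasCompactSupport {φ : E → ℝ} (hφ : ContDiff ℝ 1 φ)
    (hc : HasCompactSupport φ) : IsTestFunction φ :=
  ⟨hφ, hc.exists_bound_of_continuous hφ.continuous,
    (hc.fderiv ℝ).exists_bound_of_continuous (hφ.continuous_fderiv one_ne_zero)⟩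

lemma integrable_mul_of_abs_le_one_add_norm {f ψ : E → ℝ} (hf : Integrable f) (h0 : 0 ≤ᵐ[volume] f)
    (h2 : Integrable fun z => ‖z‖ ^ 2 * f z) (hψ : AEStronglyMeasurable ψ) {A : ℝ}
    (hA : ∀ z, |ψ z| ≤ A * (1 + ‖z‖)) : Integrable fun z => ψ z * f z := by
  have hA0 : 0 ≤ A := by simpa using (abs_nonneg _).trans (hA 0)
  refine ((hf.const_mul (2 * A)).add (h2.const_mul A)).mono' (hψ.mul hf.aestronglyMeasurable) ?_
  filter_upwards [h0] with z hz
  simp only [Pi.zero_apply] at hz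
  rw [norm_mul, Real.norm_eq_abs, Real.norm_of_nonneg hz, Pi.add_apply, ← mul_assoc, ← add_mul]
  refine mul_le_mul_of_nonneg_right ((hA z).trans ?_) hz
  nlinarith [sq_nonneg (‖z‖ - 1)]

namespace IsProbabilitySolution

variable {L : ℝ} {K : E × E → E} {f : ℝ → E → ℝ} (h : IsProbabilitySolution L K f)
include h

lemma integrable_norm_sq_mul (h2 : Integrable fun z => ‖z‖ ^ 2 * f 0 z) {t : ℝ} (ht : 0 ≤ t) :
    Integrable fun z => ‖z‖ ^ 2 * f t z :=
  ((h.exists_second_moment_bound (b := t) h2).choose_spec t ⟨ht, le_rfl⟩).1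

lemma continuousOn_integral_mul (h2 : Integrable fun z => ‖z‖ ^ 2 * f 0 z) {ψ : E → ℝ}
    (hψ : ContDiff ℝ 1 ψ) {A : ℝ} (hA : ∀ z, |ψ z| ≤ A * (1 + ‖z‖)) (b : ℝ) :
    ContinuousOn (fun t => ∫ z, ψ z * f t z) (Set.Icc 0 b) := by
  obtain ⟨C, hC⟩ := h.exists_second_moment_bound (b := b) h2
  have hA0 : 0 ≤ A := by simpa using (abs_nonneg _).trans (hA 0)
  have htest : ∀ n : ℕ, IsTestFunction fun z => cutoff ((n : ℝ) + 1) z * ψ z := fun n =>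
    .of_hasCompactSupport ((contDiff_cutoff _).mul hψ)
      (hasCompactSupport_cutoff (by positivity)).mul_right
  have hunif : TendstoUniformlyOn (fun (n : ℕ) t => ∫ z, (cutoff ((n : ℝ) + 1) z * ψ z) * f t z)
      (fun t => ∫ z, ψ z * f t z) atTop (Set.Icc 0 b) := by
    rw [Metric.tendstoUniformlyOn_iff]
    intro ε hε
    have hlim : Tendsto (fun n : ℕ => 2 * A * C / ((n : ℝ) + 1)) atTop (𝓝 0) := by
      have := (tendsto_one_div_add_atTop_nhds_zero_nat (𝕜 := ℝ)).const_mul (2 * A * C)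
      simpa [div_eq_mul_inv] using this
    filter_upwards [hlim.eventually_lt_const hε] with n hn t ht
    refine lt_of_le_of_lt ?_ hn
    have hn0 : (0 : ℝ) < n + 1 := by positivity
    have hn1 : (1 : ℝ) ≤ n + 1 := by simp
    have i1 := integrable_mul_of_abs_le_one_add_norm (h.integrable t) (h.ae_nonneg t) (hC t ht).1
      hψ.continuous.aestronglyMeasurable hA
    have i2 := (htest n).integrable_mul (h.integrable t)
    rw [Real.dist_eq, ← integral_sub i1 i2, ← Real.norm_eq_abs]
    calc _ ≤ ∫ z, 2 * A / ((n : ℝ) + 1) * (‖z‖ ^ 2 * f t z) := by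
          refine norm_integral_le_of_norm_le ((hC t ht).1.const_mul _) ?_
          filter_upwards [h.ae_nonneg t] with z hz
          simp only [Pi.zero_apply] at hz
          rw [← sub_mul, norm_mul, Real.norm_of_nonneg hz, ← mul_assoc, Real.norm_eq_abs]
          refine mul_le_mul_of_nonneg_right ?_ hz
          by_cases hz1 : ‖z‖ ≤ n + 1
          · rw [cutoff_eq_one hn0 hz1, one_mul, sub_self, abs_zero]
            positivity
          · rw [not_le] at hz1
            have h3 : |ψ z - cutoff ((n : ℝ) + 1) z * ψ z| ≤ |ψ z| := by
              rw [show ψ z - cutoff ((n : ℝ) + 1) z * ψ z = (1 - cutoff ((n : ℝ) + 1) z) * ψ z by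
                ring, abs_mul]
              refine mul_le_of_le_one_left (abs_nonneg _) (abs_le.2 ⟨?_, ?_⟩)
              · linarith [cutoff_le_one ((n : ℝ) + 1) z]
              · linarith [cutoff_nonneg ((n : ℝ) + 1) z]
            refine (h3.trans (hA z)).trans ?_
            rw [mul_comm 2 A, mul_div_assoc, mul_assoc]
            refine mul_le_mul_of_nonneg_left ?_ hA0
            rw [div_mul_eq_mul_div, le_div_iff₀ hn0]
            nlinarith [norm_nonneg z]
      _ ≤ 2 * A * C / ((n : ℝ) + 1) := by
          rw [integral_const_mul, mul_div_right_comm (2 * A) C]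
          exact mul_le_mul_of_nonneg_left (hC t ht).2 (by positivity)
  exact hunif.continuousOn (Frequently.of_forall fun n =>
    (h.solution.continuous_integral (htest n)).continuousOn)

lemma integrable_smul_kernel (h2 : Integrable fun z => ‖z‖ ^ 2 * f 0 z) {t : ℝ} (ht : 0 ≤ t)
    (z : E) : Integrable fun z' => f t z' • K (z, z') := by
  have hm : AEStronglyMeasurable (fun z' => f t z' • K (z, z')) volume :=
    (h.integrable t).aestronglyMeasurable.smul
      (h.kernel.continuous_right z).aestronglyMeasurable
  rw [← integrable_norm_iff hm]
  have := integrable_mul_of_abs_le_one_add_norm (h.integrable t) (h.ae_nonneg t)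
    (h.integrable_norm_sq_mul h2 ht) (ψ := fun z' => ‖K (z, z')‖) (A := L * (1 + ‖z‖))
    (h.kernel.continuous_right z).norm.aestronglyMeasurable fun z' => by
      rw [abs_norm]
      refine (h.kernel.norm_le z z').trans ?_
      rw [mul_assoc]
      refine mul_le_mul_of_nonneg_left ((norm_sub_le _ _).trans ?_) h.kernel.nonneg
      nlinarith [norm_nonneg z, norm_nonneg z']
  refine this.congr ?_
  filter_upwards [h.ae_nonneg t] with z' hz'
  rw [norm_smul, Real.norm_of_nonneg hz', mul_comm]

lemma continuousOn_meanField (h2 : Integrable fun z => ‖z‖ ^ 2 * f 0 z) (b : ℝ) (z : E) :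
    ContinuousOn (fun t => meanField K (f t) z) (Set.Icc 0 b) := by
  set e := stdOrthonormalBasis ℝ E
  suffices hs : ∀ v : E, ContinuousOn (fun t => (inner ℝ v (meanField K (f t) z) : ℝ))
      (Set.Icc 0 b) by
    have := continuousOn_finsetSum Finset.univ fun i _ =>
      (hs (e i)).smul (continuousOn_const (c := e i))
    refine this.congr fun t _ => ?_
    exact (e.sum_repr' _).symm
  intro v
  have hψ : ContDiff ℝ 1 fun z' => (inner ℝ v (K (z, z')) : ℝ) :=
    contDiff_const.inner ℝ (h.kernel.contDiff.comp (contDiff_const.prodMk contDiff_id))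
  refine (h.continuousOn_integral_mul h2 hψ (A := ‖v‖ * (L * (1 + ‖z‖))) (fun z' => ?_) b).congr
    fun t ht => ?_
  · refine (abs_real_inner_le_norm _ _).trans ?_
    rw [mul_assoc]
    refine mul_le_mul_of_nonneg_left ((h.kernel.norm_le z z').trans ?_) (norm_nonneg _)
    rw [mul_assoc]
    refine mul_le_mul_of_nonneg_left ((norm_sub_le _ _).trans ?_) h.kernel.nonneg
    nlinarith [norm_nonneg z, norm_nonneg z']
  · simp only [meanField]
    rw [← integral_inner (h.integrable_smul_kernel h2 ht.1 z)]
    refine integral_congr_ae (Eventually.of_forall fun z' => ?_)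
    simp only [inner_smul_right]
    ring

end IsProbabilitySolution

/-- The mean field velocity of a solution on `[0, b]`, extended to be constant in time outside. -/
def clampedField (K : E × E → E) (f : ℝ → E → ℝ) {b : ℝ} (hb : 0 ≤ b) (t : ℝ) (z : E) : E :=
  meanField K (f (Set.projIcc 0 b hb t)) z

lemma clampedField_of_mem (K : E × E → E) (f : ℝ → E → ℝ) {b : ℝ} (hb : 0 ≤ b) {t : ℝ}
    (ht : t ∈ Set.Icc 0 b) : clampedField K f hb t = meanField K (f t) := by
  funext z
  rw [clampedField, Set.projIcc_of_mem hb ht]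

namespace IsProbabilitySolution

variable {L : ℝ} {K : E × E → E} {f : ℝ → E → ℝ} (h : IsProbabilitySolution L K f)
include h

lemma continuous_clampedField (h2 : Integrable fun z => ‖z‖ ^ 2 * f 0 z) {b : ℝ} (hb : 0 ≤ b)
    (z : E) : Continuous fun t => clampedField K f hb t z :=
  (h.continuousOn_meanField h2 b z).comp_continuous
    (continuous_subtype_val.comp continuous_projIcc) fun t => (Set.projIcc 0 b hb t).2

lemma norm_clampedField_sub_le {b : ℝ} (hb : 0 ≤ b) (t : ℝ) (z w : E) :
    ‖clampedField K f hb t z - clampedField K f hb t w‖ ≤ L * ‖z - w‖ :=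
  h.norm_meanField_sub_le _ z w

lemma continuous_uncurry_clampedField (h2 : Integrable fun z => ‖z‖ ^ 2 * f 0 z) {b : ℝ}
    (hb : 0 ≤ b) : Continuous fun p : ℝ × E => clampedField K f hb p.1 p.2 := by
  refine continuous_prod_of_continuous_lipschitzWith' _ (Real.toNNReal L) (fun t => ?_)
    (h.continuous_clampedField h2 hb)
  refine LipschitzWith.of_dist_le_mul fun α β => ?_
  rw [dist_eq_norm, dist_eq_norm, Real.coe_toNNReal _ h.kernel.nonneg]
  exact h.norm_clampedField_sub_le hb t α β

lemma exists_norm_clampedField_le (h2 : Integrable fun z => ‖z‖ ^ 2 * f 0 z) {b : ℝ}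
    (hb : 0 ≤ b) : ∃ C, 0 ≤ C ∧ ∀ t z, ‖clampedField K f hb t z‖ ≤ C * (1 + ‖z‖) := by
  obtain ⟨M, hM⟩ := isCompact_Icc.exists_bound_of_continuousOn (s := Set.Icc 0 b)
    (h.continuousOn_meanField h2 b 0)
  have hL := h.kernel.nonneg
  refine ⟨|M| + L, by positivity, fun t z => ?_⟩
  have h1 := h.norm_clampedField_sub_le hb t z 0
  rw [sub_zero] at h1
  have h3 := norm_sub_norm_le (clampedField K f hb t z) (clampedField K f hb t 0)
  have h4 : ‖clampedField K f hb t 0‖ ≤ |M| :=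
    (hM _ (Set.projIcc 0 b hb t).2).trans (le_abs_self M)
  nlinarith [norm_nonneg z, abs_nonneg M]

lemma exists_isFlowOn_clampedField (h2 : Integrable fun z => ‖z‖ ^ 2 * f 0 z) {b : ℝ}
    (hb : 0 ≤ b) : ∃ X, IsFlowOn b L (clampedField K f hb) X :=
  exists_isFlowOn hb h.kernel.nonneg (h.continuous_clampedField h2 hb)
    (h.norm_clampedField_sub_le hb)

end IsProbabilitySolution

end MeanFieldContinuity

section Characteristics

variable {E : Type*} [NormedAddCommGroup E] [InnerProductSpace ℝ E] [FiniteDimensional ℝ E]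
  [MeasurableSpace E] [BorelSpace E]

/-- The measure with real density `g` with respect to the volume. -/
def withRealDensity (g : E → ℝ) : Measure E := volume.withDensity fun z => ENNReal.ofReal (g z)

lemma integral_withRealDensity {F : Type*} [NormedAddCommGroup F] [NormedSpace ℝ F] {g : E → ℝ}
    (hg : Integrable g) (h0 : 0 ≤ᵐ[volume] g) (u : E → F) :
    ∫ z, u z ∂withRealDensity g = ∫ z, g z • u z := by
  rw [withRealDensity, integral_withDensity_eq_integral_toReal_smul₀
    hg.aestronglyMeasurable.aemeasurable.ennreal_ofReal
    (Eventually.of_forall fun _ => ENNReal.ofReal_lt_top)]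
  refine integral_congr_ae ?_
  filter_upwards [h0] with z hz
  rw [ENNReal.toReal_ofReal hz]

lemma integrable_withRealDensity_iff {F : Type*} [NormedAddCommGroup F] [NormedSpace ℝ F]
    {g : E → ℝ} (hg : Integrable g) (h0 : 0 ≤ᵐ[volume] g) {u : E → F} :
    Integrable u (withRealDensity g) ↔ Integrable fun z => g z • u z := by
  rw [withRealDensity, integrable_withDensity_iff_integrable_smul₀'
    hg.aestronglyMeasurable.aemeasurable.ennreal_ofReal
    (Eventually.of_forall fun _ => ENNReal.ofReal_lt_top)]
  refine integrable_congr ?_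
  filter_upwards [h0] with z hz
  rw [ENNReal.toReal_ofReal hz]

lemma withRealDensity_absolutelyContinuous (g : E → ℝ) :
    (withRealDensity g : Measure E) ≪ volume :=
  withDensity_absolutelyContinuous _ _

namespace IsProbabilitySolution

variable {L : ℝ} {K : E × E → E} {f : ℝ → E → ℝ} (h : IsProbabilitySolution L K f)
include h

lemma isProbabilityMeasure (t : ℝ) : IsProbabilityMeasure (withRealDensity (f t)) := by
  refine ⟨?_⟩
  rw [withRealDensity, withDensity_apply _ MeasurableSet.univ, Measure.restrict_univ,
    ← ofReal_integral_eq_lintegral_ofReal (h.integrable t) (h.ae_nonneg t), h.integral_eq_one,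
    ENNReal.ofReal_one]

lemma integrable_norm_sq (h2 : Integrable fun z => ‖z‖ ^ 2 * f 0 z) {t : ℝ} (ht : 0 ≤ t) :
    Integrable (fun z => ‖z‖ ^ 2) (withRealDensity (f t)) := by
  rw [integrable_withRealDensity_iff (h.integrable t) (h.ae_nonneg t)]
  simpa [mul_comm] using h.integrable_norm_sq_mul h2 ht

lemma integrable_one_add_norm (h2 : Integrable fun z => ‖z‖ ^ 2 * f 0 z) :
    Integrable (fun z => 1 + ‖z‖) (withRealDensity (f 0)) := by
  have := h.isProbabilityMeasure 0
  refine ((integrable_const 2).add (h.integrable_norm_sq h2 le_rfl)).mono'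
    (by fun_prop) (Eventually.of_forall fun z => ?_)
  rw [Real.norm_of_nonneg (by positivity), Pi.add_apply]
  nlinarith [sq_nonneg (‖z‖ - 1)]

lemma meanField_eq_integral (t : ℝ) (z : E) :
    meanField K (f t) z = ∫ w, K (z, w) ∂withRealDensity (f t) :=
  (integral_withRealDensity (h.integrable t) (h.ae_nonneg t) _).symm

lemma hasDerivAt_integral_flow (h2 : Integrable fun z => ‖z‖ ^ 2 * f 0 z) {b : ℝ} {hb : 0 ≤ b}
    {X : ℝ → E → E} (hX : IsFlowOn b L (clampedField K f hb) X) {φ : E → ℝ}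
    (hφ : IsTestFunction φ) {t : ℝ} (ht : t ∈ Set.Ioo 0 b) :
    Integrable (fun z => fderiv ℝ φ (X t z) (meanField K (f t) (X t z))) (withRealDensity (f 0)) ∧
    HasDerivAt (fun s => ∫ z, φ (X s z) ∂withRealDensity (f 0))
      (∫ z, fderiv ℝ φ (X t z) (meanField K (f t) (X t z)) ∂withRealDensity (f 0)) t := by
  have hp := h.isProbabilityMeasure 0
  obtain ⟨Cφ, hCφ⟩ := hφ.bounded
  obtain ⟨D, hD⟩ := hφ.fderiv_bounded
  have hD0 : 0 ≤ D := (norm_nonneg _).trans (hD 0)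
  obtain ⟨C₁, hC₁0, hC₁⟩ := hX.exists_norm_le
  obtain ⟨C₂, hC₂0, hC₂⟩ := h.exists_norm_clampedField_le h2 hb
  have hfc := hφ.contDiff.continuous_fderiv one_ne_zero
  have hVc := h.continuous_meanField t
  have key := hasDerivAt_integral_of_dominated_loc_of_deriv_le (μ := withRealDensity (f 0))
    (x₀ := t) (s := Set.Ioo 0 b) (F := fun s z => φ (X s z))
    (F' := fun s z => fderiv ℝ φ (X s z) (clampedField K f hb s (X s z)))
    (bound := fun z => D * (C₂ * ((1 + C₁) * (1 + ‖z‖)))) (Ioo_mem_nhds ht.1 ht.2)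
    (Eventually.of_forall fun s =>
      (hφ.contDiff.continuous.comp (hX.continuous s)).aestronglyMeasurable)
    ((integrable_const Cφ).mono' (hφ.contDiff.continuous.comp (hX.continuous t)).aestronglyMeasurable
      (Eventually.of_forall fun z => hCφ _))
    (by
      rw [clampedField_of_mem K f hb (Set.Ioo_subset_Icc_self ht)]
      exact ((hfc.comp (hX.continuous t)).clm_apply
        (hVc.comp (hX.continuous t))).aestronglyMeasurable)
    (Eventually.of_forall fun z s hs => by
      have h3 := hC₁ s (Set.Ioo_subset_Icc_self hs) z
      refine (ContinuousLinearMap.le_opNorm _ _).trans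
        (mul_le_mul (hD _) ((hC₂ s _).trans (mul_le_mul_of_nonneg_left ?_ hC₂0))
          (norm_nonneg _) hD0)
      nlinarith [norm_nonneg z])
    ((((h.integrable_one_add_norm h2).const_mul _).const_mul _).const_mul _)
    (Eventually.of_forall fun z s hs =>
      ((hφ.contDiff.differentiable one_ne_zero _).hasFDerivAt).comp_hasDerivAt s
        (hX.hasDerivAt z s hs))
  rwa [clampedField_of_mem K f hb (Set.Ioo_subset_Icc_self ht)] at key

/-- A solution is transported by the flow of its mean field velocity. -/
theorem withRealDensity_eq_map (h2 : Integrable fun z => ‖z‖ ^ 2 * f 0 z) {b : ℝ} {hb : 0 ≤ b}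
    {X : ℝ → E → E} (hX : IsFlowOn b L (clampedField K f hb) X) {t : ℝ} (ht : t ∈ Set.Icc 0 b) :
    withRealDensity (f t) = (withRealDensity (f 0)).map (X t) := by
  have hp := h.isProbabilityMeasure 0
  set μ := withRealDensity (f 0) with hμ
  have hm : ∀ s, AEMeasurable (X s) μ := fun s => (hX.continuous s).aemeasurable
  have hν : ∀ s, IsProbabilityMeasure (μ.map (X s)) := fun s =>
    Measure.isProbabilityMeasure_map (hm s)
  have hac : ∀ s, μ.map (X s) ≪ volume := fun s =>
    hX.map_absolutelyContinuous s (withRealDensity_absolutelyContinuous _)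
  set g : ℝ → E → ℝ := fun s z => ((μ.map (X s)).rnDeriv volume z).toReal with hg
  have hgi : ∀ s, Integrable (g s) := fun s => Measure.integrable_toReal_rnDeriv
  have hgint : ∀ s (u : E → ℝ), Continuous u → ∫ z, u z * g s z = ∫ z, u (X s z) ∂μ := by
    intro s u hu
    rw [← integral_map (hm s) hu.aestronglyMeasurable, ← integral_rnDeriv_smul (hac s)]
    simp only [smul_eq_mul, hg, mul_comm]
  have hgi' : ∀ s (u : E → ℝ), Continuous u → Integrable (fun z => u (X s z)) μ →
      Integrable fun z => u z * g s z := by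
    intro s u hu hi
    have := (integrable_map_measure hu.aestronglyMeasurable (hm s)).2 hi
    rw [← integrable_rnDeriv_smul_iff (hac s)] at this
    simpa only [smul_eq_mul, hg, mul_comm] using this
  have hg1 : ∀ s, ∫ z, |g s z| = 1 := by
    intro s
    have h3 := hgint s (fun _ => 1) continuous_const
    simp only [one_mul, integral_const, probReal_univ, smul_eq_mul, mul_one] at h3
    rw [← h3]
    exact integral_congr_ae (Eventually.of_forall fun z => abs_of_nonneg ENNReal.toReal_nonneg)
  have hsub : ∀ φ, IsTestFunction φ → ∀ s, ∫ z, φ z * (f s z - g s z) =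
      (∫ z, φ z * f s z) - ∫ z, φ (X s z) ∂μ := by
    intro φ hφ s
    rw [← hgint s φ hφ.contDiff.continuous,
      ← integral_sub (hφ.integrable_mul (h.integrable s)) (hφ.integrable_mul (hgi s))]
    simp only [mul_sub]
  have hVcont := fun s => h.continuous_meanField s
  have htr := integral_abs_eq_of_transport (h := fun s z => f s z - g s z)
    (V := fun s => meanField K (f s)) (p := 0) (q := t) (c := 2) (Λ := L) ht.1
    (fun s _ => (h.integrable s).sub (hgi s)) (fun s _ => ?_)
    (fun s _ => (h.kernel.contDiff_meanField (h.integrable s)).1) (fun s _ z => ?_)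
    (fun φ hφ => ?_) (fun φ hφ s hs => ?_)
  · have h0 : ∫ z, |f 0 z - g 0 z| = 0 := by
      have h3 : g 0 =ᵐ[volume] f 0 := by
        have h4 : μ.map (X 0) = μ := by
          rw [show X 0 = id from funext hX.zero, Measure.map_id]
        have h5 : μ.rnDeriv volume =ᵐ[volume] fun z => ENNReal.ofReal (f 0 z) :=
          Measure.rnDeriv_withDensity₀ _
            (h.integrable 0).aestronglyMeasurable.aemeasurable.ennreal_ofReal
        filter_upwards [h5, h.ae_nonneg 0] with z hz hz'
        rw [hg]
        simp only
        rw [h4, hz, ENNReal.toReal_ofReal hz']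
      refine integral_eq_zero_of_ae ?_
      filter_upwards [h3] with z hz
      simp only [Pi.zero_apply]
      rw [hz, sub_self, abs_zero]
    rw [h0] at htr
    have h6 := (integral_eq_zero_iff_of_nonneg (fun z => abs_nonneg _)
      ((h.integrable t).sub (hgi t)).abs).1 htr.symm
    rw [← Measure.withDensity_rnDeriv_eq _ _ (hac t), withRealDensity]
    refine withDensity_congr_ae ?_
    filter_upwards [h6, (μ.map (X t)).rnDeriv_lt_top volume] with z hz hz'
    have h7 : f t z = g t z := sub_eq_zero.1 (abs_eq_zero.1 hz)
    rw [h7]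
    exact ENNReal.ofReal_toReal hz'.ne
  · calc ∫ z, |f s z - g s z| ≤ ∫ z, (|f s z| + |g s z|) :=
          integral_mono ((h.integrable s).sub (hgi s)).abs ((h.integrable s).abs.add (hgi s).abs)
            fun z => abs_sub _ _
      _ = 2 := by
          rw [integral_add (h.integrable s).abs (hgi s).abs, h.integral_abs_eq_one, hg1]
          norm_num
  · have := (h.kernel.contDiff_meanField (h.integrable s)).2 z
    rwa [h.integral_abs_eq_one, mul_one] at this
  · simp only [hsub φ hφ]
    refine (h.solution.continuous_integral hφ).continuousOn.sub (Continuous.continuousOn ?_)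
    obtain ⟨C, hC⟩ := hφ.bounded
    exact continuous_of_dominated
      (fun s => (hφ.contDiff.continuous.comp (hX.continuous s)).aestronglyMeasurable)
      (fun s => Eventually.of_forall fun z => hC _) (integrable_const C)
      (Eventually.of_forall fun z => hφ.contDiff.continuous.comp (hX.continuous_time z))
  · simp only [hsub φ hφ]
    have hs' : s ∈ Set.Ioo 0 b := ⟨hs.1, hs.2.trans_le ht.2⟩
    obtain ⟨i1, h3⟩ := h.hasDerivAt_integral_flow h2 hX hφ hs'
    refine ((h.solution.hasDerivAt φ hφ s).sub h3).congr_deriv ?_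
    have hu : Continuous fun z => fderiv ℝ φ z (meanField K (f s) z) :=
      (hφ.contDiff.continuous_fderiv one_ne_zero).clm_apply (hVcont s)
    have i2 := hgi' s _ hu i1
    have i3 : Integrable fun z => fderiv ℝ φ z (meanField K (f s) z) * f s z := by
      obtain ⟨D, hD⟩ := hφ.fderiv_bounded
      have hD0 : 0 ≤ D := (norm_nonneg _).trans (hD 0)
      obtain ⟨C₂, hC₂0, hC₂⟩ := h.exists_norm_clampedField_le h2 hb
      refine integrable_mul_of_abs_le_one_add_norm (h.integrable s) (h.ae_nonneg s)
        (h.integrable_norm_sq_mul h2 hs.1.le) hu.aestronglyMeasurable (A := D * C₂) fun z => ?_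
      rw [← Real.norm_eq_abs]
      refine (ContinuousLinearMap.le_opNorm _ _).trans ?_
      rw [mul_assoc]
      refine mul_le_mul (hD _) ?_ (norm_nonneg _) hD0
      have := hC₂ s z
      rwa [clampedField_of_mem K f hb (Set.Ioo_subset_Icc_self hs')] at this
    rw [← hgint s _ hu, ← integral_sub i3 i2]
    simp only [mul_sub]

end IsProbabilitySolution

end Characteristics

section LawOfLargeNumbers

variable {E : Type*} [NormedAddCommGroup E] [InnerProductSpace ℝ E] [FiniteDimensional ℝ E]
  [MeasurableSpace E] [BorelSpace E] {μ : Measure E} [IsProbabilityMeasure μ] {N : ℕ}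

lemma integrable_pi_eval (h2 : Integrable (fun z : E => ‖z‖ ^ 2) μ) (i : Fin N) :
    Integrable (fun Z : Fin N → E => ‖Z i‖ ^ 2) (Measure.pi fun _ => μ) :=
  ((measurePreserving_eval (fun _ : Fin N => μ) i).integrable_comp
    h2.aestronglyMeasurable).2 h2

lemma integral_pi_eval (h2 : Integrable (fun z : E => ‖z‖ ^ 2) μ) (i : Fin N) :
    ∫ Z : Fin N → E, ‖Z i‖ ^ 2 ∂(Measure.pi fun _ => μ) = ∫ z, ‖z‖ ^ 2 ∂μ := by
  have h := measurePreserving_eval (fun _ : Fin N => μ) i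
  have h3 := h.aemeasurable
  have := integral_map (f := fun z : E => ‖z‖ ^ 2) h3 (by rw [h.map_eq]; exact h2.aestronglyMeasurable)
  rw [h.map_eq] at this
  exact this.symm

variable {G : E → E → E} (hG : Continuous fun p : E × E => G p.1 p.2) {A : ℝ}
  (hA : ∀ y w, ‖G y w‖ ≤ A * (1 + ‖y‖ + ‖w‖)) (h0 : ∀ y, ∫ w, G y w ∂μ = 0)
  (h2 : Integrable (fun z : E => ‖z‖ ^ 2) μ)

include hA in
lemma norm_sq_le_of_norm_le_one_add (y w : E) :
    ‖G y w‖ ^ 2 ≤ 3 * A ^ 2 * (1 + ‖y‖ ^ 2 + ‖w‖ ^ 2) := by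
  have h1 := pow_le_pow_left₀ (norm_nonneg _) (hA y w) 2
  nlinarith [mul_nonneg (sq_nonneg A) (add_nonneg (add_nonneg (sq_nonneg (1 - ‖y‖))
    (sq_nonneg (1 - ‖w‖))) (sq_nonneg (‖y‖ - ‖w‖)))]

include hG in
lemma continuous_pair (i j : Fin N) : Continuous fun Z : Fin N → E => G (Z i) (Z j) :=
  hG.comp (f := fun Z : Fin N → E => (Z i, Z j)) (by fun_prop)

include hG hA h2 in
lemma integrable_norm_sq_pair (i j : Fin N) :
    Integrable (fun Z : Fin N → E => ‖G (Z i) (Z j)‖ ^ 2) (Measure.pi fun _ => μ) := by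
  refine Integrable.mono' (((integrable_const 1).add (integrable_pi_eval h2 i)).add
    (integrable_pi_eval h2 j) |>.const_mul (3 * A ^ 2)) ?_ (Eventually.of_forall fun Z => ?_)
  · exact ((continuous_pair hG i j).norm.pow 2).aestronglyMeasurable
  · rw [Real.norm_of_nonneg (sq_nonneg _)]
    exact norm_sq_le_of_norm_le_one_add hA _ _

include hG hA h2 in
lemma integral_norm_sq_pair_le (i j : Fin N) :
    ∫ Z : Fin N → E, ‖G (Z i) (Z j)‖ ^ 2 ∂(Measure.pi fun _ => μ) ≤
      3 * A ^ 2 * (1 + 2 * ∫ z, ‖z‖ ^ 2 ∂μ) := by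
  have i1 : Integrable (fun Z : Fin N → E => 1 + ‖Z i‖ ^ 2) (Measure.pi fun _ => μ) :=
    (integrable_const 1).add (integrable_pi_eval h2 i)
  calc _ ≤ ∫ Z : Fin N → E, 3 * A ^ 2 * (1 + ‖Z i‖ ^ 2 + ‖Z j‖ ^ 2) ∂(Measure.pi fun _ => μ) :=
        integral_mono (integrable_norm_sq_pair hG hA h2 i j)
          ((i1.add (integrable_pi_eval h2 j)).const_mul _)
          fun Z => norm_sq_le_of_norm_le_one_add hA _ _
    _ = _ := by
        rw [integral_const_mul, integral_add i1 (integrable_pi_eval h2 j),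
          integral_add (integrable_const _) (integrable_pi_eval h2 i), integral_pi_eval h2,
          integral_pi_eval h2]
        simp
        ring_nf
        simp

include hG hA h2 in
lemma integrable_inner_pair (i j k : Fin N) :
    Integrable (fun Z : Fin N → E => (inner ℝ (G (Z i) (Z j)) (G (Z i) (Z k)) : ℝ))
      (Measure.pi fun _ => μ) := by
  refine ((integrable_norm_sq_pair hG hA h2 i j).add
    (integrable_norm_sq_pair hG hA h2 i k)).mono' ?_ (Eventually.of_forall fun Z => ?_)
  · exact ((continuous_pair hG i j).inner (continuous_pair hG i k)).aestronglyMeasurable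
  · have := norm_inner_le_norm (𝕜 := ℝ) (G (Z i) (Z j)) (G (Z i) (Z k))
    simp only [Pi.add_apply]
    nlinarith [sq_nonneg (‖G (Z i) (Z j)‖ - ‖G (Z i) (Z k)‖), norm_nonneg (G (Z i) (Z j)),
      norm_nonneg (G (Z i) (Z k))]

include hG hA h0 h2 in
lemma integral_inner_pair_eq_zero_of_ne {i j k : Fin N} (hij : i ≠ k) (hjk : j ≠ k) :
    ∫ Z : Fin N → E, (inner ℝ (G (Z i) (Z j)) (G (Z i) (Z k)) : ℝ) ∂(Measure.pi fun _ => μ) = 0 := by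
  set P := Measure.pi fun _ : Fin N => μ
  have hind : ProbabilityTheory.iIndepFun (fun (i : Fin N) (Z : Fin N → E) => Z i) P :=
    ProbabilityTheory.iIndepFun_pi (X := fun (_ : Fin N) (z : E) => z) fun _ => aemeasurable_id
  have h1 := hind.indepFun_prodMk (fun i => measurable_pi_apply i) i j k hij hjk
  have hm1 : Measurable fun Z : Fin N → E => (Z i, Z j) :=
    (measurable_pi_apply i).prodMk (measurable_pi_apply j)
  have hm2 : Measurable fun Z : Fin N → E => Z k := measurable_pi_apply k
  rw [ProbabilityTheory.indepFun_iff_map_prod_eq_prod_map_map hm1.aemeasurable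
    hm2.aemeasurable] at h1
  have hc : Continuous fun p : (E × E) × E => (inner ℝ (G p.1.1 p.1.2) (G p.1.1 p.2) : ℝ) :=
    (hG.comp continuous_fst).inner
      (hG.comp ((continuous_fst.comp continuous_fst).prodMk continuous_snd))
  have hk : P.map (fun Z => Z k) = μ := (measurePreserving_eval (fun _ : Fin N => μ) k).map_eq
  have hint := integrable_inner_pair hG hA h2 i j k
  have hint2 : Integrable (fun p : (E × E) × E => (inner ℝ (G p.1.1 p.1.2) (G p.1.1 p.2) : ℝ))
      (P.map fun Z => ((Z i, Z j), Z k)) :=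
    (integrable_map_measure hc.aestronglyMeasurable (hm1.prodMk hm2).aemeasurable).2 hint
  have h3 := integral_map (μ := P) (hm1.prodMk hm2).aemeasurable hc.aestronglyMeasurable
  rw [← h3]
  rw [h1, hk] at hint2 ⊢
  rw [integral_prod _ hint2]
  refine integral_eq_zero_of_ae (Eventually.of_forall fun p => ?_)
  have hi : Integrable (fun w => G p.1 w) μ := by
    have h4 : Integrable (fun w => ‖G p.1 w‖ ^ 2) μ := by
      refine Integrable.mono' (((integrable_const (1 + ‖p.1‖ ^ 2)).add h2).const_mul
        (3 * A ^ 2)) ?_ (Eventually.of_forall fun w => ?_)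
      · exact ((hG.comp (continuous_const.prodMk continuous_id)).norm.pow 2).aestronglyMeasurable
      · rw [Real.norm_of_nonneg (sq_nonneg _)]
        exact norm_sq_le_of_norm_le_one_add hA _ _
    refine ((integrable_const 1).add h4).mono'
      (hG.comp (continuous_const.prodMk continuous_id)).aestronglyMeasurable
      (Eventually.of_forall fun w => ?_)
    simp only [Pi.add_apply]
    nlinarith [sq_nonneg (‖G p.1 w‖ - 1), norm_nonneg (G p.1 w)]
  simp only [Pi.zero_apply]
  rw [integral_inner hi, h0, inner_zero_right]

include hG hA h0 h2 in
lemma integral_inner_pair_eq_zero {i j k : Fin N} (hjk : j ≠ k) :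
    ∫ Z : Fin N → E, (inner ℝ (G (Z i) (Z j)) (G (Z i) (Z k)) : ℝ) ∂(Measure.pi fun _ => μ) = 0 := by
  by_cases hik : i = k
  · rw [← integral_inner_pair_eq_zero_of_ne hG hA h0 h2 (hik ▸ hjk.symm) hjk.symm]
    exact integral_congr_ae (Eventually.of_forall fun Z => real_inner_comm _ _)
  · exact integral_inner_pair_eq_zero_of_ne hG hA h0 h2 hik hjk

include hG hA h0 h2 in
lemma integral_norm_sq_average_le (hN : 1 ≤ N) (i : Fin N) :
    Integrable (fun Z : Fin N → E => ‖(N : ℝ)⁻¹ • ∑ j, G (Z i) (Z j)‖ ^ 2)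
      (Measure.pi fun _ => μ) ∧
    ∫ Z : Fin N → E, ‖(N : ℝ)⁻¹ • ∑ j, G (Z i) (Z j)‖ ^ 2 ∂(Measure.pi fun _ => μ) ≤
      3 * A ^ 2 * (1 + 2 * ∫ z, ‖z‖ ^ 2 ∂μ) * (N : ℝ)⁻¹ := by
  have hN0 : (0 : ℝ) < N := by exact_mod_cast hN
  have heq : (fun Z : Fin N → E => ‖(N : ℝ)⁻¹ • ∑ j, G (Z i) (Z j)‖ ^ 2) = fun Z =>
      (N : ℝ)⁻¹ ^ 2 * ∑ j, ∑ k, (inner ℝ (G (Z i) (Z j)) (G (Z i) (Z k)) : ℝ) := by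
    funext Z
    rw [norm_smul, mul_pow, Real.norm_eq_abs, sq_abs, ← real_inner_self_eq_norm_sq, sum_inner]
    simp_rw [inner_sum]
  have hi := fun j k => integrable_inner_pair hG hA h2 i j k
  have hi1 := fun j => integrable_finsetSum Finset.univ fun k (_ : k ∈ Finset.univ) => hi j k
  rw [heq]
  refine ⟨(integrable_finsetSum _ fun j _ => hi1 j).const_mul _, ?_⟩
  rw [integral_const_mul, integral_finsetSum _ fun j _ => hi1 j]
  have h3 : ∀ j, ∫ Z : Fin N → E, ∑ k, (inner ℝ (G (Z i) (Z j)) (G (Z i) (Z k)) : ℝ)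
      ∂(Measure.pi fun _ => μ) ≤ 3 * A ^ 2 * (1 + 2 * ∫ z, ‖z‖ ^ 2 ∂μ) := fun j => by
    rw [integral_finsetSum _ fun k _ => hi j k, Finset.sum_eq_single j]
    · simp_rw [real_inner_self_eq_norm_sq]
      exact integral_norm_sq_pair_le hG hA h2 i j
    · exact fun k _ hk => integral_inner_pair_eq_zero hG hA h0 h2 hk.symm
    · simp
  calc _ ≤ (N : ℝ)⁻¹ ^ 2 * ∑ _j : Fin N, 3 * A ^ 2 * (1 + 2 * ∫ z, ‖z‖ ^ 2 ∂μ) :=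
        mul_le_mul_of_nonneg_left (Finset.sum_le_sum fun j _ => h3 j) (by positivity)
    _ = _ := by
        rw [Finset.sum_const, Finset.card_univ, Fintype.card_fin, nsmul_eq_mul]
        field_simp

end LawOfLargeNumbers

section Coupling

lemma le_exp_mul_integral_of_hasDerivAt_le {u u' ρ : ℝ → ℝ} {b c : ℝ} (hb : 0 ≤ b) (hc : 0 ≤ c)
    (hu : ContinuousOn u (Set.Icc 0 b)) (hd : ∀ s ∈ Set.Ioo 0 b, HasDerivAt u (u' s) s)
    (hρ : Continuous ρ) (hρ0 : ∀ s, 0 ≤ ρ s) (hle : ∀ s ∈ Set.Ioo 0 b, u' s ≤ c * u s + ρ s)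
    (h0 : u 0 = 0) : u b ≤ exp (c * b) * ∫ s in (0 : ℝ)..b, ρ s := by
  have hexp : ∀ s, HasDerivAt (fun s => exp (-(c * s))) (exp (-(c * s)) * -c) s := fun s => by
    simpa using (((hasDerivAt_id s).const_mul c).neg).exp
  have hI : ∀ s, HasDerivAt (fun s => ∫ τ in (0 : ℝ)..s, ρ τ) (ρ s) s := fun s =>
    intervalIntegral.integral_hasDerivAt_right (hρ.intervalIntegrable _ _)
      hρ.aestronglyMeasurable.stronglyMeasurableAtFilter hρ.continuousAt
  set g : ℝ → ℝ := fun s => exp (-(c * s)) * u s - ∫ τ in (0 : ℝ)..s, ρ τ with hg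
  have hg' : ∀ s ∈ Set.Ioo 0 b, HasDerivAt g
      (exp (-(c * s)) * -c * u s + exp (-(c * s)) * u' s - ρ s) s := fun s hs =>
    ((hexp s).mul (hd s hs)).sub (hI s)
  have hanti : AntitoneOn g (Set.Icc 0 b) := by
    refine antitoneOn_of_deriv_nonpos (convex_Icc 0 b) ?_ ?_ ?_
    · exact ((continuous_iff_continuousAt.2 fun s => (hexp s).continuousAt).continuousOn.mul
        hu).sub (continuous_iff_continuousAt.2 fun s => (hI s).continuousAt).continuousOn
    · rw [interior_Icc]
      exact fun s hs => (hg' s hs).differentiableAt.differentiableWithinAt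
    · rw [interior_Icc]
      intro s hs
      rw [(hg' s hs).deriv]
      have h1 : exp (-(c * s)) ≤ 1 := exp_le_one_iff.2 (by nlinarith [hs.1])
      nlinarith [hle s hs, exp_pos (-(c * s)), hρ0 s]
  have h1 := hanti (Set.left_mem_Icc.2 hb) (Set.right_mem_Icc.2 hb) hb
  simp only [hg, h0, mul_zero, intervalIntegral.integral_same, sub_zero, sub_nonpos] at h1
  calc u b = exp (c * b) * (exp (-(c * b)) * u b) := by
        rw [← mul_assoc, ← exp_add, add_neg_cancel, exp_zero, one_mul]
    _ ≤ _ := mul_le_mul_of_nonneg_left h1 (exp_pos _).le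

variable {E : Type*} [NormedAddCommGroup E] [InnerProductSpace ℝ E] [FiniteDimensional ℝ E]
  [MeasurableSpace E] [BorelSpace E]

/-- The difference between the empirical force and the field `V` at the `i`-th particle of the
configuration `Y`. -/
def forceResidual {N : ℕ} (K : E × E → E) (V : E → E) (Y : Fin N → E) (i : Fin N) : E :=
  (N : ℝ)⁻¹ • ∑ j, (K (Y i, Y j) - V (Y i))

lemma IsInteractionKernel.inner_average_sub_le {L : ℝ} {K : E × E → E}
    (hK : IsInteractionKernel L K) {N : ℕ} (hN : 1 ≤ N) (V : E → E) (x y : Fin N → E) (i : Fin N) :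
    2 * inner ℝ (x i - y i) ((N : ℝ)⁻¹ • ∑ j, K (x i, x j) - V (y i)) ≤
      (3 * L + 1) * ‖x i - y i‖ ^ 2 + L * ((N : ℝ)⁻¹ * ∑ j, ‖x j - y j‖ ^ 2) +
        ‖forceResidual K V y i‖ ^ 2 := by
  have hL := hK.nonneg
  have hN0 : (0 : ℝ) < N := by exact_mod_cast hN
  set m := (N : ℝ)⁻¹ * ∑ j, ‖x j - y j‖ with hm
  have hm0 : 0 ≤ m := by positivity
  have hm2 : m ^ 2 ≤ (N : ℝ)⁻¹ * ∑ j, ‖x j - y j‖ ^ 2 := by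
    have := sq_sum_le_card_mul_sum_sq (s := Finset.univ) (f := fun j : Fin N => ‖x j - y j‖)
    rw [Finset.card_univ, Fintype.card_fin] at this
    rw [hm, mul_pow]
    calc _ ≤ (N : ℝ)⁻¹ ^ 2 * (N * ∑ j, ‖x j - y j‖ ^ 2) := by gcongr
      _ = _ := by field_simp
  have hcard : (N : ℝ)⁻¹ • ∑ _j : Fin N, V (y i) = V (y i) := by
    rw [Finset.sum_const, Finset.card_univ, Fintype.card_fin, ← Nat.cast_smul_eq_nsmul ℝ, smul_smul,
      inv_mul_cancel₀ hN0.ne', one_smul]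
  have hsplit : (N : ℝ)⁻¹ • ∑ j, K (x i, x j) - V (y i) =
      (N : ℝ)⁻¹ • ∑ j, (K (x i, x j) - K (y i, y j)) + forceResidual K V y i := by
    rw [forceResidual, Finset.sum_sub_distrib, Finset.sum_sub_distrib, smul_sub, smul_sub, hcard]
    abel
  have h1 : ‖(N : ℝ)⁻¹ • ∑ j, (K (x i, x j) - K (y i, y j))‖ ≤ L * ‖x i - y i‖ + L * m := by
    rw [norm_smul, norm_inv, Real.norm_natCast]
    calc _ ≤ (N : ℝ)⁻¹ * ∑ j, (L * ‖x i - y i‖ + L * ‖x j - y j‖) := by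
          refine mul_le_mul_of_nonneg_left ((norm_sum_le _ _).trans
            (Finset.sum_le_sum fun j _ => ?_)) (by positivity)
          rw [← sub_add_sub_cancel _ (K (y i, x j))]
          exact (norm_add_le _ _).trans (add_le_add (hK.norm_sub_left_le _ _ _)
            (hK.norm_sub_right_le _ _ _))
      _ = _ := by
          rw [Finset.sum_add_distrib, Finset.sum_const, Finset.card_univ, Fintype.card_fin,
            nsmul_eq_mul, ← Finset.mul_sum, hm]
          field_simp
  rw [hsplit]
  have h2 := (real_inner_le_norm (x i - y i)
    ((N : ℝ)⁻¹ • ∑ j, (K (x i, x j) - K (y i, y j)) + forceResidual K V y i)).trans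
    (mul_le_mul_of_nonneg_left ((norm_add_le _ _).trans (add_le_add_left h1 _)) (norm_nonneg _))
  generalize ‖x i - y i‖ = p at *
  generalize ‖forceResidual K V y i‖ = q at *
  nlinarith [sq_nonneg (p - q), mul_nonneg hL (sq_nonneg (p - m)),
    mul_le_mul_of_nonneg_left hm2 hL]

lemma IsInteractionKernel.norm_sub_sq_le_integral {L : ℝ} {K : E × E → E}
    (hK : IsInteractionKernel L K) {N : ℕ} (hN : 1 ≤ N) {V : ℝ → E → E} {ξ η : ℝ → Fin N → E}
    {b : ℝ} (hb : 0 ≤ b)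
    (hξ : ∀ s, HasDerivAt ξ (fun i => (N : ℝ)⁻¹ • ∑ j, K (ξ s i, ξ s j)) s)
    (hη : ∀ i, Continuous fun s => η s i)
    (hη' : ∀ i, ∀ s ∈ Set.Ioo 0 b, HasDerivAt (fun s => η s i) (V s (η s i)) s)
    (h0 : ξ 0 = η 0) (hr : ∀ i, Continuous fun s => forceResidual K (V s) (η s) i) (i : Fin N) :
    ‖ξ b i - η b i‖ ^ 2 ≤ exp ((5 * L + 1) * b) * ∫ s in (0 : ℝ)..b,
      (‖forceResidual K (V s) (η s) i‖ ^ 2 + (N : ℝ)⁻¹ * ∑ k, ‖forceResidual K (V s) (η s) k‖ ^ 2) := by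
  have hL := hK.nonneg
  have hN0 : (0 : ℝ) < N := by exact_mod_cast hN
  have hξi : ∀ i s, HasDerivAt (fun s => ξ s i) ((N : ℝ)⁻¹ • ∑ j, K (ξ s i, ξ s j)) s :=
    fun i s => hasDerivAt_pi.1 (hξ s) i
  have hξc : ∀ i, Continuous fun s => ξ s i := fun i =>
    continuous_iff_continuousAt.2 fun s => (hξi i s).continuousAt
  have hc : ∀ i, Continuous fun s => ‖ξ s i - η s i‖ ^ 2 := fun i => ((hξc i).sub (hη i)).norm.pow 2
  have hd : ∀ i, ∀ s ∈ Set.Ioo 0 b, HasDerivAt (fun s => ‖ξ s i - η s i‖ ^ 2)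
      (2 * inner ℝ (ξ s i - η s i) ((N : ℝ)⁻¹ • ∑ j, K (ξ s i, ξ s j) - V s (η s i))) s :=
    fun i s hs => ((hξi i s).sub (hη' i s hs)).norm_sq
  have hmain := le_exp_mul_integral_of_hasDerivAt_le (c := 5 * L + 1)
    (u := fun s => ‖ξ s i - η s i‖ ^ 2 + (N : ℝ)⁻¹ * ∑ k, ‖ξ s k - η s k‖ ^ 2)
    (ρ := fun s => ‖forceResidual K (V s) (η s) i‖ ^ 2 +
      (N : ℝ)⁻¹ * ∑ k, ‖forceResidual K (V s) (η s) k‖ ^ 2)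
    hb (by positivity)
    ((hc i).add (continuous_const.mul (continuous_finsetSum _ fun k _ => hc k))).continuousOn
    (fun s hs => (hd i s hs).add ((HasDerivAt.fun_sum fun k _ => hd k s hs).const_mul (N : ℝ)⁻¹))
    (((hr i).norm.pow 2).add (continuous_const.mul
      (continuous_finsetSum _ fun k _ => (hr k).norm.pow 2)))
    (fun s => by positivity) (fun s hs => ?_) (by simp [h0])
  · refine le_trans ?_ hmain
    simp only [le_add_iff_nonneg_right]
    positivity
  · have h1 := fun k => hK.inner_average_sub_le hN (V s) (ξ s) (η s) k
    have h2 := mul_le_mul_of_nonneg_left (Finset.sum_le_sum fun k (_ : k ∈ Finset.univ) => h1 k)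
      (inv_nonneg.2 hN0.le)
    rw [Finset.sum_add_distrib, Finset.sum_add_distrib, ← Finset.mul_sum (a := 3 * L + 1),
      Finset.sum_const, Finset.card_univ, Fintype.card_fin, nsmul_eq_mul, mul_add, mul_add,
      inv_mul_cancel_left₀ hN0.ne', mul_left_comm _ (3 * L + 1)] at h2
    have h3 := h1 i
    have h4 : 0 ≤ L * ‖ξ s i - η s i‖ ^ 2 := by positivity
    nlinarith

end Coupling

section MeanSquareCoupling

lemma integral_le_of_le_mul_intervalIntegral {Ω : Type*} [MeasurableSpace Ω] {P : Measure Ω}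
    [SFinite P] {g : Ω → ℝ} {ρ : ℝ → Ω → ℝ} {b c D : ℝ} (hb : 0 ≤ b) (hc : 0 ≤ c) (hD : 0 ≤ D)
    (hg : Measurable g) (hg0 : ∀ ω, 0 ≤ g ω) (hρ : Measurable fun p : Ω × ℝ => ρ p.2 p.1)
    (hρc : ∀ ω, Continuous fun s => ρ s ω) (hρ0 : ∀ s ω, 0 ≤ ρ s ω)
    (hle : ∀ ω, g ω ≤ c * ∫ s in (0 : ℝ)..b, ρ s ω)
    (hint : ∀ s ∈ Set.Icc 0 b, Integrable (ρ s) P) (hbound : ∀ s ∈ Set.Icc 0 b, ∫ ω, ρ s ω ∂P ≤ D) :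
    Integrable g P ∧ ∫ ω, g ω ∂P ≤ c * (D * b) := by
  have hm : Measurable fun p : Ω × ℝ => ENNReal.ofReal (ρ p.2 p.1) := hρ.ennreal_ofReal
  have key : ∫⁻ ω, ENNReal.ofReal (g ω) ∂P ≤ ENNReal.ofReal (c * (D * b)) := by
    calc ∫⁻ ω, ENNReal.ofReal (g ω) ∂P
        ≤ ∫⁻ ω, ENNReal.ofReal c * (∫⁻ s in Set.Ioc 0 b, ENNReal.ofReal (ρ s ω)) ∂P := by
          refine lintegral_mono fun ω => ?_
          rw [← ofReal_integral_eq_lintegral_ofReal, ← ENNReal.ofReal_mul hc]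
          · refine ENNReal.ofReal_le_ofReal ?_
            rw [← intervalIntegral.integral_of_le hb]
            exact hle ω
          · exact ((hρc ω).integrableOn_Icc).mono_set Set.Ioc_subset_Icc_self
          · exact Eventually.of_forall fun s => hρ0 s ω
      _ = ENNReal.ofReal c * ∫⁻ s in Set.Ioc 0 b, ∫⁻ ω, ENNReal.ofReal (ρ s ω) ∂P := by
          rw [lintegral_const_mul _ hm.lintegral_prod_right', lintegral_lintegral_swap]
          exact hm.aemeasurable
      _ ≤ ENNReal.ofReal c * ∫⁻ _s in Set.Ioc 0 b, ENNReal.ofReal D := by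
          refine mul_le_mul_right (setLIntegral_mono' measurableSet_Ioc fun s hs => ?_) _
          have hs' := Set.Ioc_subset_Icc_self hs
          rw [← ofReal_integral_eq_lintegral_ofReal (hint s hs') (Eventually.of_forall (hρ0 s))]
          exact ENNReal.ofReal_le_ofReal (hbound s hs')
      _ = _ := by
          rw [setLIntegral_const, Real.volume_Ioc, sub_zero, ← ENNReal.ofReal_mul hD,
            ← ENNReal.ofReal_mul hc]
  have h0 : 0 ≤ᵐ[P] g := Eventually.of_forall hg0
  refine ⟨⟨hg.aestronglyMeasurable, (hasFiniteIntegral_iff_ofReal h0).2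
    (key.trans_lt ENNReal.ofReal_lt_top)⟩, ?_⟩
  rw [integral_eq_lintegral_of_nonneg_ae h0 hg.aestronglyMeasurable]
  exact ENNReal.toReal_le_of_le_ofReal (by positivity) key

variable {E : Type*} [NormedAddCommGroup E] [InnerProductSpace ℝ E] [FiniteDimensional ℝ E]
  [MeasurableSpace E] [BorelSpace E]

/-- The flow of the system of `N` particles interacting through `K`. -/
structure IsParticleFlow (K : E × E → E) (N : ℕ) (T : ℝ → (Fin N → E) → Fin N → E) : Prop where
  measurable : ∀ t, Measurable (T t)
  zero : ∀ Z, T 0 Z = Z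
  hasDerivAt : ∀ Z t, HasDerivAt (fun s => T s Z)
    (fun i => (N : ℝ)⁻¹ • ∑ j, K (T t Z i, T t Z j)) t

namespace IsProbabilitySolution

variable {K : E × E → E} {L : ℝ} {f : ℝ → E → ℝ} (h : IsProbabilitySolution L K f)
include h

lemma integral_kernel_flow (h2 : Integrable fun z => ‖z‖ ^ 2 * f 0 z) {b : ℝ} {hb : 0 ≤ b}
    {X : ℝ → E → E} (hX : IsFlowOn b L (clampedField K f hb) X) {s : ℝ} (hs : s ∈ Set.Icc 0 b)
    (y : E) : Integrable (fun w => K (y, X s w)) (withRealDensity (f 0)) ∧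
      ∫ w, K (y, X s w) ∂withRealDensity (f 0) = clampedField K f hb s y := by
  have hp := h.isProbabilityMeasure 0
  have hc := h.kernel.continuous_right y
  constructor
  · obtain ⟨C, hC0, hC⟩ := hX.exists_norm_le
    have hL := h.kernel.nonneg
    refine ((integrable_const (L * ‖y‖)).add
      ((h.integrable_one_add_norm h2).const_mul (L * C))).mono'
      (hc.comp (hX.continuous s)).aestronglyMeasurable (Eventually.of_forall fun w => ?_)
    simp only [Pi.add_apply]
    calc ‖K (y, X s w)‖ ≤ L * ‖y - X s w‖ := h.kernel.norm_le _ _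
      _ ≤ L * (‖y‖ + C * (1 + ‖w‖)) := mul_le_mul_of_nonneg_left
          ((norm_sub_le _ _).trans (add_le_add_right (hC s hs w) _)) hL
      _ = _ := by ring
  · rw [clampedField_of_mem K f hb hs, h.meanField_eq_integral, h.withRealDensity_eq_map h2 hX hs,
      integral_map (hX.continuous s).aemeasurable hc.aestronglyMeasurable]

lemma exists_integral_norm_forceResidual_le (h2 : Integrable fun z => ‖z‖ ^ 2 * f 0 z) {b : ℝ}
    {hb : 0 ≤ b} {X : ℝ → E → E} (hX : IsFlowOn b L (clampedField K f hb) X) :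
    ∃ C, 0 ≤ C ∧ ∀ N : ℕ, 1 ≤ N → ∀ s ∈ Set.Icc 0 b, ∀ i : Fin N,
      Integrable (fun Z : Fin N → E => ‖forceResidual K (clampedField K f hb s)
        (fun k => X s (Z k)) i‖ ^ 2) (Measure.pi fun _ => withRealDensity (f 0)) ∧
      ∫ Z : Fin N → E, ‖forceResidual K (clampedField K f hb s) (fun k => X s (Z k)) i‖ ^ 2
        ∂(Measure.pi fun _ => withRealDensity (f 0)) ≤ C * (N : ℝ)⁻¹ := by
  have hp := h.isProbabilityMeasure 0
  have hL := h.kernel.nonneg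
  obtain ⟨C, hC0, hC⟩ := hX.exists_norm_le
  obtain ⟨C₁, hC₁0, hC₁⟩ := h.exists_norm_clampedField_le h2 hb
  set A := 2 * L * C + C₁ + C₁ * C with hA
  refine ⟨3 * A ^ 2 * (1 + 2 * ∫ z, ‖z‖ ^ 2 ∂withRealDensity (f 0)), ?_, fun N hN s hs i => ?_⟩
  · have : 0 ≤ ∫ z, ‖z‖ ^ 2 ∂withRealDensity (f 0) := integral_nonneg fun _ => sq_nonneg _
    positivity
  · refine integral_norm_sq_average_le
      (G := fun y w => K (X s y, X s w) - clampedField K f hb s (X s y)) ?_ (A := A)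
      (fun y w => ?_) (fun y => ?_) (h.integrable_norm_sq h2 le_rfl) hN i
    · refine (h.kernel.contDiff.continuous.comp
        (((hX.continuous s).comp continuous_fst).prodMk
          ((hX.continuous s).comp continuous_snd))).sub ?_
      exact (h.continuous_uncurry_clampedField h2 hb).comp
        (continuous_const.prodMk ((hX.continuous s).comp continuous_fst))
    · calc ‖K (X s y, X s w) - clampedField K f hb s (X s y)‖
          ≤ L * (‖X s y‖ + ‖X s w‖) + C₁ * (1 + ‖X s y‖) :=
            (norm_sub_le _ _).trans (add_le_add ((h.kernel.norm_le _ _).trans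
              (mul_le_mul_of_nonneg_left (norm_sub_le _ _) hL)) (hC₁ _ _))
        _ ≤ L * (C * (1 + ‖y‖) + C * (1 + ‖w‖)) + C₁ * (1 + C * (1 + ‖y‖)) := by
            gcongr <;> exact hC s hs _
        _ ≤ A * (1 + ‖y‖ + ‖w‖) := by
            rw [hA]
            have := mul_nonneg hL hC0
            have := mul_nonneg hC₁0 hC0
            nlinarith [norm_nonneg y, norm_nonneg w, mul_nonneg this (norm_nonneg w),
              mul_nonneg (mul_nonneg hL hC0) (norm_nonneg w),
              mul_nonneg (mul_nonneg hL hC0) (norm_nonneg y), mul_nonneg hC₁0 (norm_nonneg w),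
              mul_nonneg hC₁0 (norm_nonneg y)]
    · obtain ⟨h3, h4⟩ := h.integral_kernel_flow h2 hX hs (X s y)
      rw [integral_sub h3 (integrable_const _), h4, integral_const, probReal_univ, one_smul,
        sub_self]

lemma exists_integral_norm_sub_sq_le (h2 : Integrable fun z => ‖z‖ ^ 2 * f 0 z) {b : ℝ}
    {hb : 0 ≤ b} {X : ℝ → E → E} (hX : IsFlowOn b L (clampedField K f hb) X) :
    ∃ C, 0 ≤ C ∧ ∀ N : ℕ, 1 ≤ N → ∀ T : ℝ → (Fin N → E) → Fin N → E, IsParticleFlow K N T →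
      ∀ i : Fin N,
      Integrable (fun Z : Fin N → E => ‖T b Z i - X b (Z i)‖ ^ 2)
        (Measure.pi fun _ => withRealDensity (f 0)) ∧
      ∫ Z : Fin N → E, ‖T b Z i - X b (Z i)‖ ^ 2
        ∂(Measure.pi fun _ => withRealDensity (f 0)) ≤ C * (N : ℝ)⁻¹ := by
  have hp := h.isProbabilityMeasure 0
  have hL := h.kernel.nonneg
  obtain ⟨C, hC0, hC⟩ := h.exists_integral_norm_forceResidual_le h2 hX
  refine ⟨exp ((5 * L + 1) * b) * (2 * C * b), by positivity, fun N hN T hT i => ?_⟩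
  have hN0 : (0 : ℝ) < N := by exact_mod_cast hN
  have hXc : ∀ k : Fin N, Continuous fun p : (Fin N → E) × ℝ => X p.2 (p.1 k) := fun k =>
    hX.continuous_uncurry.comp (f := fun p : (Fin N → E) × ℝ => (p.2, p.1 k)) (by fun_prop)
  have hrc : ∀ k : Fin N, Continuous fun p : (Fin N → E) × ℝ =>
      forceResidual K (clampedField K f hb p.2) (fun k => X p.2 (p.1 k)) k := fun k => by
    refine (continuous_finsetSum _ fun j _ => ?_).const_smul _
    exact (h.kernel.contDiff.continuous.comp ((hXc k).prodMk (hXc j))).sub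
      ((h.continuous_uncurry_clampedField h2 hb).comp (continuous_snd.prodMk (hXc k)))
  have hρc : Continuous fun p : (Fin N → E) × ℝ =>
      ‖forceResidual K (clampedField K f hb p.2) (fun k => X p.2 (p.1 k)) i‖ ^ 2 + (N : ℝ)⁻¹ *
        ∑ k, ‖forceResidual K (clampedField K f hb p.2) (fun k => X p.2 (p.1 k)) k‖ ^ 2 :=
    ((hrc i).norm.pow 2).add (continuous_const.mul
      (continuous_finsetSum _ fun k _ => (hrc k).norm.pow 2))
  have hslice : ∀ Z : Fin N → E, Continuous fun s : ℝ => (Z, s) := fun Z => by fun_prop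
  have key := integral_le_of_le_mul_intervalIntegral
    (P := Measure.pi fun _ : Fin N => withRealDensity (f 0))
    (g := fun Z : Fin N → E => ‖T b Z i - X b (Z i)‖ ^ 2)
    (ρ := fun s Z => ‖forceResidual K (clampedField K f hb s) (fun k => X s (Z k)) i‖ ^ 2 +
      (N : ℝ)⁻¹ * ∑ k, ‖forceResidual K (clampedField K f hb s) (fun k => X s (Z k)) k‖ ^ 2)
    (c := exp ((5 * L + 1) * b)) (D := 2 * C * (N : ℝ)⁻¹) hb (exp_pos _).le (by positivity)
    ?_ (fun _ => sq_nonneg _) hρc.measurable (fun Z => hρc.comp (hslice Z))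
    (fun s Z => by positivity)
    (fun Z => h.kernel.norm_sub_sq_le_integral hN hb (hT.hasDerivAt Z)
      (fun k => hX.continuous_time (Z k)) (fun k s hs => hX.hasDerivAt (Z k) s hs)
      ?_ (fun k => (hrc k).comp (hslice Z)) i)
    (fun s hs => ?_) (fun s hs => ?_)
  · refine ⟨key.1, key.2.trans (le_of_eq (by ring))⟩
  · exact (((measurable_pi_apply i).comp (hT.measurable b)).sub
      ((hX.continuous b).measurable.comp (measurable_pi_apply i))).norm.pow_const 2
  · rw [hT.zero]
    funext k
    exact (hX.zero _).symm
  · exact (hC N hN s hs i).1.add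
      ((integrable_finsetSum _ fun k _ => (hC N hN s hs k).1).const_mul _)
  · rw [integral_add (hC N hN s hs i).1
      ((integrable_finsetSum _ fun k _ => (hC N hN s hs k).1).const_mul _), integral_const_mul,
      integral_finsetSum _ fun k _ => (hC N hN s hs k).1]
    have h5 := Finset.sum_le_sum fun k (_ : k ∈ Finset.univ) => (hC N hN s hs k).2
    rw [Finset.sum_const, Finset.card_univ, Fintype.card_fin, nsmul_eq_mul] at h5
    have h6 := mul_le_mul_of_nonneg_left h5 (inv_nonneg.2 hN0.le)
    rw [inv_mul_cancel_left₀ hN0.ne'] at h6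
    linarith [(hC N hN s hs i).2]

end IsProbabilitySolution

end MeanSquareCoupling

section Chaos

variable {E : Type*} [NormedAddCommGroup E] [InnerProductSpace ℝ E] [FiniteDimensional ℝ E]
  [MeasurableSpace E] [BorelSpace E]

lemma map_pi_comp_castLE {μ : Measure E} [IsProbabilityMeasure μ] {j N : ℕ} (hj : j ≤ N)
    {Y : E → E} (hY : Measurable Y) :
    (Measure.pi fun _ : Fin N => μ).map (fun Z (i : Fin j) => Y (Z (Fin.castLE hj i))) =
      Measure.pi fun _ => μ.map Y := by
  have hind : ProbabilityTheory.iIndepFun (fun (k : Fin N) (Z : Fin N → E) => Y (Z k))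
      (Measure.pi fun _ : Fin N => μ) :=
    ProbabilityTheory.iIndepFun_pi (X := fun (_ : Fin N) => Y) fun _ => hY.aemeasurable
  have h1 := hind.precomp (g := Fin.castLE hj) (Fin.castLE_injective hj)
  have hm : ∀ k : Fin N, Measurable fun Z : Fin N → E => Y (Z k) := fun k =>
    hY.comp (measurable_pi_apply k)
  rw [ProbabilityTheory.iIndepFun_iff_map_fun_eq_pi_map fun i => (hm _).aemeasurable] at h1
  refine h1.trans ?_
  congr 1
  funext i
  have h2 := (measurePreserving_eval (fun _ : Fin N => μ) (Fin.castLE hj i)).map_eq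
  conv_rhs => rw [← h2]
  rw [Measure.map_map hY (measurable_pi_apply _)]
  rfl

lemma abs_integral_comp_sub_le {Ω : Type*} [MeasurableSpace Ω] {P : Measure Ω}
    [IsProbabilityMeasure P] {j : ℕ} {ξ η : Ω → Fin j → E} (hξ : Measurable ξ) (hη : Measurable η)
    {Φ : (Fin j → E) → ℝ} {M : ℝ≥0} (hΦ : LipschitzWith M Φ) {B : ℝ} (hB : ∀ w, |Φ w| ≤ B)
    {D ε : ℝ} (hε : 0 < ε)
    (hD : ∀ i, Integrable (fun ω => ‖ξ ω i - η ω i‖ ^ 2) P ∧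
      ∫ ω, ‖ξ ω i - η ω i‖ ^ 2 ∂P ≤ D) :
    |∫ ω, Φ (ξ ω) ∂P - ∫ ω, Φ (η ω) ∂P| ≤ M * (j * (ε + ε⁻¹ * D)) := by
  have hint : ∀ {ζ : Ω → Fin j → E}, Measurable ζ → Integrable (fun ω => Φ (ζ ω)) P := fun hζ =>
    (integrable_const B).mono' (hΦ.continuous.measurable.comp hζ).aestronglyMeasurable
      (Eventually.of_forall fun ω => hB _)
  have hi : ∀ i, Integrable (fun ω => ε + ε⁻¹ * ‖ξ ω i - η ω i‖ ^ 2) P := fun i =>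
    (integrable_const _).add ((hD i).1.const_mul _)
  rw [← integral_sub (hint hξ) (hint hη), ← Real.norm_eq_abs]
  calc _ ≤ ∫ ω, M * ∑ i, (ε + ε⁻¹ * ‖ξ ω i - η ω i‖ ^ 2) ∂P := by
        refine norm_integral_le_of_norm_le ((integrable_finsetSum _ fun i _ => hi i).const_mul _)
          (Eventually.of_forall fun ω => ?_)
        rw [← dist_eq_norm]
        refine (hΦ.dist_le_mul _ _).trans (mul_le_mul_of_nonneg_left ?_ M.2)
        have hsum : ∀ i, 0 ≤ ε + ε⁻¹ * ‖ξ ω i - η ω i‖ ^ 2 := fun i => by positivity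
        refine (dist_pi_le_iff (Finset.sum_nonneg fun i _ => hsum i)).2 fun i => ?_
        refine le_trans ?_ (Finset.single_le_sum (fun i _ => hsum i) (Finset.mem_univ i))
        rw [dist_eq_norm]
        generalize ‖ξ ω i - η ω i‖ = p
        have h1 : ε⁻¹ * p ^ 2 + ε - p = ε⁻¹ * ((p - ε / 2) ^ 2 + 3 / 4 * ε ^ 2) := by
          field_simp
          ring
        have h2 : 0 ≤ ε⁻¹ * ((p - ε / 2) ^ 2 + 3 / 4 * ε ^ 2) := by positivity
        linarith
    _ = M * ∑ i, (ε + ε⁻¹ * ∫ ω, ‖ξ ω i - η ω i‖ ^ 2 ∂P) := by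
        rw [integral_const_mul, integral_finsetSum _ fun i _ => hi i]
        congr 2
        funext i
        rw [integral_add (integrable_const _) ((hD i).1.const_mul _), integral_const_mul]
        simp
    _ ≤ M * ∑ _i : Fin j, (ε + ε⁻¹ * D) := by
        gcongr with i _
        exact (hD i).2
    _ = _ := by rw [Finset.sum_const, Finset.card_univ, Fintype.card_fin, nsmul_eq_mul]

theorem IsProbabilitySolution.tendsto_integral_particles {K : E × E → E} {L : ℝ} {f : ℝ → E → ℝ}
    (h : IsProbabilitySolution L K f) (h2 : Integrable fun z => ‖z‖ ^ 2 * f 0 z)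
    {T : (N : ℕ) → ℝ → (Fin N → E) → Fin N → E} (hT : ∀ N, 1 ≤ N → IsParticleFlow K N (T N))
    {j : ℕ} (hj : 1 ≤ j) {t : ℝ} (ht : 0 ≤ t) {Φ : (Fin j → E) → ℝ} (hΦ : Continuous Φ)
    (hb : ∃ C : ℝ, ∀ w, |Φ w| ≤ C) :
    Tendsto (fun N : ℕ => ∫ Z, Φ (fun i => T (N + j) t Z (Fin.castLE (Nat.le_add_left j N) i))
      ∂(Measure.pi fun _ : Fin (N + j) => withRealDensity (f 0))) atTop
      (𝓝 (∫ w, Φ w ∂(Measure.pi fun _ : Fin j => withRealDensity (f t)))) := by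
  have hp := fun s => h.isProbabilityMeasure s
  obtain ⟨X, hX⟩ := h.exists_isFlowOn_clampedField h2 ht
  obtain ⟨C, hC0, hC⟩ := h.exists_integral_norm_sub_sq_le h2 hX
  have hTm : ∀ N, Measurable fun (Z : Fin (N + j) → E) (i : Fin j) =>
      T (N + j) t Z (Fin.castLE (Nat.le_add_left j N) i) := fun N =>
    measurable_pi_lambda _ fun i =>
      (measurable_pi_apply _).comp ((hT (N + j) (by lia)).measurable t)
  have hXm : ∀ N, Measurable fun (Z : Fin (N + j) → E) (i : Fin j) =>
      X t (Z (Fin.castLE (Nat.le_add_left j N) i)) := fun N =>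
    measurable_pi_lambda _ fun i =>
      (hX.continuous t).measurable.comp (measurable_pi_apply _)
  let ν : ℕ → ProbabilityMeasure (Fin j → E) := fun N =>
    ⟨(Measure.pi fun _ : Fin (N + j) => withRealDensity (f 0)).map
      (fun Z i => T (N + j) t Z (Fin.castLE (Nat.le_add_left j N) i)),
      Measure.isProbabilityMeasure_map (hTm N).aemeasurable⟩
  let ν' : ProbabilityMeasure (Fin j → E) :=
    ⟨Measure.pi fun _ : Fin j => withRealDensity (f t), inferInstance⟩
  have hν : Tendsto ν atTop (𝓝 ν') := by
    rw [tendsto_iff_forall_lipschitz_integral_tendsto]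
    rintro Ψ ⟨B, hB⟩ ⟨M, hM⟩
    have hB' : ∀ w, |Ψ w| ≤ |Ψ 0| + B := fun w => by
      have h3 := hB w 0
      rw [Real.dist_eq] at h3
      have h4 := abs_add_le (Ψ w - Ψ 0) (Ψ 0)
      rw [sub_add_cancel] at h4
      linarith
    have hlaw : ∀ N : ℕ, ∫ w, Ψ w ∂(ν' : Measure (Fin j → E)) =
        ∫ Z, Ψ (fun i => X t (Z (Fin.castLE (Nat.le_add_left j N) i)))
          ∂(Measure.pi fun _ : Fin (N + j) => withRealDensity (f 0)) := fun N => by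
      rw [← integral_map (hXm N).aemeasurable hM.continuous.aestronglyMeasurable,
        map_pi_comp_castLE _ (hX.continuous t).measurable,
        ← h.withRealDensity_eq_map h2 hX ⟨ht, le_rfl⟩]
      rfl
    have hlaw' : ∀ N : ℕ, ∫ w, Ψ w ∂(ν N : Measure (Fin j → E)) =
        ∫ Z, Ψ (fun i => T (N + j) t Z (Fin.castLE (Nat.le_add_left j N) i))
          ∂(Measure.pi fun _ : Fin (N + j) => withRealDensity (f 0)) := fun N =>
      integral_map (hTm N).aemeasurable hM.continuous.aestronglyMeasurable
    have hlim : Tendsto (fun N : ℕ => M * (j * ((1 + C) * (√((N + j : ℕ) : ℝ))⁻¹))) atTop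
        (𝓝 0) := by
      have h3 := (tendsto_inv_atTop_zero.comp (Real.tendsto_sqrt_atTop.comp
        (tendsto_natCast_atTop_atTop (R := ℝ)))).comp (tendsto_add_atTop_nat j)
      simpa using ((h3.const_mul (1 + C)).const_mul (j : ℝ)).const_mul (M : ℝ)
    refine tendsto_iff_dist_tendsto_zero.2 (squeeze_zero (fun _ => dist_nonneg) (fun N => ?_) hlim)
    have hn : (0 : ℝ) < ((N + j : ℕ) : ℝ) := by
      have : 0 < N + j := by lia
      exact_mod_cast this
    rw [Real.dist_eq, hlaw N, hlaw' N]
    refine (abs_integral_comp_sub_le (hTm N) (hXm N) hM hB'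
      (ε := (√((N + j : ℕ) : ℝ))⁻¹) (by positivity)
      fun i => hC (N + j) (by lia) _ (hT (N + j) (by lia)) _).trans (le_of_eq ?_)
    rw [inv_inv]
    have h5 : √((N + j : ℕ) : ℝ) * (C * ((N + j : ℕ) : ℝ)⁻¹) = C * (√((N + j : ℕ) : ℝ))⁻¹ := by
      have h6 := Real.mul_self_sqrt hn.le
      have h7 := Real.sqrt_pos.2 hn
      field_simp
      rw [sq, h6, mul_comm]
    rw [h5]
    ring
  obtain ⟨B, hB⟩ := hb
  have h3 := ProbabilityMeasure.tendsto_iff_forall_integral_tendsto.1 hν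
    (BoundedContinuousFunction.ofNormedAddCommGroup Φ hΦ B hB)
  refine h3.congr fun N => ?_
  exact integral_map (hTm N).aemeasurable hΦ.aestronglyMeasurable

end Chaos

section TimeReversal

variable {E : Type*} [NormedAddCommGroup E] [InnerProductSpace ℝ E] [FiniteDimensional ℝ E]
  [MeasurableSpace E] [BorelSpace E] {K : E × E → E} {L : ℝ}

lemma IsInteractionKernel.neg (hK : IsInteractionKernel L K) : IsInteractionKernel L (-K) where
  nonneg := hK.nonneg
  contDiff := hK.contDiff.neg
  antisymm z z' := by simp [← hK.antisymm z' z]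
  fderiv_left z z' := by
    have := hK.fderiv_left z z'
    simpa [fderiv_fun_neg] using this
  fderiv_right z z' := by
    have := hK.fderiv_right z z'
    simpa [fderiv_fun_neg] using this

lemma meanField_neg (K : E × E → E) (g : E → ℝ) (z : E) :
    meanField (-K) g z = -meanField K g z := by
  simp [meanField, integral_neg]

lemma IsMeanFieldSolution.reverse {f : ℝ → E → ℝ} (hf : IsMeanFieldSolution K f) :
    IsMeanFieldSolution (-K) fun t => f (-t) where
  integrable t := hf.integrable (-t)
  hasDerivAt φ hφ t := by
    refine ((hf.hasDerivAt φ hφ (-t)).comp t (hasDerivAt_neg t)).congr_deriv ?_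
    rw [mul_neg_one, ← integral_neg]
    simp [meanField_neg]

lemma IsProbabilitySolution.reverse {f : ℝ → E → ℝ} (h : IsProbabilitySolution L K f) :
    IsProbabilitySolution L (-K) fun t => f (-t) where
  kernel := h.kernel.neg
  solution := h.solution.reverse
  ae_nonneg t := h.ae_nonneg (-t)
  integral_eq_one t := h.integral_eq_one (-t)

lemma IsParticleFlow.reverse {N : ℕ} {T : ℝ → (Fin N → E) → Fin N → E}
    (hT : IsParticleFlow K N T) : IsParticleFlow (-K) N fun t => T (-t) where
  measurable t := hT.measurable (-t)
  zero Z := by rw [neg_zero, hT.zero]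
  hasDerivAt Z t := by
    refine ((hT.hasDerivAt Z (-t)).scomp t (hasDerivAt_neg t)).congr_deriv ?_
    funext i
    simp

end TimeReversal

lemma densMeasure_eq_withRealDensity {d : ℕ} (g : EuclideanSpace ℝ (Fin d) → ℝ) :
    densMeasure g = withRealDensity g := rfl

lemma integral_marginal {d N j : ℕ} (hj : j ≤ N) {P : Measure (Fin N → EuclideanSpace ℝ (Fin d))}
    {S : (Fin N → EuclideanSpace ℝ (Fin d)) → Fin N → EuclideanSpace ℝ (Fin d)}
    (hS : Measurable S) {Φ : (Fin j → EuclideanSpace ℝ (Fin d)) → ℝ} (hΦ : Continuous Φ) :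
    ∫ w, Φ w ∂(marginal N j (P.map S)) = ∫ Z, Φ (fun i => S Z (Fin.castLE hj i)) ∂P := by
  have hp : Measurable fun (z : Fin N → EuclideanSpace ℝ (Fin d)) (i : Fin j) =>
      z (Fin.castLE hj i) := measurable_pi_lambda _ fun i => measurable_pi_apply _
  rw [marginal, dif_pos hj, Measure.map_map hp hS,
    integral_map (hp.comp hS).aemeasurable hΦ.aestronglyMeasurable]
  rfl

lemma integrable_norm_sq_mul_of_higher_moment {E : Type*} [NormedAddCommGroup E]
    [MeasurableSpace E] [BorelSpace E] {μ : Measure E} {g : E → ℝ} {n : ℕ} (hn : 2 ≤ n)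
    (hg0 : ∀ z, 0 ≤ g z)
    (hg : Integrable g μ) (hgn : Integrable (fun z => ‖z‖ ^ n * g z) μ) :
    Integrable (fun z => ‖z‖ ^ 2 * g z) μ := by
  refine (hg.add hgn).mono' ((by fun_prop : Continuous fun z : E => ‖z‖ ^ 2).measurable.aestronglyMeasurable.mul
    hg.aestronglyMeasurable) (Eventually.of_forall fun z => ?_)
  rw [Real.norm_of_nonneg (mul_nonneg (sq_nonneg _) (hg0 z)), Pi.add_apply, ← one_add_mul]
  refine mul_le_mul_of_nonneg_right ?_ (hg0 z)
  rcases le_total ‖z‖ 1 with h | h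
  · have := pow_le_one₀ (n := 2) (norm_nonneg z) h
    have := pow_nonneg (norm_nonneg z) n
    linarith
  · have := pow_le_pow_right₀ h hn
    linarith

/-- propagation of chaos: let `F_N(t) = T_t#(fin·Leb)^{⊗N}` where
`T_t` is the `N`-particle flow and `fin` is a probability density with finite
moment of order `d+5`, and let `f` be the weak solution of the mean field PDE
with initial data `fin`.  Then for each `j ≥ 1` and each `t`, the `j`-particle
marginal `F_{N:j}(t)` converges weakly to `(f(t,·)·Leb)^{⊗j}` as `N → ∞`. -/
theorem stmt14 (d : ℕ) (L : ℝ) (hL : 0 ≤ L)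
    (K : EuclideanSpace ℝ (Fin d) × EuclideanSpace ℝ (Fin d) → EuclideanSpace ℝ (Fin d))
    (hK : ContDiff ℝ 1 K)
    (hK1 : ∀ z z' : EuclideanSpace ℝ (Fin d), K (z, z') = - K (z', z))
    (hK2 : (∀ z z' : EuclideanSpace ℝ (Fin d), ‖fderiv ℝ (fun w => K (w, z')) z‖ ≤ L) ∧
           (∀ z z' : EuclideanSpace ℝ (Fin d), ‖fderiv ℝ (fun w => K (z, w)) z'‖ ≤ L))
    (fin : EuclideanSpace ℝ (Fin d) → ℝ)
    (hfin_nonneg : ∀ z, 0 ≤ fin z) (hfin_int : Integrable fin)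
    (hfin_prob : ∫ z, fin z = 1)
    (hfin_mom : Integrable (fun z => ‖z‖ ^ (d + 5) * fin z))
    -- the N-particle flows
    (T : (N : ℕ) → ℝ → (Fin N → EuclideanSpace ℝ (Fin d)) →
      (Fin N → EuclideanSpace ℝ (Fin d)))
    (hTmeas : ∀ N t, Measurable (T N t))
    (hT0 : ∀ N Z, T N 0 Z = Z)
    (hTode : ∀ N : ℕ, 1 ≤ N → ∀ Z t, HasDerivAt (fun s => T N s Z)
      (fun i => (N : ℝ)⁻¹ • ∑ j : Fin N, K (T N t Z i, T N t Z j)) t)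
    -- the solution of the mean field PDE with initial data fin
    (f : ℝ → EuclideanSpace ℝ (Fin d) → ℝ)
    (hf_int : ∀ t, Integrable (f t))
    (hf0 : f 0 =ᵐ[(volume : Measure (EuclideanSpace ℝ (Fin d)))] fin)
    (hf : IsWeakMeanFieldSol K f) :
    ∀ j : ℕ, 1 ≤ j → ∀ t : ℝ,
      ∀ Φ : (Fin j → EuclideanSpace ℝ (Fin d)) → ℝ, Continuous Φ →
        (∃ C : ℝ, ∀ w, |Φ w| ≤ C) →
        Tendsto (fun N : ℕ =>
            ∫ w, Φ w ∂(marginal N j (Measure.map (T N t)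
              (Measure.pi (fun _ : Fin N => densMeasure fin)))))
          atTop
          (𝓝 (∫ w, Φ w ∂(Measure.pi (fun _ : Fin j => densMeasure (f t))))) := by
  intro j hj t Φ hΦ hb
  have hker : IsInteractionKernel L K := ⟨hL, hK, hK1, hK2.1, hK2.2⟩
  have hsol : IsMeanFieldSolution K f :=
    ⟨hf_int, fun φ hφ t => hf φ hφ.contDiff hφ.bounded hφ.fderiv_bounded t⟩
  have h0 : 0 ≤ᵐ[volume] f 0 := by
    filter_upwards [hf0] with z hz
    rw [hz]
    exact hfin_nonneg z
  have h : IsProbabilitySolution L K f := ⟨hker, hsol, hsol.ae_nonneg hker h0, fun s => by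
    rw [hsol.integral_eq s 0, integral_congr_ae hf0, hfin_prob]⟩
  have h2 : Integrable fun z => ‖z‖ ^ 2 * f 0 z := by
    refine (integrable_norm_sq_mul_of_higher_moment (by lia) hfin_nonneg hfin_int hfin_mom).congr ?_
    filter_upwards [hf0] with z hz
    rw [hz]
  have hT : ∀ N, 1 ≤ N → IsParticleFlow K N (T N) := fun N hN => ⟨hTmeas N, hT0 N, hTode N hN⟩
  have hinit : densMeasure fin = withRealDensity (f 0) := by
    rw [densMeasure_eq_withRealDensity]
    refine withDensity_congr_ae ?_
    filter_upwards [hf0] with z hz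
    rw [hz]
  rw [← tendsto_add_atTop_iff_nat j]
  simp only [hinit, densMeasure_eq_withRealDensity,
    integral_marginal (Nat.le_add_left j _) (hTmeas _ _) hΦ]
  rcases le_total 0 t with ht | ht
  · exact h.tendsto_integral_particles h2 hT hj ht hΦ hb
  · have key := h.reverse.tendsto_integral_particles (by simpa using h2)
      (fun N hN => (hT N hN).reverse) hj (neg_nonneg.2 ht) hΦ hb
    simpa only [neg_neg, neg_zero] using key
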